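/- Let ω be a free ultrafilter on ℕ and let N ⊆ M be an inclusion of hyperfinite II₁ factors such that no corner of M embeds into N inside M (M ⊀_M N). Then no corner of the central sequence algebra M' ∩ M^ω embeds into N^ω inside M^ω. In particular, if M' ∩ M^ω ⊆ N^ω, then a corner of M embeds into N inside M (M ≺_M N). -/

import Mathlib

open scoped ComplexOrder
open Filter

namespace PopaQ

variable {H : Type u} [NormedAddCommGroup H] [InnerProductSpace ℂ H] [CompleteSpace H]

/-- Bounded operators on `H`. -/
abbrev Op (H : Type u) [NormedAddCommGroup H] [InnerProductSpace ℂ H] [CompleteSpace H] :=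
  H →L[ℂ] H

/-- The relative commutant `N' ∩ M` (as sets of operators). -/
def relComm (N M : Set (Op H)) : Set (Op H) :=
  {x | x ∈ M ∧ ∀ y ∈ N, y * x = x * y}

/-- The scalar operators `ℂ 1`. -/
def scalars (H : Type u) [NormedAddCommGroup H] [InnerProductSpace ℂ H] [CompleteSpace H] :
    Set (Op H) :=
  {x | ∃ c : ℂ, x = c • (1 : Op H)}

/-- A (self-adjoint) projection. -/
def IsProjection (p : Op H) : Prop :=
  IsSelfAdjoint p ∧ IsIdempotentElem p

/-- `τ` is a faithful tracial state on `M`. -/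
structure IsTracialState (M : Set (Op H)) (τ : Op H →ₗ[ℂ] ℂ) : Prop where
  map_one : τ 1 = 1
  tracial : ∀ x ∈ M, ∀ y ∈ M, τ (x * y) = τ (y * x)
  pos : ∀ x ∈ M, 0 ≤ τ (star x * x)
  faithful : ∀ x ∈ M, τ (star x * x) = 0 → x = 0

/-- A set of operators is finite dimensional as a complex vector space. -/
def FinDim (S : Set (Op H)) : Prop :=
  ∃ s : Finset (Op H), S ⊆ (Submodule.span ℂ (s : Set (Op H)) : Set (Op H))

/-- `M` is a II₁ factor with faithful normal trace `τ`:
a factor (trivial center) carrying a faithful tracial state, which is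
infinite dimensional. -/
structure IsII1Factor (M : VonNeumannAlgebra H) (τ : Op H →ₗ[ℂ] ℂ) : Prop where
  factor : relComm (M : Set (Op H)) (M : Set (Op H)) = scalars H
  trace : IsTracialState (M : Set (Op H)) τ
  infdim : ¬ FinDim (M : Set (Op H))

/-- `M` is hyperfinite: it is the (weak closure = double commutant) of an increasing
union of finite-dimensional *-subalgebras. -/
def IsHyperfinite (M : VonNeumannAlgebra H) : Prop :=
  ∃ A : ℕ → StarSubalgebra ℂ (Op H),
    Monotone A ∧ (∀ n, (A n : Set (Op H)) ⊆ M) ∧ (∀ n, FinDim (A n : Set (Op H))) ∧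
    Set.centralizer (Set.centralizer (⋃ n, (A n : Set (Op H)))) = (M : Set (Op H))

/-- A bounded sequence of operators. -/
def Bdd (x : ℕ → Op H) : Prop :=
  ∃ C : ℝ, ∀ n, ‖x n‖ ≤ C

/-- A sequence taking values in `S`. -/
def SeqIn (S : Set (Op H)) (x : ℕ → Op H) : Prop :=
  ∀ n, x n ∈ S

/-- A free ultrafilter on ℕ. -/
def IsFreeUltrafilter (ω : Ultrafilter ℕ) : Prop :=
  ∀ s : Set ℕ, s.Finite → s ∉ ω

/-- `Mω` is the tracial ultrapower of `M` along `ω`, with trace `τ`;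
`limω` assigns to each bounded sequence in `M` its class in `Mω` (the diagonal
embedding of `M` into `Mω` being the identity on `M`). -/
structure IsTracialUltrapower (ω : Ultrafilter ℕ) (M Mω : VonNeumannAlgebra H)
    (τ : Op H →ₗ[ℂ] ℂ) (limω : (ℕ → Op H) → Op H) : Prop where
  subset : (M : Set (Op H)) ⊆ (Mω : Set (Op H))
  mem : ∀ x, SeqIn (M : Set (Op H)) x → Bdd x → limω x ∈ Mω
  diag : ∀ m ∈ M, limω (fun _ => m) = m
  map_add : ∀ x y, SeqIn (M : Set (Op H)) x → Bdd x → SeqIn (M : Set (Op H)) y → Bdd y →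
    limω (fun n => x n + y n) = limω x + limω y
  map_mul : ∀ x y, SeqIn (M : Set (Op H)) x → Bdd x → SeqIn (M : Set (Op H)) y → Bdd y →
    limω (fun n => x n * y n) = limω x * limω y
  map_smul : ∀ (c : ℂ) x, SeqIn (M : Set (Op H)) x → Bdd x →
    limω (fun n => c • x n) = c • limω x
  map_star : ∀ x, SeqIn (M : Set (Op H)) x → Bdd x →
    limω (fun n => star (x n)) = star (limω x)
  surj : ∀ z ∈ Mω, ∃ x, SeqIn (M : Set (Op H)) x ∧ Bdd x ∧ limω x = z
  tr : ∀ x, SeqIn (M : Set (Op H)) x → Bdd x →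
    Tendsto (fun n => τ (x n)) (ω : Filter ℕ) (nhds (τ (limω x)))
  eq_zero : ∀ x, SeqIn (M : Set (Op H)) x → Bdd x →
    (limω x = 0 ↔ Tendsto (fun n => ‖τ (star (x n) * x n)‖) (ω : Filter ℕ) (nhds 0))
  traceState : IsTracialState (Mω : Set (Op H)) τ

/-- The ultrapower `N^ω ⊆ M^ω` of a subalgebra `N ⊆ M`: classes of bounded
sequences with entries in `N`. -/
def ultrapowerSet (limω : (ℕ → Op H) → Op H) (N : Set (Op H)) : Set (Op H) :=
  {z | ∃ x, SeqIn N x ∧ Bdd x ∧ limω x = z}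

/-- `θ` is a *-homomorphism from `S` to `T` (as sets of operators). -/
def IsStarHomOn (θ : Op H → Op H) (S T : Set (Op H)) : Prop :=
  (∀ x ∈ S, θ x ∈ T) ∧
  (∀ x ∈ S, ∀ y ∈ S, θ (x + y) = θ x + θ y) ∧
  (∀ x ∈ S, ∀ y ∈ S, θ (x * y) = θ x * θ y) ∧
  (∀ (c : ℂ), ∀ x ∈ S, θ (c • x) = c • θ x) ∧
  (∀ x ∈ S, θ (star x) = star (θ x))

/-- The corner `p S p` of a set of operators. -/
def corner (p : Op H) (S : Set (Op H)) : Set (Op H) :=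
  {x | x ∈ S ∧ p * x * p = x}

/-- Popa's intertwining relation: a corner of `P` embeds into `Q` inside `M`,
written `P ≺_M Q`: there are nonzero projections `p ∈ P`, `q ∈ Q`, a
*-homomorphism `θ : pPp → qQq` and a nonzero partial isometry `v ∈ qMp` with
`θ(x) v = v x` for all `x ∈ pPp`. -/
def CornerEmbeds (P Q M : Set (Op H)) : Prop :=
  ∃ (p q v : Op H) (θ : Op H → Op H),
    p ∈ P ∧ IsProjection p ∧ p ≠ 0 ∧
    q ∈ Q ∧ IsProjection q ∧ q ≠ 0 ∧
    IsStarHomOn θ (corner p P) (corner q Q) ∧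
    v ∈ M ∧ v ≠ 0 ∧ IsProjection (star v * v) ∧ q * v * p = v ∧
    ∀ x ∈ corner p P, θ x * v = v * x

/-- `E` is the (`τ`-preserving) conditional expectation from `M` onto `Q`. -/
structure IsCondExp (τ : Op H →ₗ[ℂ] ℂ) (M Q : Set (Op H)) (E : Op H → Op H) : Prop where
  mem : ∀ x ∈ M, E x ∈ Q
  fix : ∀ q ∈ Q, E q = q
  map_add : ∀ x ∈ M, ∀ y ∈ M, E (x + y) = E x + E y
  map_smul : ∀ (c : ℂ), ∀ x ∈ M, E (c • x) = c • E x
  bimod : ∀ a ∈ Q, ∀ x ∈ M, ∀ b ∈ Q, E (a * x * b) = a * E x * b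
  tr : ∀ x ∈ M, τ (E x) = τ x

/-- `c` is a Pimsner–Popa bound for the inclusion `Q ⊆ M` with conditional
expectation `E`: every positive `x ∈ M` satisfies `x ≤ c E(x)`. -/
def IndexBound (M : Set (Op H)) (E : Op H → Op H) (c : ℝ) : Prop :=
  ∀ x ∈ M, x.IsPositive → (c • E x - x).IsPositive

/-- The inclusion `Q ⊆ M` (with conditional expectation `E`) has finite Jones index. -/
def HasFiniteIndex (M : Set (Op H)) (E : Op H → Op H) : Prop :=
  ∃ c : ℝ, 0 < c ∧ IndexBound M E c

/-- The Jones index `[M : Q]` of an inclusion `Q ⊆ M` with conditional expectation `E`,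
via the Pimsner–Popa characterization as the optimal constant `c` with
`x ≤ c E(x)` for all positive `x ∈ M`. -/
noncomputable def jonesIndex (M : Set (Op H)) (E : Op H → Op H) : ℝ :=
  sInf {c : ℝ | 0 < c ∧ IndexBound M E c}

end PopaQ

universe u
set_option linter.unusedSectionVars false
namespace PopaQ

section wot
variable {K1 K2 K3 : Type*} [NormedAddCommGroup K1] [InnerProductSpace ℂ K1] [CompleteSpace K1]
  [NormedAddCommGroup K2] [InnerProductSpace ℂ K2] [CompleteSpace K2]
  [NormedAddCommGroup K3] [InnerProductSpace ℂ K3] [CompleteSpace K3]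

/-- weak operator limit along `ω` -/
def WLim (ω : Ultrafilter ℕ) (T : ℕ → K1 →L[ℂ] K2) (T' : K1 →L[ℂ] K2) : Prop :=
  ∀ ξ η, Tendsto (fun n => inner ℂ η (T n ξ)) (ω : Filter ℕ) (nhds (inner ℂ η (T' ξ)))

theorem ultra_lim (ω : Ultrafilter ℕ) (f : ℕ → ℂ) (C : ℝ) (h : ∀ n, ‖f n‖ ≤ C) :
    ∃ z, ‖z‖ ≤ C ∧ Tendsto f (ω : Filter ℕ) (nhds z) := by
  have hc : IsCompact (Metric.closedBall (0:ℂ) C) := isCompact_closedBall _ _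
  have := hc.ultrafilter_le_nhds (ω.map f) (by
    rw [Ultrafilter.coe_map, Filter.le_principal_iff, Filter.mem_map]
    refine Filter.univ_mem' fun n => ?_
    simpa using h n)
  obtain ⟨z, hz, hz'⟩ := this
  exact ⟨z, by simpa using hz, hz'⟩

theorem wot_lim (ω : Ultrafilter ℕ) (T : ℕ → K1 →L[ℂ] K2) (C : ℝ) (hC : ∀ n, ‖T n‖ ≤ C) :
    ∃ T', ‖T'‖ ≤ C ∧ WLim ω T T' := by
  have hC0 : 0 ≤ C := (norm_nonneg _).trans (hC 0)
  have hb : ∀ ξ η n, ‖inner ℂ (T n ξ) η‖ ≤ C * ‖ξ‖ * ‖η‖ := fun ξ η n => by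
    refine (norm_inner_le_norm _ _).trans ?_
    gcongr
    exact ((T n).le_opNorm ξ).trans (by gcongr; exact hC n)
  choose φ hφ hφ' using fun ξ η => ultra_lim ω (fun n => inner ℂ (T n ξ) η) _ (hb ξ η)
  let F : K1 → (K2 →L[ℂ] ℂ) := fun ξ => LinearMap.mkContinuous
    { toFun := φ ξ
      map_add' := fun x y => by
        refine tendsto_nhds_unique (hφ' ξ (x+y)) ?_
        simp only [inner_add_right]
        exact (hφ' _ _).add (hφ' _ _)
      map_smul' := fun c x => by
        refine tendsto_nhds_unique (hφ' ξ (c • x)) ?_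
        simp only [inner_smul_right]
        exact (hφ' _ _).const_mul c } (C * ‖ξ‖) (fun η => hφ ξ η)
  have hF : ∀ ξ η, F ξ η = φ ξ η := fun _ _ => rfl
  let G : K1 → K2 := fun ξ => (InnerProductSpace.toDual ℂ K2).symm (F ξ)
  have hG : ∀ ξ η, inner ℂ (G ξ) η = φ ξ η := fun ξ η => by
    simp [G, hF]
  have hGt : ∀ ξ η, Tendsto (fun n => inner ℂ (T n ξ) η) (ω : Filter ℕ) (nhds (inner ℂ (G ξ) η)) :=
    fun ξ η => by rw [hG]; exact hφ' ξ η
  let T' : K1 →L[ℂ] K2 := LinearMap.mkContinuous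
    { toFun := G
      map_add' := fun x y => by
        refine ext_inner_right ℂ fun η => ?_
        refine tendsto_nhds_unique (hGt (x+y) η) ?_
        simp only [map_add, inner_add_left]
        exact (hGt _ _).add (hGt _ _)
      map_smul' := fun c x => by
        refine ext_inner_right ℂ fun η => ?_
        refine tendsto_nhds_unique (hGt (c • x) η) ?_
        simp only [map_smul, inner_smul_left]
        exact (hGt _ _).const_mul _ } C (fun ξ => by
          show ‖G ξ‖ ≤ _
          rw [LinearIsometryEquiv.norm_map]
          exact LinearMap.mkContinuous_norm_le _ (by positivity) _)
  refine ⟨T', LinearMap.mkContinuous_norm_le _ hC0 _, fun ξ η => ?_⟩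
  have := (hGt ξ η).star
  simpa [T'] using this

theorem WLim.norm_le {ω : Ultrafilter ℕ} {T : ℕ → K1 →L[ℂ] K2} {T'} (h : WLim ω T T') {C : ℝ}
    (hC : 0 ≤ C) (hT : ∀ᶠ n in (ω : Filter ℕ), ‖T n‖ ≤ C) : ‖T'‖ ≤ C := by
  refine ContinuousLinearMap.opNorm_le_bound _ hC fun ξ => ?_
  by_cases h0 : ‖T' ξ‖ = 0
  · rw [h0]; positivity
  have h1 : ‖inner ℂ (T' ξ) (T' ξ)‖ ≤ (C * ‖ξ‖) * ‖T' ξ‖ := by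
    refine le_of_tendsto (h ξ (T' ξ)).norm (hT.mono fun n hn => ?_)
    refine (norm_inner_le_norm _ _).trans ?_
    rw [mul_comm]
    gcongr
    exact ((T n).le_opNorm ξ).trans (by gcongr)
  rw [inner_self_eq_norm_sq_to_K, norm_pow] at h1
  simp only [Complex.coe_algebraMap, Complex.norm_real, norm_norm, sq] at h1
  exact le_of_mul_le_mul_right h1 (lt_of_le_of_ne (norm_nonneg _) (Ne.symm h0))

theorem WLim.unique {ω : Ultrafilter ℕ} {T : ℕ → K1 →L[ℂ] K2} {T' T''} (h : WLim ω T T')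
    (h' : WLim ω T T'') : T' = T'' := by
  ext ξ
  exact ext_inner_left ℂ fun η => tendsto_nhds_unique (h ξ η) (h' ξ η)

theorem WLim.congr {ω : Ultrafilter ℕ} {T S : ℕ → K1 →L[ℂ] K2} {T'} (h : WLim ω T T')
    (h' : ∀ᶠ n in (ω : Filter ℕ), T n = S n) : WLim ω S T' := fun ξ η =>
  (h ξ η).congr' (h'.mono fun n hn => by simp only [hn])

theorem WLim.const (ω : Ultrafilter ℕ) (T' : K1 →L[ℂ] K2) : WLim ω (fun _ => T') T' := fun _ _ =>
  tendsto_const_nhds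

theorem WLim.comp_left {ω : Ultrafilter ℕ} {T : ℕ → K1 →L[ℂ] K2} {T'} (h : WLim ω T T')
    (S : K2 →L[ℂ] K3) : WLim ω (fun n => S ∘L T n) (S ∘L T') := fun ξ η => by
  have := h ξ (ContinuousLinearMap.adjoint S η)
  simpa only [ContinuousLinearMap.comp_apply, ContinuousLinearMap.adjoint_inner_left] using this

theorem WLim.comp_right {ω : Ultrafilter ℕ} {T : ℕ → K1 →L[ℂ] K2} {T'} (h : WLim ω T T')
    (S : K3 →L[ℂ] K1) : WLim ω (fun n => T n ∘L S) (T' ∘L S) := fun ξ η => by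
  simp only [ContinuousLinearMap.comp_apply]
  exact h _ _

theorem WLim.sub {ω : Ultrafilter ℕ} {T S : ℕ → K1 →L[ℂ] K2} {T' S'} (h : WLim ω T T')
    (h' : WLim ω S S') : WLim ω (fun n => T n - S n) (T' - S') := fun ξ η => by
  simp only [sub_apply, inner_sub_right]
  exact (h _ _).sub (h' _ _)

theorem nonneg_iff_inner (T : K1 →L[ℂ] K1) : 0 ≤ T ↔ ∀ ξ, 0 ≤ inner ℂ ξ (T ξ) := by
  rw [ContinuousLinearMap.nonneg_iff_isPositive]
  constructor
  · intro h ξ; exact h.inner_nonneg_right ξ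
  · intro h
    rw [ContinuousLinearMap.isPositive_iff_complex]
    intro x
    have := h x
    rw [← inner_conj_symm]
    obtain ⟨h1, h2⟩ := Complex.le_def.mp this
    simp at h1 h2
    have h3 := inner_conj_symm (T x) x (𝕜 := ℂ)
    have h4 : (inner ℂ (T x) x : ℂ).re = (inner ℂ x (T x)).re := by rw [← h3, Complex.conj_re]
    have h5 : (inner ℂ (T x) x : ℂ).im = 0 := by rw [← h3, Complex.conj_im, ← h2, neg_zero]
    rw [inner_conj_symm]
    refine ⟨?_, by simpa [h4] using h1⟩
    apply Complex.ext <;> simp [h5]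

theorem WLim.nonneg {ω : Ultrafilter ℕ} {T : ℕ → K1 →L[ℂ] K1} {T'} (h : WLim ω T T')
    (hT : ∀ᶠ n in (ω : Filter ℕ), 0 ≤ T n) : 0 ≤ T' := by
  rw [nonneg_iff_inner]
  intro ξ
  refine ge_of_tendsto (h ξ ξ) (hT.mono fun n hn => (nonneg_iff_inner _).1 hn ξ)

theorem WLim.le {ω : Ultrafilter ℕ} {T S : ℕ → K1 →L[ℂ] K1} {T' S'} (h : WLim ω T T')
    (h' : WLim ω S S') (hT : ∀ᶠ n in (ω : Filter ℕ), T n ≤ S n) : T' ≤ S' := by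
  rw [← sub_nonneg]
  exact (h'.sub h).nonneg (hT.mono fun n hn => sub_nonneg.2 hn)

end wot

section vn
variable {H : Type u} [NormedAddCommGroup H] [InnerProductSpace ℂ H] [CompleteSpace H]

theorem mem_vn_iff (M : VonNeumannAlgebra H) (x : Op H) :
    x ∈ M ↔ ∀ y, y ∈ Set.centralizer (M : Set (Op H)) → y * x = x * y := by
  rw [← SetLike.mem_coe]
  conv_lhs => rw [← M.centralizer_centralizer]
  rw [Set.mem_centralizer_iff]

theorem star_mem_centralizer (M : VonNeumannAlgebra H) {y : Op H}
    (hy : y ∈ Set.centralizer (M : Set (Op H))) : star y ∈ Set.centralizer (M : Set (Op H)) := by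
  rw [Set.mem_centralizer_iff] at *
  intro m hm
  have := hy (star m) (star_mem hm)
  have := congrArg star this
  simpa using this.symm

theorem WLim.mem_vn {ω : Ultrafilter ℕ} {M : VonNeumannAlgebra H} {T : ℕ → Op H} {T'}
    (h : WLim ω T T') (hT : ∀ n, T n ∈ M) : T' ∈ M := by
  rw [mem_vn_iff]
  intro y hy
  refine (h.comp_left y).unique ?_
  refine (h.comp_right y).congr (Filter.Eventually.of_forall fun n => ?_)
  exact (((mem_vn_iff M _).1 (hT n)) y hy).symm

theorem cfc_mem_vn {M : VonNeumannAlgebra H} {x : Op H} (hx : x ∈ M) (f : ℝ → ℝ) :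
    cfc f x ∈ M := by
  rw [mem_vn_iff]
  intro y hy
  have h1 : Commute x y := ((mem_vn_iff M _).1 hx y hy).symm
  have h2 : Commute (star x) y := ((mem_vn_iff M _).1 (star_mem hx) y hy).symm
  by_cases hsa : IsSelfAdjoint x
  · exact (h1.cfc_real f).symm.eq
  · rw [cfc_apply_of_not_predicate _ hsa]; simp

theorem vn_isClosed (M : VonNeumannAlgebra H) : IsClosed (M : Set (Op H)) := by
  rw [← M.centralizer_centralizer]
  exact Set.isClosed_centralizer _

theorem exists_sqrt {M : VonNeumannAlgebra H} {x : Op H} (hx : x ∈ M) (h0 : 0 ≤ x) :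
    ∃ s ∈ M, IsSelfAdjoint s ∧ x = star s * s := by
  have hsa : IsSelfAdjoint x := IsSelfAdjoint.of_nonneg h0
  refine ⟨cfc Real.sqrt x, cfc_mem_vn hx _, cfc_predicate _ _, ?_⟩
  rw [(cfc_predicate Real.sqrt x : IsSelfAdjoint _).star_eq, ← cfc_mul ..]
  conv_lhs => rw [← cfc_id ℝ x]
  refine cfc_congr fun t ht => ?_
  have : 0 ≤ t := spectrum_nonneg_of_nonneg h0 ht
  simp [Real.mul_self_sqrt this]

theorem IsTracialState.nonneg {M : VonNeumannAlgebra H} {τ : Op H →ₗ[ℂ] ℂ}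
    (h : IsTracialState (M : Set (Op H)) τ) {x : Op H} (hx : x ∈ M) (h0 : 0 ≤ x) : 0 ≤ τ x := by
  obtain ⟨s, hs, -, rfl⟩ := exists_sqrt hx h0
  exact h.pos s hs

theorem IsTracialState.mono {M : VonNeumannAlgebra H} {τ : Op H →ₗ[ℂ] ℂ}
    (h : IsTracialState (M : Set (Op H)) τ) {x y : Op H} (hx : x ∈ M) (hy : y ∈ M) (h0 : x ≤ y) :
    τ x ≤ τ y := by
  rw [← sub_nonneg, ← map_sub]
  exact h.nonneg (sub_mem hy hx) (sub_nonneg.2 h0)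

theorem IsTracialState.eq_zero {M : VonNeumannAlgebra H} {τ : Op H →ₗ[ℂ] ℂ}
    (h : IsTracialState (M : Set (Op H)) τ) {x : Op H} (hx : x ∈ M) (h0 : 0 ≤ x) (ht : τ x = 0) :
    x = 0 := by
  obtain ⟨s, hs, -, rfl⟩ := exists_sqrt hx h0
  rw [h.faithful s hs ht]; simp

theorem IsTracialState.restrict {M N : VonNeumannAlgebra H} {τ : Op H →ₗ[ℂ] ℂ}
    (h : IsTracialState (M : Set (Op H)) τ) (hNM : (N : Set (Op H)) ⊆ M) :
    IsTracialState (N : Set (Op H)) τ :=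
  ⟨h.1, fun x hx y hy => h.2 x (hNM hx) y (hNM hy), fun x hx => h.3 x (hNM hx),
   fun x hx => h.4 x (hNM hx)⟩

/-- normality of the trace along decreasing sequences -/
def Nrml (ω : Ultrafilter ℕ) (M : VonNeumannAlgebra H) (τ : Op H →ₗ[ℂ] ℂ) : Prop :=
  ∀ (t : ℕ → Op H) (t' : Op H) (c : ℝ), (∀ n, t n ∈ M) → Antitone t → (∀ n, 0 ≤ t n) →
    (∀ n, t n ≤ 1) → WLim ω t t' → (∀ n, c ≤ (τ (t n)).re) → c ≤ (τ t').re

theorem Nrml.restrict {ω : Ultrafilter ℕ} {M N : VonNeumannAlgebra H} {τ : Op H →ₗ[ℂ] ℂ}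
    (h : Nrml ω M τ) (hNM : (N : Set (Op H)) ⊆ M) : Nrml ω N τ :=
  fun t t' c ht => h t t' c (fun n => hNM (ht n))

theorem norm_le_one_of_nonneg {x : Op H} (h0 : 0 ≤ x) (h1 : x ≤ 1) : ‖x‖ ≤ 1 :=
  (CStarAlgebra.norm_le_one_iff_of_nonneg x h0).2 h1

variable {ω : Ultrafilter ℕ} {M Mω : VonNeumannAlgebra H} {τ : Op H →ₗ[ℂ] ℂ}
  {limω : (ℕ → Op H) → Op H}

theorem IsTracialUltrapower.congr (hU : IsTracialUltrapower ω M Mω τ limω) {x y : ℕ → Op H}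
    (hx : SeqIn (M : Set (Op H)) x) (bx : Bdd x) (hy : SeqIn (M : Set (Op H)) y) (bY : Bdd y)
    (h : Tendsto (fun n => ‖τ (star (x n - y n) * (x n - y n))‖) (ω : Filter ℕ) (nhds 0)) :
    limω x = limω y := by
  have hy' : SeqIn (M : Set (Op H)) (fun n => (-1:ℂ) • y n) := fun n => M.toStarSubalgebra.smul_mem (hy n) _
  have by' : Bdd (fun n => (-1:ℂ) • y n) := by
    obtain ⟨C, hC⟩ := bY; exact ⟨C, fun n => by simpa using hC n⟩
  have h1 := hU.map_add x _ hx bx hy' by'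
  rw [hU.map_smul _ _ hy bY] at h1
  have h2 : limω (fun n => x n + (-1:ℂ) • y n) = 0 := by
    rw [hU.eq_zero]
    · simpa [sub_eq_add_neg] using h
    · intro n; exact add_mem (hx n) (hy' n)
    · obtain ⟨C, hC⟩ := bx; obtain ⟨C', hC'⟩ := by'
      exact ⟨C + C', fun n => (norm_add_le _ _).trans (add_le_add (hC n) (hC' n))⟩
  rw [h2] at h1
  have : limω x - limω y = 0 := by rw [h1]; simp [sub_eq_add_neg]
  exact sub_eq_zero.1 this

theorem IsTracialUltrapower.nonneg (hU : IsTracialUltrapower ω M Mω τ limω) {x : ℕ → Op H}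
    (hx : SeqIn (M : Set (Op H)) x) (bx : Bdd x) (h0 : ∀ n, 0 ≤ x n) : 0 ≤ limω x := by
  choose s hs hsa hs' using fun n => exists_sqrt (hx n) (h0 n)
  have bs : Bdd s := by
    obtain ⟨C, hC⟩ := bx
    refine ⟨Real.sqrt C, fun n => Real.le_sqrt_of_sq_le ?_⟩
    rw [sq, ← CStarRing.norm_star_mul_self, ← hs']; exact hC n
  have bs' : Bdd (fun n => star (s n)) := by
    obtain ⟨C, hC⟩ := bs; exact ⟨C, fun n => by simpa using hC n⟩
  have : x = fun n => star (s n) * s n := funext hs'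
  rw [this, hU.map_mul (fun n => star (s n)) s (fun n => star_mem (hs n)) bs' hs bs,
    hU.map_star s hs bs]
  exact star_mul_self_nonneg _

theorem IsTracialUltrapower.nrml (hU : IsTracialUltrapower ω M Mω τ limω)
    (hω : IsFreeUltrafilter ω) : Nrml ω M τ := by
  intro t t' c ht hanti h0 h1 hl hc
  have bt : Bdd t := ⟨1, fun n => norm_le_one_of_nonneg (h0 n) (h1 n)⟩
  have hz : ∀ k, limω t ≤ t k := by
    intro k
    have hm : ∀ n, t n - t (max n k) ∈ M := fun n => sub_mem (ht _) (ht _)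
    have e1 : limω (fun n => t (max n k)) = limω t := by
      refine hU.congr (fun n => ht _) ?_ ht bt ?_
      · exact ⟨1, fun n => norm_le_one_of_nonneg (h0 _) (h1 _)⟩
      · refine tendsto_const_nhds.congr' ?_
        have : ∀ᶠ n in (ω : Filter ℕ), k ≤ n := by
          have := hω (Set.Iio k) (Set.finite_Iio k)
          rw [← Ultrafilter.compl_mem_iff_notMem] at this
          filter_upwards [this] with n hn
          simpa using hn
        filter_upwards [this] with n hn
        rw [max_eq_left hn]; simp
    rw [← e1]
    have e2 := hU.map_add (fun n => t (max n k)) (fun n => t k - t (max n k)) (fun n => ht _)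
      ⟨1, fun n => norm_le_one_of_nonneg (h0 _) (h1 _)⟩ (fun n => sub_mem (ht _) (ht _))
      ⟨2, fun n => (norm_sub_le _ _).trans (by
        have := norm_le_one_of_nonneg (h0 k) (h1 k)
        have := norm_le_one_of_nonneg (h0 (max n k)) (h1 (max n k))
        linarith)⟩
    simp only [add_sub_cancel] at e2
    rw [hU.diag _ (ht k)] at e2
    rw [e2]
    refine le_add_of_nonneg_right (hU.nonneg (fun n => sub_mem (ht _) (ht _))
      ⟨2, fun n => (norm_sub_le _ _).trans (by
        have := norm_le_one_of_nonneg (h0 k) (h1 k)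
        have := norm_le_one_of_nonneg (h0 (max n k)) (h1 (max n k))
        linarith)⟩ fun n => sub_nonneg.2 (hanti (le_max_right _ _)))
  have hz' : limω t ≤ t' := (WLim.const ω _).le hl (Filter.Eventually.of_forall hz)
  have h2 := hU.traceState.mono (hU.mem t ht bt) (hU.subset (hl.mem_vn ht)) hz'
  have h3 : c ≤ (τ (limω t)).re :=
    ge_of_tendsto ((Complex.continuous_re.tendsto _).comp (hU.tr t ht bt))
      (Filter.Eventually.of_forall hc)
  exact h3.trans (Complex.le_def.1 h2).1
end vn

section egorov
variable {H : Type u} [NormedAddCommGroup H] [InnerProductSpace ℂ H] [CompleteSpace H]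

/-- `(1+g)⁻¹` -/
noncomputable def rinv (g : Op H) : Op H := cfc (fun x : ℝ => (1 + x)⁻¹) g

theorem rinv_cont {g : Op H} (h0 : 0 ≤ g) :
    ContinuousOn (fun x : ℝ => (1 + x)⁻¹) (spectrum ℝ g) := by
  refine ContinuousOn.inv₀ (by fun_prop) fun x hx => ?_
  have : 0 ≤ x := spectrum_nonneg_of_nonneg h0 hx
  positivity

theorem rinv_sa (g : Op H) : IsSelfAdjoint (rinv g) := cfc_predicate _ _

theorem rinv_nonneg {g : Op H} (h0 : 0 ≤ g) : 0 ≤ rinv g :=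
  cfc_nonneg fun x hx => by
    have : 0 ≤ x := spectrum_nonneg_of_nonneg h0 hx
    positivity

theorem rinv_le_one {g : Op H} (h0 : 0 ≤ g) : rinv g ≤ 1 :=
  cfc_le_one _ _ fun x hx => by
    have : 0 ≤ x := spectrum_nonneg_of_nonneg h0 hx
    exact inv_le_one_of_one_le₀ (by linarith)

theorem rinv_eq {g : Op H} (h0 : 0 ≤ g) :
    (1 + g) * rinv g = 1 ∧ rinv g * (1 + g) = 1 := by
  have hsa : IsSelfAdjoint g := IsSelfAdjoint.of_nonneg h0
  have hc := rinv_cont h0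
  have h1 : cfc (fun x : ℝ => 1 + x) g = 1 + g := by
    rw [cfc_const_add (1:ℝ) (fun x => x) g (by fun_prop) hsa, cfc_id' ℝ g]; simp
  have e : ∀ x ∈ spectrum ℝ g, (1 + x) * (1+x)⁻¹ = 1 := fun x hx => by
    have : 0 ≤ x := spectrum_nonneg_of_nonneg h0 hx
    field_simp
  rw [← h1, rinv, ← cfc_mul _ _ g (by fun_prop) hc, ← cfc_mul _ _ g hc (by fun_prop)]
  constructor
  · rw [cfc_congr (g := fun _ => (1:ℝ)) (fun x hx => e x hx), cfc_const_one ℝ g]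
  · rw [cfc_congr (g := fun _ => (1:ℝ)) (fun x hx => by simpa only [mul_comm] using e x hx),
      cfc_const_one ℝ g]

theorem rinv_antitone {g g' : Op H} (h0 : 0 ≤ g) (h : g ≤ g') : rinv g' ≤ rinv g := by
  have h0' := h0.trans h
  let a : (Op H)ˣ := ⟨1 + g, rinv g, (rinv_eq h0).1, (rinv_eq h0).2⟩
  let b : (Op H)ˣ := ⟨1 + g', rinv g', (rinv_eq h0').1, (rinv_eq h0').2⟩
  exact CStarAlgebra.inv_le_inv (a := a) (b := b) (add_nonneg zero_le_one h0)
    (add_le_add_right h 1)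

theorem rinv_conj {g : Op H} (h0 : 0 ≤ g) : rinv g * g * rinv g ≤ 1 := by
  have h1 : rinv g * g * rinv g = rinv g - rinv g * rinv g := by
    have := (rinv_eq h0).2
    have h2 : rinv g * g = 1 - rinv g := by rw [← this]; noncomm_ring
    rw [h2, sub_mul, one_mul]
  rw [h1]
  have h3 : 0 ≤ rinv g * rinv g := by
    conv => enter [2,1]; rw [← (rinv_sa g).star_eq]
    exact star_mul_self_nonneg _
  exact (sub_le_self _ h3).trans (rinv_le_one h0)

theorem rinv_sub {g : Op H} (h0 : 0 ≤ g) : 1 - rinv g ≤ g := by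
  have hc := rinv_cont h0
  have hsa : IsSelfAdjoint g := IsSelfAdjoint.of_nonneg h0
  have : cfc (fun x : ℝ => 1 - (1+x)⁻¹) g = 1 - rinv g := by
    rw [cfc_sub (fun _ => (1:ℝ)) (fun x : ℝ => (1+x)⁻¹) g (by fun_prop) hc, cfc_const_one ℝ g]; rfl
  rw [← this]
  refine (cfc_mono (g := fun x => x) ?_ (continuousOn_const.sub hc) (by fun_prop)).trans
    (le_of_eq (cfc_id' ℝ g))
  intro x hx
  have : 0 ≤ x := spectrum_nonneg_of_nonneg h0 hx
  have h3 : 1 - (1+x)⁻¹ = x * (1+x)⁻¹ := by field_simp; ring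
  show 1 - (1+x)⁻¹ ≤ x
  rw [h3]
  exact mul_le_of_le_one_right this (inv_le_one_of_one_le₀ (by linarith))

theorem norm_mul_rinv {g d : Op H} (h : star d * d ≤ g) : ‖d * rinv g‖ ≤ 1 := by
  have h0 : 0 ≤ g := (star_mul_self_nonneg d).trans h
  have hsa := rinv_sa g
  have h2 : star (d * rinv g) * (d * rinv g) ≤ 1 := by
    refine le_trans ?_ (rinv_conj h0)
    have := star_left_conjugate_le_conjugate h (rinv g)
    rw [hsa.star_eq] at this
    refine le_trans (le_of_eq ?_) this
    simp only [star_mul, hsa.star_eq, mul_assoc]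
  have h3 := norm_le_one_of_nonneg (star_mul_self_nonneg _) h2
  rw [CStarRing.norm_star_mul_self] at h3
  nlinarith [norm_nonneg (d * rinv g)]

theorem IsFreeUltrafilter.ge {ω : Ultrafilter ℕ} (hω : IsFreeUltrafilter ω) (k : ℕ) :
    ∀ᶠ n in (ω : Filter ℕ), k ≤ n := by
  have := hω (Set.Iio k) (Set.finite_Iio k)
  rw [← Ultrafilter.compl_mem_iff_notMem] at this
  filter_upwards [this] with n hn
  simpa using hn

theorem IsFreeUltrafilter.le_atTop {ω : Ultrafilter ℕ} (hω : IsFreeUltrafilter ω) :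
    (ω : Filter ℕ) ≤ atTop := by
  intro s hs
  obtain ⟨k, hk⟩ := mem_atTop_sets.1 hs
  exact (hω.ge k).mono fun n hn => hk n hn

theorem geom_bound (n m : ℕ) : ∑ k ∈ Finset.Ico n m, 2 * (1/4:ℝ)^k ≤ 3 * (1/4:ℝ)^n := by
  rcases le_total m n with h | h
  · rw [Finset.Ico_eq_empty_of_le h]; simp
  have : ∑ k ∈ Finset.Ico n m, 2 * (1/4:ℝ)^k = (8/3) * ((1/4:ℝ)^n - (1/4)^m) := by
    induction m, h using Nat.le_induction with
    | base => simp
    | succ m hm ih => rw [Finset.sum_Ico_succ_top hm, ih, pow_succ]; ring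
  rw [this]
  have h1 : (0:ℝ) < (1/4)^m := by positivity
  have h2 : (0:ℝ) < (1/4)^n := by positivity
  linarith

variable {ω : Ultrafilter ℕ} {M : VonNeumannAlgebra H} {τ : Op H →ₗ[ℂ] ℂ}

theorem egorov (hω : IsFreeUltrafilter ω) (hτ : IsTracialState (M : Set (Op H)) τ)
    (hn : Nrml ω M τ) (d : ℕ → Op H) (hd : ∀ k, d k ∈ M)
    (hd2 : ∀ k, (τ (star (d k) * d k)).re ≤ (1/16)^k) :
    ∃ a : ℕ → Op H, (∀ n, a n ∈ M) ∧ (∀ n, IsSelfAdjoint (a n)) ∧ (∀ n, ‖a n‖ ≤ 1) ∧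
      (∀ n k, n ≤ k → ‖d k * a n‖ ≤ (1/2)^k) ∧ (∀ n k, n ≤ k → ‖a n * d k‖ ≤ (1/2)^k) ∧
      WLim ω a 1 ∧ Tendsto (fun n => (τ (star (1 - a n) * (1 - a n))).re) atTop (nhds 0) := by
  let D : ℕ → Op H := fun k => ((2:ℂ)^k) • d k
  have hD : ∀ k, D k ∈ M := fun k => M.toStarSubalgebra.smul_mem (hd k) _
  let h : ℕ → Op H := fun k => star (D k) * D k + D k * star (D k)
  have hh : ∀ k, h k ∈ M := fun k =>
    add_mem (mul_mem (star_mem (hD k)) (hD k)) (mul_mem (hD k) (star_mem (hD k)))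
  have h0 : ∀ k, 0 ≤ h k := fun k => add_nonneg (star_mul_self_nonneg _) (mul_star_self_nonneg _)
  have hτh : ∀ k, (τ (h k)).re ≤ 2 * (1/4)^k := fun k => by
    have e1 : τ (h k) = 2 * ((4:ℂ)^k * τ (star (d k) * d k)) := by
      simp only [h, map_add]
      rw [hτ.tracial _ (hD k) _ (star_mem (hD k))]
      have : star (D k) * D k = (4:ℂ)^k • (star (d k) * d k) := by
        simp only [D, star_smul, smul_mul_smul_comm]
        congr 1
        simp [← mul_pow]; norm_num
      rw [this, map_smul, smul_eq_mul]; ring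
    rw [e1]
    have e2 : (2 * ((4:ℂ)^k * τ (star (d k) * d k))).re = 2 * (4^k * (τ (star (d k) * d k)).re) := by
      have : (4:ℂ)^k = ((4^k : ℝ) : ℂ) := by push_cast; rfl
      rw [this, show (2:ℂ) = ((2:ℝ):ℂ) by norm_num, Complex.re_ofReal_mul, Complex.re_ofReal_mul]
    rw [e2]
    have : (4:ℝ)^k * (1/16)^k = (1/4)^k := by rw [← mul_pow]; norm_num
    rw [← this]
    have := hd2 k
    gcongr
  let g : ℕ → ℕ → Op H := fun n m => ∑ k ∈ Finset.Ico n m, h k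
  have gM : ∀ n m, g n m ∈ M := fun n m => sum_mem fun k _ => hh k
  have g0 : ∀ n m, 0 ≤ g n m := fun n m => Finset.sum_nonneg fun k _ => h0 k
  have gm : ∀ n, Monotone (g n) := fun n m m' hm =>
    Finset.sum_le_sum_of_subset_of_nonneg (Finset.Ico_subset_Ico_right hm) fun k _ _ => h0 k
  have gn : ∀ n n' m, n ≤ n' → g n' m ≤ g n m := fun n n' m hm =>
    Finset.sum_le_sum_of_subset_of_nonneg (Finset.Ico_subset_Ico_left hm) fun k _ _ => h0 k
  have hg : ∀ n m k, n ≤ k → k < m → h k ≤ g n m := fun n m k h1 h2 =>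
    Finset.single_le_sum (f := h) (fun i _ => h0 i) (Finset.mem_Ico.2 ⟨h1, h2⟩)
  have gτ : ∀ n m, (τ (g n m)).re ≤ 3 * (1/4)^n := fun n m => by
    refine le_trans ?_ (geom_bound n m)
    simp only [g, map_sum, Complex.re_sum]
    exact Finset.sum_le_sum fun k _ => hτh k
  let a : ℕ → ℕ → Op H := fun n m => rinv (g n m)
  have aM : ∀ n m, a n m ∈ M := fun n m => cfc_mem_vn (gM n m) _
  have an : ∀ n m, ‖a n m‖ ≤ 1 := fun n m =>
    norm_le_one_of_nonneg (rinv_nonneg (g0 n m)) (rinv_le_one (g0 n m))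
  choose b hb1 hb using fun n => wot_lim ω (a n) 1 (an n)
  have bM : ∀ n, b n ∈ M := fun n => (hb n).mem_vn (aM n)
  have b0 : ∀ n, 0 ≤ b n := fun n => (hb n).nonneg
    (Filter.Eventually.of_forall fun m => rinv_nonneg (g0 n m))
  have bsa : ∀ n, IsSelfAdjoint (b n) := fun n => IsSelfAdjoint.of_nonneg (b0 n)
  have b1 : ∀ n, b n ≤ 1 := fun n => (hb n).le (WLim.const ω _)
    (Filter.Eventually.of_forall fun m => rinv_le_one (g0 n m))
  have bmono : Monotone b := fun n n' hn => (hb n).le (hb n')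
    (Filter.Eventually.of_forall fun m => rinv_antitone (g0 _ _) (gn n n' m hn))
  have bτ : ∀ n, (τ (1 - b n)).re ≤ 3 * (1/4)^n := fun n => by
    have := hn (a n) (b n) (1 - 3 * (1/4)^n) (aM n)
      (fun m m' hm => rinv_antitone (g0 _ _) (gm n hm))
      (fun m => rinv_nonneg (g0 n m)) (fun m => rinv_le_one (g0 n m)) (hb n) (fun m => by
        have h1 := hτ.mono (sub_mem (one_mem M) (aM n m)) (gM n m) (rinv_sub (g0 n m))
        have h2 := (Complex.le_def.1 h1).1.trans (gτ n m)
        rw [map_sub, hτ.map_one] at h2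
        simp at h2 ⊢; linarith)
    rw [map_sub, hτ.map_one]; simp at this ⊢; linarith
  have nD : ∀ k x, ‖D k * x‖ = 2^k * ‖d k * x‖ := fun k x => by
    simp [D, norm_smul]
  have nD' : ∀ k x, ‖x * D k‖ = 2^k * ‖x * d k‖ := fun k x => by
    simp [D, norm_smul]
  have half : ∀ (k : ℕ) (t : ℝ), 2^k * t ≤ 1 → t ≤ (1/2)^k := fun k t ht => by
    rw [one_div, inv_pow, ← one_div, le_div_iff₀ (by positivity)]; linarith
  refine ⟨b, bM, bsa, hb1, fun n k hk => ?_, fun n k hk => ?_, ?_, ?_⟩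
  · refine half _ _ ?_
    rw [← nD]
    refine ((hb n).comp_left (D k)).norm_le zero_le_one ?_
    filter_upwards [hω.ge (k+1)] with m hm
    exact norm_mul_rinv ((le_add_of_nonneg_right (mul_star_self_nonneg _)).trans (hg n m k hk hm))
  · refine half _ _ ?_
    rw [← nD']
    have : b n * D k = star (star (D k) * b n) := by simp [(bsa n).star_eq]
    rw [this, norm_star]
    refine ((hb n).comp_left (star (D k))).norm_le zero_le_one ?_
    filter_upwards [hω.ge (k+1)] with m hm
    refine norm_mul_rinv (le_trans ?_ (hg n m k hk hm))
    rw [star_star]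
    exact (le_add_of_nonneg_left (star_mul_self_nonneg _))
  · obtain ⟨c, hc1, hc⟩ := wot_lim ω b 1 hb1
    have cM := hc.mem_vn bM
    have hbc : ∀ n, b n ≤ c := fun n => (WLim.const ω _).le hc
      ((hω.ge n).mono fun m hm => bmono hm)
    have c1 : c ≤ 1 := hc.le (WLim.const ω _) (Filter.Eventually.of_forall b1)
    have hz : (τ (1 - c)).re ≤ 0 := by
      have h1 : Tendsto (fun n => 3 * (1/4:ℝ)^n) atTop (nhds (3 * 0)) :=
        (tendsto_pow_atTop_nhds_zero_of_lt_one (by norm_num) (by norm_num)).const_mul _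
      rw [mul_zero] at h1
      refine ge_of_tendsto h1 (Filter.Eventually.of_forall fun n => ?_)
      refine le_trans ?_ (bτ n)
      exact (Complex.le_def.1 (hτ.mono (sub_mem (one_mem M) cM) (sub_mem (one_mem M) (bM n))
        (sub_le_sub_left (hbc n) 1))).1
    have hp := hτ.nonneg (sub_mem (one_mem M) cM) (sub_nonneg.2 c1)
    have : 1 - c = 0 := hτ.eq_zero (sub_mem (one_mem M) cM) (sub_nonneg.2 c1)
      (Complex.ext (le_antisymm hz (Complex.le_def.1 hp).1) (Complex.le_def.1 hp).2.symm)
    rw [sub_eq_zero.1 this]; exact hc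
  · have h1 : Tendsto (fun n => 3 * (1/4:ℝ)^n) atTop (nhds (3 * 0)) :=
        (tendsto_pow_atTop_nhds_zero_of_lt_one (by norm_num) (by norm_num)).const_mul _
    rw [mul_zero] at h1
    have sM : ∀ n, 1 - b n ∈ M := fun n => sub_mem (one_mem M) (bM n)
    refine squeeze_zero (fun n => (Complex.le_def.1 (hτ.pos _ (sM n))).1) (fun n => ?_) h1
    refine le_trans (Complex.le_def.1 (hτ.mono (mul_mem (star_mem (sM n)) (sM n)) (sM n) ?_)).1 (bτ n)
    have s0 : 0 ≤ 1 - b n := sub_nonneg.2 (b1 n)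
    have s1 : 1 - b n ≤ 1 := sub_le_self _ (b0 n)
    have ssa : IsSelfAdjoint (1 - b n) := IsSelfAdjoint.of_nonneg s0
    rw [ssa.star_eq]
    have : 0 ≤ (1 - b n) - (1 - b n) * (1 - b n) := by
      rw [← mul_one_sub, sub_sub_cancel]
      refine Commute.mul_nonneg s0 (b0 n) ?_
      exact (Commute.one_left _).sub_left (Commute.refl _)
    exact sub_nonneg.1 this

end egorov

section gns
variable {H : Type u} [NormedAddCommGroup H] [InnerProductSpace ℂ H] [CompleteSpace H]
variable {M : VonNeumannAlgebra H} {τ : Op H →ₗ[ℂ] ℂ}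

theorem vn_smul (M : VonNeumannAlgebra H) {x : Op H} (hx : x ∈ M) (c : ℂ) : c • x ∈ M :=
  M.toStarSubalgebra.smul_mem hx c

theorem IsTracialState.star (h : IsTracialState (M : Set (Op H)) τ) {x : Op H} (hx : x ∈ M) :
    τ (star x) = star (τ x) := by
  have h1 := (Complex.le_def.1 (h.pos (1 + x) (add_mem (one_mem M) hx))).2
  have h2 := (Complex.le_def.1 (h.pos (1 + Complex.I • x)
    (add_mem (one_mem M) (vn_smul M hx _)))).2
  have h3 := (Complex.le_def.1 (h.pos x hx)).2
  have e1 : Star.star (1 + x) * (1 + x) = 1 + x + Star.star x + Star.star x * x := by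
    simp only [star_add, star_one]; noncomm_ring
  have e2 : Star.star (1 + Complex.I • x) * (1 + Complex.I • x) =
      1 + Complex.I • x - Complex.I • Star.star x + Star.star x * x := by
    simp only [star_add, star_one, star_smul, add_mul, mul_add, one_mul, mul_one,
      smul_mul_smul_comm]
    simp
    abel
  rw [e1] at h1
  rw [e2] at h2
  simp only [map_add, map_sub, map_smul, h.map_one, smul_eq_mul] at h1 h2
  simp at h1 h2 h3
  apply Complex.ext
  · simp; linarith
  · simp; linarith

/-- type synonym -/
def PreL2 (M : VonNeumannAlgebra H) : Type u := M.toStarSubalgebra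

noncomputable instance : AddCommGroup (PreL2 M) := inferInstanceAs (AddCommGroup M.toStarSubalgebra)
noncomputable instance : Module ℂ (PreL2 M) := inferInstanceAs (Module ℂ M.toStarSubalgebra)

/-- underlying operator -/
def PreL2.v (x : PreL2 M) : Op H := Subtype.val (show M.toStarSubalgebra from x)

theorem PreL2.v_mem (x : PreL2 M) : x.v ∈ M := (show M.toStarSubalgebra from x).2

/-- constructor -/
def PreL2.mk (x : Op H) (hx : x ∈ M) : PreL2 M := (⟨x, hx⟩ : M.toStarSubalgebra)

/-- the GNS inner product -/
noncomputable def l2core (h : IsTracialState (M : Set (Op H)) τ) :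
    InnerProductSpace.Core ℂ (PreL2 M) where
  inner x y := τ (star x.v * y.v)
  conj_inner_symm x y := by
    have := h.star (mul_mem (star_mem y.v_mem) x.v_mem)
    rw [star_mul, star_star] at this
    exact this.symm
  re_inner_nonneg x := (Complex.le_def.1 (h.pos _ x.v_mem)).1
  add_left x y z := by
    show τ (star (x.v + y.v) * z.v) = _
    rw [star_add, add_mul, map_add]
  smul_left x y r := by
    show τ (star (r • x.v) * y.v) = _
    rw [star_smul, smul_mul_assoc, map_smul]; rfl
  definite x hx := by
    have := h.faithful _ x.v_mem hx
    exact Subtype.ext this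

/-- standard form data -/
structure IsStd (M : VonNeumannAlgebra H) (τ : Op H →ₗ[ℂ] ℂ) {K : Type u} [NormedAddCommGroup K]
    [InnerProductSpace ℂ K] [CompleteSpace K] (vec : Op H →ₗ[ℂ] K) (L R : Op H → (K →L[ℂ] K)) :
    Prop where
  tr : IsTracialState (M : Set (Op H)) τ
  inner : ∀ x ∈ M, ∀ y ∈ M, inner ℂ (vec x) (vec y) = τ (star x * y)
  dense : Dense (vec '' (M : Set (Op H)))
  Lvec : ∀ x ∈ M, ∀ y ∈ M, L x (vec y) = vec (x * y)
  Rvec : ∀ x ∈ M, ∀ y ∈ M, R x (vec y) = vec (y * x)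
  Lnorm : ∀ x ∈ M, ‖L x‖ ≤ ‖x‖
  Rnorm : ∀ x ∈ M, ‖R x‖ ≤ ‖x‖

theorem tr_mul_le (h : IsTracialState (M : Set (Op H)) τ) {x y : Op H} (hx : x ∈ M) (hy : y ∈ M) :
    (τ (star (x * y) * (x * y))).re ≤ ‖x‖ ^ 2 * (τ (star y * y)).re := by
  have h1 : star x * x ≤ ((‖x‖^2 : ℝ) : ℂ) • (1 : Op H) := by
    have := CStarAlgebra.star_mul_le_algebraMap_norm_sq (a := x)
    refine this.trans (le_of_eq ?_)
    rw [Algebra.algebraMap_eq_smul_one]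
    norm_cast
  have h2 := star_left_conjugate_le_conjugate h1 y
  have h3 := (Complex.le_def.1 (h.mono
    (mul_mem (mul_mem (star_mem hy) (mul_mem (star_mem hx) hx)) hy)
    (mul_mem (mul_mem (star_mem hy) (vn_smul M (one_mem M) _)) hy) h2)).1
  rw [mul_smul_comm, mul_one, smul_mul_assoc, map_smul, smul_eq_mul, Complex.re_ofReal_mul] at h3
  rw [star_mul, mul_assoc, ← mul_assoc (star x), ← mul_assoc]
  exact h3

theorem exists_std (h : IsTracialState (M : Set (Op H)) τ) :
    ∃ (K : Type u) (_ : NormedAddCommGroup K) (_ : InnerProductSpace ℂ K) (_ : CompleteSpace K)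
      (vec : Op H →ₗ[ℂ] K) (L R : Op H → (K →L[ℂ] K)), IsStd M τ vec L R := by
  letI : NormedAddCommGroup (PreL2 M) := (l2core h).toNormedAddCommGroup
  letI : InnerProductSpace ℂ (PreL2 M) := InnerProductSpace.ofCore (l2core h).toCore
  have hin : ∀ x y : PreL2 M, inner ℂ x y = τ (star x.v * y.v) := fun x y => rfl
  have hno : ∀ x : PreL2 M, ‖x‖ ^ 2 = (τ (star x.v * x.v)).re := fun x => by
    rw [← hin, ← inner_self_eq_norm_sq (𝕜 := ℂ)]; rfl
  let K := UniformSpace.Completion (PreL2 M)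
  let v0 : PreL2 M →ₗ[ℂ] K := (UniformSpace.Completion.toComplL (𝕜 := ℂ) (E := PreL2 M)).toLinearMap
  obtain ⟨vec, hvec⟩ := LinearMap.exists_extend (p := Subalgebra.toSubmodule M.toStarSubalgebra.toSubalgebra) v0
  have hv : ∀ x (hx : x ∈ M), vec x = ((PreL2.mk x hx : PreL2 M) : K) := fun x hx =>
    congrArg (fun f => f (⟨x, hx⟩ : M.toStarSubalgebra)) hvec
  classical
  let Lp : ∀ x : Op H, x ∈ M → (PreL2 M →L[ℂ] PreL2 M) := fun x hx => LinearMap.mkContinuous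
    { toFun := fun y => PreL2.mk (x * y.v) (mul_mem hx y.v_mem)
      map_add' := fun y z => Subtype.ext (mul_add x y.v z.v)
      map_smul' := fun c y => Subtype.ext (mul_smul_comm c x y.v) } ‖x‖ (fun y => by
        refine le_of_sq_le_sq ?_ (by positivity)
        rw [mul_pow, hno, hno]
        exact tr_mul_le h hx y.v_mem)
  let Rp : ∀ x : Op H, x ∈ M → (PreL2 M →L[ℂ] PreL2 M) := fun x hx => LinearMap.mkContinuous
    { toFun := fun y => PreL2.mk (y.v * x) (mul_mem y.v_mem hx)
      map_add' := fun y z => Subtype.ext (add_mul y.v z.v x)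
      map_smul' := fun c y => Subtype.ext (smul_mul_assoc c y.v x) } ‖x‖ (fun y => by
        refine le_of_sq_le_sq ?_ (by positivity)
        rw [mul_pow, hno, hno]
        have := tr_mul_le h (star_mem hx) (star_mem y.v_mem)
        rw [← star_mul, star_star, star_star, norm_star, h.tracial _ (mul_mem y.v_mem hx) _
          (star_mem (mul_mem y.v_mem hx)), h.tracial _ y.v_mem _ (star_mem y.v_mem)] at this
        exact this)
  have cn : ∀ (f : PreL2 M →L[ℂ] PreL2 M) C, 0 ≤ C → ‖f‖ ≤ C → ‖f.completion‖ ≤ C := by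
    intro f C hC hf
    refine ContinuousLinearMap.opNorm_le_bound _ hC fun ξ => ?_
    induction ξ using UniformSpace.Completion.induction_on with
    | hp => exact isClosed_le (by fun_prop) (by fun_prop)
    | ih a =>
      rw [ContinuousLinearMap.completion_apply_coe, UniformSpace.Completion.norm_coe,
        UniformSpace.Completion.norm_coe]
      exact (f.le_opNorm a).trans (by gcongr)
  refine ⟨K, inferInstance, inferInstance, inferInstance, vec,
    fun x => if hx : x ∈ M then (Lp x hx).completion else 0,
    fun x => if hx : x ∈ M then (Rp x hx).completion else 0, h, ?_, ?_, ?_, ?_, ?_, ?_⟩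
  · intro x hx y hy
    rw [hv x hx, hv y hy, UniformSpace.Completion.inner_coe, hin]; rfl
  · refine (UniformSpace.Completion.denseRange_coe (α := PreL2 M)).mono ?_
    rintro _ ⟨x, rfl⟩
    exact ⟨x.v, x.v_mem, hv _ _⟩
  · intro x hx y hy
    rw [hv y hy, hv _ (mul_mem hx hy)]
    simp only [dif_pos hx]
    rw [ContinuousLinearMap.completion_apply_coe]; rfl
  · intro x hx y hy
    rw [hv y hy, hv _ (mul_mem hy hx)]
    simp only [dif_pos hx]
    rw [ContinuousLinearMap.completion_apply_coe]; rfl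
  · intro x hx
    simp only [dif_pos hx]
    exact cn _ _ (norm_nonneg _) (LinearMap.mkContinuous_norm_le _ (norm_nonneg _) _)
  · intro x hx
    simp only [dif_pos hx]
    exact cn _ _ (norm_nonneg _) (LinearMap.mkContinuous_norm_le _ (norm_nonneg _) _)

end gns

section proj
variable {K : Type*} [NormedAddCommGroup K] [InnerProductSpace ℂ K] [CompleteSpace K]

/-- projection onto the closure -/
noncomputable def pr (U : Submodule ℂ K) : K →L[ℂ] K := U.topologicalClosure.starProjection

theorem pr_mem (U : Submodule ℂ K) (ξ : K) : pr U ξ ∈ U.topologicalClosure :=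
  Submodule.starProjection_apply_mem _ _

theorem pr_eq {U : Submodule ℂ K} {ξ : K} (h : ξ ∈ U.topologicalClosure) : pr U ξ = ξ :=
  Submodule.starProjection_eq_self_iff.2 h

theorem pr_eq' {U : Submodule ℂ K} {ξ : K} (h : ξ ∈ U) : pr U ξ = ξ :=
  pr_eq (U.le_topologicalClosure h)

theorem mem_of_pr_eq {U : Submodule ℂ K} {ξ : K} (h : pr U ξ = ξ) : ξ ∈ U.topologicalClosure := by
  rw [← h]; exact pr_mem _ _

theorem pr_inner (U : Submodule ℂ K) (ξ η : K) : inner ℂ (pr U ξ) η = inner ℂ ξ (pr U η) :=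
  Submodule.inner_starProjection_left_eq_right _ _ _

theorem pr_pr (U : Submodule ℂ K) (ξ : K) : pr U (pr U ξ) = pr U ξ := pr_eq (pr_mem _ _)

theorem pr_norm (U : Submodule ℂ K) (ξ : K) : ‖pr U ξ‖ ≤ ‖ξ‖ :=
  Submodule.norm_starProjection_apply_le _ _

theorem pr_opNorm (U : Submodule ℂ K) : ‖pr U‖ ≤ 1 :=
  ContinuousLinearMap.opNorm_le_bound _ zero_le_one fun ξ => by simpa using pr_norm U ξ

theorem pr_adj (U : Submodule ℂ K) : ContinuousLinearMap.adjoint (pr U) = pr U := by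
  refine (ContinuousLinearMap.eq_adjoint_iff _ _).2 (fun x y => pr_inner U x y) |>.symm

theorem pr_inner_self (U : Submodule ℂ K) (ξ : K) : inner ℂ ξ (pr U ξ) = (‖pr U ξ‖ ^ 2 : ℝ) := by
  rw [← pr_pr, ← pr_inner, pr_pr, inner_self_eq_norm_sq_to_K]; simp

theorem closure_orth {U : Submodule ℂ K} {ξ : K} (h : ∀ η ∈ U, inner ℂ η ξ = 0) :
    ∀ η ∈ U.topologicalClosure, inner ℂ η ξ = 0 := by
  intro η hη
  have hc : IsClosed {η : K | inner ℂ η ξ = 0} := isClosed_eq (by fun_prop) continuous_const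
  exact closure_minimal (s := (U : Set K)) (fun x hx => h x hx) hc hη

theorem pr_zero {U : Submodule ℂ K} {ξ : K} (h : ∀ η ∈ U, inner ℂ η ξ = 0) : pr U ξ = 0 := by
  rw [← inner_self_eq_zero (𝕜 := ℂ), ← pr_inner, pr_pr, closure_orth h _ (pr_mem _ _)]

theorem pr_sub_orth {U : Submodule ℂ K} (ξ : K) {η : K} (hη : η ∈ U.topologicalClosure) :
    inner ℂ η (ξ - pr U ξ) = 0 := by
  rw [inner_sub_right, ← pr_inner, pr_eq hη, sub_self]

theorem pr_eq_of {U : Submodule ℂ K} {ξ ζ : K} (hζ : ζ ∈ U.topologicalClosure)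
    (h : ∀ η ∈ U, inner ℂ η (ξ - ζ) = 0) : pr U ξ = ζ := by
  have := pr_zero h
  rw [map_sub, pr_eq hζ] at this
  exact sub_eq_zero.1 this

theorem closure_map {K2 : Type*} [NormedAddCommGroup K2] [InnerProductSpace ℂ K2] [CompleteSpace K2]
    {U : Submodule ℂ K} {V : Submodule ℂ K2} {T : K →L[ℂ] K2} (h : ∀ x ∈ U, T x ∈ V.topologicalClosure)
    {x} (hx : x ∈ U.topologicalClosure) : T x ∈ V.topologicalClosure := by
  have hc : IsClosed {x : K | T x ∈ V.topologicalClosure} :=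
    V.isClosed_topologicalClosure.preimage T.continuous
  exact closure_minimal (s := (U : Set K)) (fun x hx => h x hx) hc hx

theorem pr_comm {U : Submodule ℂ K} {T : K →L[ℂ] K} (h : ∀ x ∈ U, T x ∈ U.topologicalClosure)
    (h' : ∀ x ∈ U, ContinuousLinearMap.adjoint T x ∈ U.topologicalClosure) (ξ : K) :
    pr U (T ξ) = T (pr U ξ) := by
  refine pr_eq_of (closure_map h (pr_mem _ _)) fun η hη => ?_
  rw [← map_sub, ← ContinuousLinearMap.adjoint_inner_left]
  exact pr_sub_orth _ (h' _ hη)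

theorem eq_top_of_pr {U : Submodule ℂ K} (h : ∀ ξ, (∀ η ∈ U, inner ℂ η ξ = 0) → ξ = 0) (ξ : K) :
    ξ ∈ U.topologicalClosure := by
  have := h (ξ - pr U ξ) fun η hη => pr_sub_orth ξ (U.le_topologicalClosure hη)
  rw [sub_eq_zero.1 this]; exact pr_mem _ _
end proj

section graph
variable {K1 K2 : Type*} [NormedAddCommGroup K1] [InnerProductSpace ℂ K1] [CompleteSpace K1]
  [NormedAddCommGroup K2] [InnerProductSpace ℂ K2] [CompleteSpace K2]

/-- Hilbert sum -/
abbrev HS (K1 K2 : Type*) := WithLp 2 (K1 × K2)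

/-- pair -/
abbrev pp (x : K1) (y : K2) : HS K1 K2 := WithLp.toLp 2 (x, y)

/-- diagonal operator -/
noncomputable def hdiag (a1 : K1 →L[ℂ] K1) (a2 : K2 →L[ℂ] K2) : HS K1 K2 →L[ℂ] HS K1 K2 :=
  (WithLp.prodContinuousLinearEquiv 2 ℂ K1 K2).symm.toContinuousLinearMap ∘L
    (a1.prodMap a2) ∘L (WithLp.prodContinuousLinearEquiv 2 ℂ K1 K2).toContinuousLinearMap

/-- inclusion -/
noncomputable def hinl : K1 →L[ℂ] HS K1 K2 :=
  (WithLp.prodContinuousLinearEquiv 2 ℂ K1 K2).symm.toContinuousLinearMap ∘L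
    ContinuousLinearMap.inl ℂ K1 K2

theorem hdiag_apply (a1 : K1 →L[ℂ] K1) (a2 : K2 →L[ℂ] K2) (g : HS K1 K2) :
    hdiag a1 a2 g = pp (a1 g.fst) (a2 g.snd) := rfl

theorem hinl_apply (x : K1) : (hinl x : HS K1 K2) = pp x 0 := rfl

theorem hs_inner (g g' : HS K1 K2) :
    inner ℂ g g' = inner ℂ g.fst g'.fst + inner ℂ g.snd g'.snd := rfl

theorem hs_ext {g g' : HS K1 K2} (h1 : g.fst = g'.fst) (h2 : g.snd = g'.snd) : g = g' := by
  rcases g with ⟨a, b⟩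
  rcases g' with ⟨c, d⟩
  simp at h1 h2
  rw [h1, h2]

theorem hdiag_adj (a1 : K1 →L[ℂ] K1) (a2 : K2 →L[ℂ] K2) :
    ContinuousLinearMap.adjoint (hdiag a1 a2) =
      hdiag (ContinuousLinearMap.adjoint a1) (ContinuousLinearMap.adjoint a2) := by
  refine ((ContinuousLinearMap.eq_adjoint_iff _ _).2 fun x y => ?_).symm
  simp [hs_inner, hdiag_apply, ContinuousLinearMap.adjoint_inner_left]

/-- off-diagonal part of the projection onto a graph -/
noncomputable def offd (G : Submodule ℂ (HS K1 K2)) : K1 →L[ℂ] K2 :=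
  WithLp.sndL 2 ℂ K1 K2 ∘L pr G ∘L hinl

theorem offd_apply (G : Submodule ℂ (HS K1 K2)) (x : K1) : offd G x = (pr G (pp x 0)).snd := rfl

theorem offd_adj (G : Submodule ℂ (HS K1 K2)) (y : K2) :
    ContinuousLinearMap.adjoint (offd G) y = (pr G (pp 0 y)).fst := by
  refine ext_inner_right ℂ fun x => ?_
  rw [ContinuousLinearMap.adjoint_inner_left, offd_apply]
  have := pr_inner G (pp 0 y) (pp x 0)
  simp [hs_inner] at this
  exact this.symm

theorem offd_comm {G : Submodule ℂ (HS K1 K2)} {a1 : K1 →L[ℂ] K1} {a2 : K2 →L[ℂ] K2}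
    (h : ∀ g ∈ G, pp (a1 g.fst) (a2 g.snd) ∈ G.topologicalClosure)
    (h' : ∀ g ∈ G, pp (ContinuousLinearMap.adjoint a1 g.fst)
      (ContinuousLinearMap.adjoint a2 g.snd) ∈ G.topologicalClosure) (x : K1) :
    offd G (a1 x) = a2 (offd G x) := by
  have := pr_comm (U := G) (T := hdiag a1 a2) h (by rw [hdiag_adj]; exact h') (pp x 0)
  have e : hdiag a1 a2 (pp x 0) = pp (a1 x) 0 := by
    rw [hdiag_apply]; exact hs_ext rfl (map_zero a2)
  rw [e] at this
  rw [offd_apply, this]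
  rfl

theorem offd_zero {G : Submodule ℂ (HS K1 K2)} (h : offd G = 0) {g : HS K1 K2} (hg : g ∈ G) :
    pp 0 g.snd ∈ G.topologicalClosure := by
  have h1 : (pr G (pp g.fst 0)).snd = 0 := by rw [← offd_apply, h]; rfl
  have h2 : (pr G (pp 0 g.snd)).fst = 0 := by rw [← offd_adj, h]; simp
  have h3 : pr G g = pr G (pp g.fst 0) + pr G (pp 0 g.snd) := by
    rw [← map_add]; congr 1; apply hs_ext <;> simp
  rw [pr_eq' hg] at h3
  refine mem_of_pr_eq (hs_ext ?_ ?_)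
  · exact h2
  · have := congrArg WithLp.snd h3
    simp [h1] at this
    exact this.symm

theorem graph_iso (G : Submodule ℂ (HS K1 K2)) (hG : ∀ g ∈ G, ‖g.fst‖ = ‖g.snd‖) :
    ∃ W : K1 →L[ℂ] K2, (∀ g ∈ G, W g.fst = g.snd) ∧
      (∀ g ∈ G, ContinuousLinearMap.adjoint W g.snd = g.fst) ∧
      (∀ x, (∀ g ∈ G, inner ℂ g.fst x = 0) → W x = 0) ∧
      (∀ y, (∀ g ∈ G, inner ℂ g.snd y = 0) → ContinuousLinearMap.adjoint W y = 0) ∧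
      (∀ x, W (ContinuousLinearMap.adjoint W (W x)) = W x) ∧
      (∀ (a1 : K1 →L[ℂ] K1) (a2 : K2 →L[ℂ] K2),
        (∀ g ∈ G, pp (a1 g.fst) (a2 g.snd) ∈ G.topologicalClosure) →
        (∀ g ∈ G, pp (ContinuousLinearMap.adjoint a1 g.fst)
          (ContinuousLinearMap.adjoint a2 g.snd) ∈ G.topologicalClosure) →
        ∀ x, W (a1 x) = a2 (W x)) := by
  have hG' : ∀ g ∈ G.topologicalClosure, ‖g.fst‖ = ‖g.snd‖ := by
    intro g hg
    have hc : IsClosed {g : HS K1 K2 | ‖g.fst‖ = ‖g.snd‖} :=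
      isClosed_eq (WithLp.fstL 2 ℂ K1 K2).continuous.norm (WithLp.sndL 2 ℂ K1 K2).continuous.norm
    exact closure_minimal (s := (G : Set (HS K1 K2))) (t := {g : HS K1 K2 | ‖g.fst‖ = ‖g.snd‖}) (fun x hx => hG x hx) hc hg
  have hin : ∀ g ∈ G.topologicalClosure, ∀ g' ∈ G.topologicalClosure,
      inner ℂ g.fst g'.fst = inner ℂ g.snd g'.snd := by
    intro g hg g' hg'
    have e : ∀ c : ℂ, ‖g.fst + c • g'.fst‖ = ‖g.snd + c • g'.snd‖ := fun c => by
      simpa using hG' (g + c • g') (add_mem hg (Submodule.smul_mem _ c hg'))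
    rw [inner_eq_sum_norm_sq_div_four, inner_eq_sum_norm_sq_div_four]
    have e1 := e 1
    have e2 := e (-1)
    have e3 := e Complex.I
    have e4 := e (-Complex.I)
    simp only [one_smul, neg_smul, ← sub_eq_add_neg] at e1 e2 e3 e4
    simp only [RCLike.I_to_complex]
    rw [e1, e2, e3, e4]
  have p1 : ∀ g ∈ G.topologicalClosure, pr G (pp g.fst 0) = (1/2:ℂ) • g := fun g hg => by
    refine pr_eq_of (Submodule.smul_mem _ _ hg) fun g' hg' => ?_
    have := hin g' (G.le_topologicalClosure hg') g hg
    simp [hs_inner, inner_sub_right, inner_smul_right, this]; ring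
  have p2 : ∀ g ∈ G.topologicalClosure, pr G (pp 0 g.snd) = (1/2:ℂ) • g := fun g hg => by
    refine pr_eq_of (Submodule.smul_mem _ _ hg) fun g' hg' => ?_
    have := hin g' (G.le_topologicalClosure hg') g hg
    simp [hs_inner, inner_sub_right, inner_smul_right, this]; ring
  have W1 : ∀ g ∈ G.topologicalClosure, (2:ℂ) • offd G g.fst = g.snd := fun g hg => by
    rw [offd_apply, p1 g hg]; simp
  have W2 : ∀ g ∈ G.topologicalClosure, (2:ℂ) • ContinuousLinearMap.adjoint (offd G) g.snd = g.fst :=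
    fun g hg => by
    rw [offd_adj, p2 g hg]; simp
  have hadj : ContinuousLinearMap.adjoint ((2:ℂ) • offd G) = (2:ℂ) • ContinuousLinearMap.adjoint (offd G) := by
    ext y; refine ext_inner_right ℂ fun x => ?_
    rw [ContinuousLinearMap.adjoint_inner_left, ContinuousLinearMap.smul_apply,
      ContinuousLinearMap.smul_apply, inner_smul_right, inner_smul_left,
      ContinuousLinearMap.adjoint_inner_left]
    congr 1; exact (map_ofNat (starRingEnd ℂ) 2).symm
  refine ⟨(2:ℂ) • offd G, fun g hg => W1 g (G.le_topologicalClosure hg), fun g hg => ?_,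
    fun x hx => ?_, fun y hy => ?_, fun x => ?_, fun a1 a2 h h' x => ?_⟩
  · rw [hadj]; exact W2 g (G.le_topologicalClosure hg)
  · have : pr G (pp x 0) = 0 := pr_zero fun g hg => by simp [hs_inner, hx g hg]
    simp [offd_apply, this]
  · have : pr G (pp 0 y) = 0 := pr_zero fun g hg => by simp [hs_inner, hy g hg]
    rw [hadj]
    rw [ContinuousLinearMap.smul_apply, offd_adj, this]; simp
  · rw [hadj]
    have hm : (2:ℂ) • pr G (pp x 0) ∈ G.topologicalClosure := Submodule.smul_mem _ _ (pr_mem _ _)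
    have e1 : ((2:ℂ) • offd G) x = ((2:ℂ) • pr G (pp x 0)).snd := by simp [offd_apply]
    rw [e1]
    simp only [ContinuousLinearMap.smul_apply]
    rw [W2 _ hm, W1 _ hm]
  · simp only [ContinuousLinearMap.smul_apply, offd_comm h h' x, map_smul]

end graph

section std
variable {H : Type u} [NormedAddCommGroup H] [InnerProductSpace ℂ H] [CompleteSpace H]
variable {M Q : VonNeumannAlgebra H} {τ : Op H →ₗ[ℂ] ℂ} {K : Type u} [NormedAddCommGroup K]
    [InnerProductSpace ℂ K] [CompleteSpace K] {vec : Op H →ₗ[ℂ] K} {L R : Op H → (K →L[ℂ] K)}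

namespace IsStd
variable (S : IsStd M τ vec L R)
include S

theorem norm_sq {x : Op H} (hx : x ∈ M) : ‖vec x‖ ^ 2 = (τ (star x * x)).re := by
  rw [← S.inner x hx x hx, ← inner_self_eq_norm_sq (𝕜 := ℂ)]; rfl

theorem norm_star {x : Op H} (hx : x ∈ M) : ‖vec (star x)‖ = ‖vec x‖ := by
  rw [← sq_eq_sq₀ (norm_nonneg _) (norm_nonneg _), S.norm_sq hx, S.norm_sq (star_mem hx), star_star,
    S.tr.tracial _ hx _ (star_mem hx)]

theorem eq_zero {x : Op H} (hx : x ∈ M) (h : vec x = 0) : x = 0 :=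
  S.tr.faithful x hx (by rw [← S.inner x hx x hx, h, inner_zero_left])

theorem inj {x y : Op H} (hx : x ∈ M) (hy : y ∈ M) (h : vec x = vec y) : x = y :=
  sub_eq_zero.1 (S.eq_zero (sub_mem hx hy) (by rw [map_sub, h, sub_self]))

theorem ext {E : Type*} [NormedAddCommGroup E] [NormedSpace ℂ E] {T T' : K →L[ℂ] E}
    (h : ∀ x ∈ M, T (vec x) = T' (vec x)) (ξ : K) : T ξ = T' ξ := by
  have : (fun ξ => T ξ) = fun ξ => T' ξ :=
    Continuous.ext_on S.dense T.continuous T'.continuous (by rintro _ ⟨x, hx, rfl⟩; exact h x hx)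
  exact congrFun this ξ

theorem ext_inner {ξ η : K} (h : ∀ x ∈ M, Inner.inner ℂ ξ (vec x) = Inner.inner ℂ η (vec x)) :
    ξ = η := by
  refine ext_inner_right ℂ fun ζ => ?_
  exact S.ext (T := innerSL ℂ ξ) (T' := innerSL ℂ η) h ζ

theorem L_mul {x y : Op H} (hx : x ∈ M) (hy : y ∈ M) (ξ : K) : L x (L y ξ) = L (x * y) ξ :=
  S.ext (T := L x ∘L L y) (T' := L (x * y)) (fun z hz => by
    rw [ContinuousLinearMap.comp_apply, S.Lvec y hy z hz, S.Lvec x hx _ (mul_mem hy hz),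
      S.Lvec _ (mul_mem hx hy) z hz, mul_assoc]) ξ

theorem R_mul {x y : Op H} (hx : x ∈ M) (hy : y ∈ M) (ξ : K) : R x (R y ξ) = R (y * x) ξ :=
  S.ext (T := R x ∘L R y) (T' := R (y * x)) (fun z hz => by
    rw [ContinuousLinearMap.comp_apply, S.Rvec y hy z hz, S.Rvec x hx _ (mul_mem hz hy),
      S.Rvec _ (mul_mem hy hx) z hz, mul_assoc]) ξ

theorem L_R {x y : Op H} (hx : x ∈ M) (hy : y ∈ M) (ξ : K) : L x (R y ξ) = R y (L x ξ) :=
  S.ext (T := L x ∘L R y) (T' := R y ∘L L x) (fun z hz => by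
    rw [ContinuousLinearMap.comp_apply, ContinuousLinearMap.comp_apply, S.Rvec y hy z hz,
      S.Lvec x hx _ (mul_mem hz hy), S.Lvec x hx z hz, S.Rvec y hy _ (mul_mem hx hz), mul_assoc]) ξ

theorem L_one (ξ : K) : L 1 ξ = ξ :=
  S.ext (T := L 1) (T' := ContinuousLinearMap.id ℂ K) (fun z hz => by
    rw [S.Lvec 1 (one_mem M) z hz, one_mul]; rfl) ξ

theorem R_one (ξ : K) : R 1 ξ = ξ :=
  S.ext (T := R 1) (T' := ContinuousLinearMap.id ℂ K) (fun z hz => by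
    rw [S.Rvec 1 (one_mem M) z hz, mul_one]; rfl) ξ

theorem L_add {x y : Op H} (hx : x ∈ M) (hy : y ∈ M) (ξ : K) : L (x + y) ξ = L x ξ + L y ξ :=
  S.ext (T := L (x + y)) (T' := L x + L y) (fun z hz => by
    rw [_root_.add_apply, S.Lvec _ (add_mem hx hy) z hz, S.Lvec x hx z hz, S.Lvec y hy z hz,
      add_mul, map_add]) ξ

theorem R_add {x y : Op H} (hx : x ∈ M) (hy : y ∈ M) (ξ : K) : R (x + y) ξ = R x ξ + R y ξ :=
  S.ext (T := R (x + y)) (T' := R x + R y) (fun z hz => by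
    rw [_root_.add_apply, S.Rvec _ (add_mem hx hy) z hz, S.Rvec x hx z hz, S.Rvec y hy z hz,
      mul_add, map_add]) ξ

theorem L_smul {x : Op H} (hx : x ∈ M) (c : ℂ) (ξ : K) : L (c • x) ξ = c • L x ξ :=
  S.ext (T := L (c • x)) (T' := c • L x) (fun z hz => by
    rw [ContinuousLinearMap.smul_apply, S.Lvec _ (vn_smul M hx c) z hz, S.Lvec x hx z hz,
      smul_mul_assoc, map_smul]) ξ

theorem R_smul {x : Op H} (hx : x ∈ M) (c : ℂ) (ξ : K) : R (c • x) ξ = c • R x ξ :=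
  S.ext (T := R (c • x)) (T' := c • R x) (fun z hz => by
    rw [ContinuousLinearMap.smul_apply, S.Rvec _ (vn_smul M hx c) z hz, S.Rvec x hx z hz,
      mul_smul_comm, map_smul]) ξ

theorem L_sub {x y : Op H} (hx : x ∈ M) (hy : y ∈ M) (ξ : K) : L (x - y) ξ = L x ξ - L y ξ := by
  rw [eq_sub_iff_add_eq, ← S.L_add (sub_mem hx hy) hy, sub_add_cancel]

theorem L_inner {x : Op H} (hx : x ∈ M) (ξ η : K) :
    Inner.inner ℂ (L (star x) ξ) η = Inner.inner ℂ ξ (L x η) := by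
  have h1 : ∀ y ∈ M, ∀ z ∈ M, Inner.inner ℂ (L (star x) (vec y)) (vec z) =
      Inner.inner ℂ (vec y) (L x (vec z)) := fun y hy z hz => by
    rw [S.Lvec _ (star_mem hx) y hy, S.Lvec _ hx z hz, S.inner _ (mul_mem (star_mem hx) hy) _ hz,
      S.inner _ hy _ (mul_mem hx hz), star_mul, star_star, mul_assoc]
  have h2 : ∀ y ∈ M, Inner.inner ℂ (L (star x) (vec y)) η = Inner.inner ℂ (vec y) (L x η) :=
    fun y hy => S.ext (T := innerSL ℂ (L (star x) (vec y))) (T' := innerSL ℂ (vec y) ∘L L x)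
      (fun z hz => h1 y hy z hz) η
  rw [← inner_conj_symm, ← inner_conj_symm ξ]
  congr 1
  exact S.ext (T := innerSL ℂ η ∘L L (star x)) (T' := innerSL ℂ (L x η)) (fun y hy => by
    have := h2 y hy
    rw [← inner_conj_symm, ← inner_conj_symm (vec y)] at this
    exact (RingHom.injective _ this)) ξ

theorem R_inner {x : Op H} (hx : x ∈ M) (ξ η : K) :
    Inner.inner ℂ (R (star x) ξ) η = Inner.inner ℂ ξ (R x η) := by
  have h1 : ∀ y ∈ M, ∀ z ∈ M, Inner.inner ℂ (R (star x) (vec y)) (vec z) =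
      Inner.inner ℂ (vec y) (R x (vec z)) := fun y hy z hz => by
    rw [S.Rvec _ (star_mem hx) y hy, S.Rvec _ hx z hz, S.inner _ (mul_mem hy (star_mem hx)) _ hz,
      S.inner _ hy _ (mul_mem hz hx), star_mul, star_star, mul_assoc,
      S.tr.tracial _ hx _ (mul_mem (star_mem hy) hz), mul_assoc]
  have h2 : ∀ y ∈ M, Inner.inner ℂ (R (star x) (vec y)) η = Inner.inner ℂ (vec y) (R x η) :=
    fun y hy => S.ext (T := innerSL ℂ (R (star x) (vec y))) (T' := innerSL ℂ (vec y) ∘L R x)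
      (fun z hz => h1 y hy z hz) η
  rw [← inner_conj_symm, ← inner_conj_symm ξ]
  congr 1
  exact S.ext (T := innerSL ℂ η ∘L R (star x)) (T' := innerSL ℂ (R x η)) (fun y hy => by
    have := h2 y hy
    rw [← inner_conj_symm, ← inner_conj_symm (vec y)] at this
    exact (RingHom.injective _ this)) ξ

theorem L_adj {x : Op H} (hx : x ∈ M) : ContinuousLinearMap.adjoint (L x) = L (star x) :=
  ((ContinuousLinearMap.eq_adjoint_iff _ _).2 fun ξ η => S.L_inner hx ξ η).symm

theorem R_adj {x : Op H} (hx : x ∈ M) : ContinuousLinearMap.adjoint (R x) = R (star x) :=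
  ((ContinuousLinearMap.eq_adjoint_iff _ _).2 fun ξ η => S.R_inner hx ξ η).symm

theorem vec_eq {x : Op H} (hx : x ∈ M) : vec x = L x (vec 1) := by
  rw [S.Lvec x hx 1 (one_mem M), mul_one]

theorem vec_eq' {x : Op H} (hx : x ∈ M) : vec x = R x (vec 1) := by
  rw [S.Rvec x hx 1 (one_mem M), one_mul]

theorem norm_one : ‖vec 1‖ = 1 := by
  have := S.norm_sq (one_mem M)
  rw [star_one, one_mul, S.tr.map_one] at this
  rw [← sq_eq_sq₀ (norm_nonneg _) zero_le_one, this]; simp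

theorem norm_vec_le {x : Op H} (hx : x ∈ M) : ‖vec x‖ ≤ ‖x‖ := by
  rw [S.vec_eq hx]
  refine ((L x).le_opNorm _).trans ?_
  rw [S.norm_one, mul_one]
  exact S.Lnorm x hx

theorem tendsto_vec {x : ℕ → Op H} {y : Op H} (hx : ∀ n, x n ∈ M) (hy : y ∈ M)
    (h : Tendsto x atTop (nhds y)) : Tendsto (fun n => vec (x n)) atTop (nhds (vec y)) := by
  rw [tendsto_iff_norm_sub_tendsto_zero] at h ⊢
  refine squeeze_zero (fun _ => norm_nonneg _) (fun n => ?_) h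
  rw [← map_sub]
  exact S.norm_vec_le (sub_mem (hx n) hy)

end IsStd

theorem norm_le_of_bdd (S : IsStd M τ vec L R) (hQ : (Q : Set (Op H)) ⊆ M) {w : Op H} (hw : w ∈ Q)
    {C : ℝ} (hC : 0 ≤ C) (h : ∀ y ∈ Q, ‖vec (w * y)‖ ≤ C * ‖vec y‖) : ‖w‖ ≤ C := by
  set b : Op H := star w * w with hb
  have bQ : b ∈ Q := mul_mem (star_mem hw) hw
  have bsa : IsSelfAdjoint b := IsSelfAdjoint.star_mul_self w
  set f : ℝ → ℝ := fun t => max (t - C^2) 0 with hf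
  have fc : Continuous f := by fun_prop
  set g : Op H := cfc f b with hg
  have gQ : g ∈ Q := cfc_mem_vn bQ f
  have gsa : IsSelfAdjoint g := cfc_predicate _ _
  have e1 : g * (b - ((C^2 : ℝ) : ℂ) • 1) * g = g * g * g := by
    have e2 : b - ((C^2 : ℝ) : ℂ) • 1 = cfc (fun t : ℝ => t - C^2) b := by
      rw [cfc_sub (fun t : ℝ => t) (fun _ => C^2) b (by fun_prop) (by fun_prop), cfc_id' ℝ b,
        cfc_const (C^2) b bsa, Algebra.algebraMap_eq_smul_one, ← Complex.coe_smul (C^2) (1 : Op H)]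
    rw [e2, hg, ← cfc_mul f _ b (by fun_prop) (by fun_prop),
      ← cfc_mul _ f b (by fun_prop) (by fun_prop), ← cfc_mul f f b (by fun_prop) (by fun_prop),
      ← cfc_mul _ f b (by fun_prop) (by fun_prop)]
    refine cfc_congr fun t _ => ?_
    simp only [hf]
    rcases le_total (t - C^2) 0 with h | h
    · simp [max_eq_right h]
    · simp [max_eq_left h]
  have g0 : 0 ≤ g := cfc_nonneg fun t _ => le_max_right _ _
  have ggg : 0 ≤ g * g * g := by
    have := star_left_conjugate_nonneg g0 g
    rwa [gsa.star_eq] at this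
  have h1 := h g gQ
  have h2 : (τ (star (w * g) * (w * g))).re ≤ C^2 * (τ (star g * g)).re := by
    rw [← S.norm_sq (hQ (mul_mem hw gQ)), ← S.norm_sq (hQ gQ), ← mul_pow]
    exact pow_le_pow_left₀ (norm_nonneg _) h1 2
  have e3 : star (w * g) * (w * g) = g * (b - ((C^2 : ℝ) : ℂ) • 1) * g + ((C^2 : ℝ) : ℂ) • (star g * g) := by
    rw [star_mul, gsa.star_eq, mul_sub, sub_mul, hb]
    simp [mul_assoc]
  rw [e3, e1, map_add, map_smul, smul_eq_mul, Complex.add_re, Complex.re_ofReal_mul] at h2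
  have h3 := S.tr.nonneg (hQ (mul_mem (mul_mem gQ gQ) gQ)) ggg
  have h4 : g * g * g = 0 := S.tr.eq_zero (hQ (mul_mem (mul_mem gQ gQ) gQ)) ggg
    (Complex.ext (le_antisymm (by simp; linarith) (Complex.le_def.1 h3).1) (Complex.le_def.1 h3).2.symm)
  have h5 : g * g = 0 := by
    have : star (g * g) * (g * g) = 0 := by
      rw [star_mul, gsa.star_eq, mul_assoc, ← mul_assoc g g g, h4, mul_zero]
    exact CStarRing.star_mul_self_eq_zero_iff _ |>.1 this
  have h6 : g = 0 := by
    rw [← CStarRing.star_mul_self_eq_zero_iff, gsa.star_eq, h5]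
  have h7 : b ≤ algebraMap ℝ (Op H) (C^2) := by
    have e : cfc (fun t : ℝ => C^2 + f t) b = algebraMap ℝ (Op H) (C^2) := by
      rw [cfc_const_add _ f b (by fun_prop) bsa, ← hg, h6, add_zero]
    rw [← e]
    refine (le_of_eq (cfc_id' ℝ b).symm).trans (cfc_mono (fun t _ => ?_) (by fun_prop) (by fun_prop))
    have := le_max_left (t - C^2) 0
    simp only [hf]; linarith
  have h8 : ‖b‖ ≤ C^2 :=
    (CStarAlgebra.norm_le_iff_le_algebraMap b (by positivity) (star_mul_self_nonneg w)).2 h7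
  rw [hb, CStarRing.norm_star_mul_self] at h8
  exact abs_le_of_sq_le_sq' (by nlinarith) hC |>.2

/-- the image of `Q` in `L²` -/
noncomputable def l2 (vec : Op H →ₗ[ℂ] K) (Q : VonNeumannAlgebra H) : Submodule ℂ K :=
  (Subalgebra.toSubmodule Q.toStarSubalgebra.toSubalgebra).map vec

theorem mem_l2 {ξ : K} : ξ ∈ l2 vec Q ↔ ∃ x ∈ Q, vec x = ξ := Iff.rfl

theorem vec_mem_l2 {x : Op H} (hx : x ∈ Q) : vec x ∈ l2 vec Q := ⟨x, hx, rfl⟩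

variable {ω : Ultrafilter ℕ}

theorem left_bounded (S : IsStd M τ vec L R) (hQ : (Q : Set (Op H)) ⊆ M) (hω : IsFreeUltrafilter ω)
    (hn : Nrml ω M τ) {ξ : K} (hξ : ξ ∈ (l2 vec Q).topologicalClosure) {C : ℝ} (hC : 0 ≤ C)
    (hb : ∀ y ∈ Q, ‖R y ξ‖ ≤ C * ‖vec y‖) : ∃ w ∈ Q, vec w = ξ := by
  have hτ := S.tr.restrict hQ
  have hn' := hn.restrict hQ
  have ex : ∀ k : ℕ, ∃ x ∈ Q, ‖vec x - ξ‖ < (1/2) * (1/4)^k := fun k => by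
    obtain ⟨_, ⟨x, hx, rfl⟩, h⟩ := Metric.mem_closure_iff.1 hξ ((1/2) * (1/4)^k) (by positivity)
    exact ⟨x, hx, by rwa [dist_comm, dist_eq_norm] at h⟩
  choose n nQ hnξ using ex
  have ntend : Tendsto (fun k => vec (n k)) atTop (nhds ξ) := by
    rw [tendsto_iff_norm_sub_tendsto_zero]
    refine squeeze_zero (fun _ => norm_nonneg _) (fun k => (hnξ k).le) ?_
    have := (tendsto_pow_atTop_nhds_zero_of_lt_one (r := (1/4:ℝ)) (by norm_num) (by norm_num)).const_mul (1/2)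
    simpa using this
  have dQ : ∀ k, n (k+1) - n k ∈ Q := fun k => sub_mem (nQ _) (nQ _)
  obtain ⟨a, aQ, asa, a1, hda, had, al, a2⟩ := egorov hω hτ hn' (fun k => n (k+1) - n k) dQ (fun k => by
    rw [← S.norm_sq (hQ (dQ k))]
    have : ‖vec (n (k+1) - n k)‖ ≤ (1/4)^k := by
      rw [map_sub, show vec (n (k+1)) - vec (n k) = (vec (n (k+1)) - ξ) - (vec (n k) - ξ) by abel]
      refine (norm_sub_le _ _).trans ?_
      have h1 := hnξ k
      have h2 := hnξ (k+1)
      rw [pow_succ] at h2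
      have : (0:ℝ) < (1/4)^k := by positivity
      linarith
    calc _ ≤ ((1/4:ℝ)^k)^2 := pow_le_pow_left₀ (norm_nonneg _) this 2
      _ = _ := by rw [← pow_mul, mul_comm, pow_mul]; norm_num)
  have half : ∀ m k : ℕ, (1/2:ℝ)^(m+k) ≤ 1 * (1/2)^k := fun m k => by
    rw [pow_add]; gcongr; exact pow_le_one₀ (by norm_num) (by norm_num)
  have wex : ∀ m, ∃ w ∈ Q, Tendsto (fun k => a m * n (m + k)) atTop (nhds w) := fun m => by
    have := cauchySeq_of_le_geometric (1/2) 1 (f := fun k => a m * n (m + k)) (by norm_num) (fun k => by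
      rw [dist_comm, dist_eq_norm, ← mul_sub]
      exact (had m (m+k) (by omega)).trans (half m k))
    obtain ⟨w, hw⟩ := cauchySeq_tendsto_of_complete this
    exact ⟨w, (vn_isClosed Q).mem_of_tendsto hw (Filter.Eventually.of_forall fun k =>
      mul_mem (aQ m) (nQ _)), hw⟩
  have yex : ∀ m, ∃ w ∈ Q, Tendsto (fun k => n (m + k) * a m) atTop (nhds w) := fun m => by
    have := cauchySeq_of_le_geometric (1/2) 1 (f := fun k => n (m + k) * a m) (by norm_num) (fun k => by
      rw [dist_comm, dist_eq_norm, ← sub_mul]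
      exact (hda m (m+k) (by omega)).trans (half m k))
    obtain ⟨w, hw⟩ := cauchySeq_tendsto_of_complete this
    exact ⟨w, (vn_isClosed Q).mem_of_tendsto hw (Filter.Eventually.of_forall fun k =>
      mul_mem (nQ _) (aQ m)), hw⟩
  choose w wQ hw using wex
  choose y yQ hy using yex
  have ns : ∀ m, Tendsto (fun k => vec (n (m + k))) atTop (nhds ξ) := fun m =>
    ntend.comp (tendsto_atTop_mono (fun k => Nat.le_add_left k m) tendsto_id)
  have vw : ∀ m, vec (w m) = L (a m) ξ := fun m => by
    refine tendsto_nhds_unique (S.tendsto_vec (fun k => hQ (mul_mem (aQ m) (nQ _))) (hQ (wQ m)) (hw m)) ?_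
    refine (((L (a m)).continuous.tendsto ξ).comp (ns m)).congr fun k => ?_
    exact S.Lvec _ (hQ (aQ m)) _ (hQ (nQ _))
  have vy : ∀ m, vec (y m) = R (a m) ξ := fun m => by
    refine tendsto_nhds_unique (S.tendsto_vec (fun k => hQ (mul_mem (nQ _) (aQ m))) (hQ (yQ m)) (hy m)) ?_
    refine (((R (a m)).continuous.tendsto ξ).comp (ns m)).congr fun k => ?_
    exact S.Rvec _ (hQ (aQ m)) _ (hQ (nQ _))
  have wC : ∀ m, ‖w m‖ ≤ C := fun m => by
    refine norm_le_of_bdd S hQ (wQ m) hC fun z hz => ?_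
    rw [← S.Rvec _ (hQ hz) _ (hQ (wQ m)), vw, ← S.L_R (hQ (aQ m)) (hQ hz)]
    refine (((L (a m)).le_opNorm _).trans ?_).trans (hb z hz)
    exact mul_le_of_le_one_left (norm_nonneg _) ((S.Lnorm _ (hQ (aQ m))).trans (a1 m))
  have wy : ∀ i j, a i * y j = w i * a j := fun i j => by
    refine S.inj (hQ (mul_mem (aQ i) (yQ j))) (hQ (mul_mem (wQ i) (aQ j))) ?_
    rw [← S.Lvec _ (hQ (aQ i)) _ (hQ (yQ j)), ← S.Rvec _ (hQ (aQ j)) _ (hQ (wQ i)), vw, vy,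
      S.L_R (hQ (aQ i)) (hQ (aQ j))]
  obtain ⟨W, -, hW⟩ := wot_lim ω w C wC
  have WQ := hW.mem_vn wQ
  have yW : ∀ j, y j = W * a j := fun j => by
    have h1 := al.comp_right (y j)
    have h2 := hW.comp_right (a j)
    have := (h1.congr (Filter.Eventually.of_forall fun i => wy i j)).unique h2
    exact this
  refine ⟨W, WQ, ?_⟩
  have e : ∀ j, R (a j) (vec W) = R (a j) ξ := fun j => by
    rw [S.Rvec _ (hQ (aQ j)) _ (hQ WQ), ← yW, vy]
  refine S.ext_inner fun z hz => ?_
  have e2 : ∀ j, Inner.inner ℂ (vec W) (vec (z * a j)) = Inner.inner ℂ ξ (vec (z * a j)) := fun j => by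
    rw [← S.Rvec _ (hQ (aQ j)) _ hz, ← S.R_inner (hQ (aQ j)), ← S.R_inner (hQ (aQ j)),
      (asa j).star_eq, e]
  have t : Tendsto (fun j => vec (z * a j)) atTop (nhds (vec z)) := by
    rw [tendsto_iff_norm_sub_tendsto_zero]
    have t1 : Tendsto (fun j => ‖z‖ * Real.sqrt ((τ (star (1 - a j) * (1 - a j))).re)) atTop (nhds (‖z‖ * Real.sqrt 0)) :=
      (a2.sqrt).const_mul _
    rw [Real.sqrt_zero, mul_zero] at t1
    refine squeeze_zero (fun _ => norm_nonneg _) (fun j => ?_) t1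
    have m1 : 1 - a j ∈ M := sub_mem (one_mem M) (hQ (aQ j))
    rw [← S.norm_sq m1, Real.sqrt_sq (norm_nonneg _), ← norm_neg, neg_sub, ← map_sub,
      show z - z * a j = z * (1 - a j) by noncomm_ring, ← S.Lvec z hz _ m1]
    refine ((L z).le_opNorm _).trans ?_
    gcongr
    exact S.Lnorm z hz
  refine tendsto_nhds_unique ((tendsto_const_nhds).inner t) ?_
  simp only [e2]
  exact (tendsto_const_nhds).inner t

theorem bimodule (S : IsStd M τ vec L R) (hQ : (Q : Set (Op H)) ⊆ M) (hω : IsFreeUltrafilter ω)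
    (hn : Nrml ω M τ) (hf : relComm (Q : Set (Op H)) (Q : Set (Op H)) = scalars H)
    (U : Submodule ℂ K) (hU : U ≤ (l2 vec Q).topologicalClosure)
    (hL : ∀ x ∈ Q, ∀ ξ ∈ U, L x ξ ∈ U.topologicalClosure) (hR : ∀ x ∈ Q, ∀ ξ ∈ U, R x ξ ∈ U.topologicalClosure)
    (h0 : ∃ ξ ∈ U, ξ ≠ 0) : vec 1 ∈ U.topologicalClosure := by
  have cL : ∀ x ∈ Q, ∀ ξ, pr U (L x ξ) = L x (pr U ξ) := fun x hx =>
    pr_comm (hL x hx) (by rw [S.L_adj (hQ hx)]; exact hL _ (star_mem hx))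
  have cR : ∀ x ∈ Q, ∀ ξ, pr U (R x ξ) = R x (pr U ξ) := fun x hx =>
    pr_comm (hR x hx) (by rw [S.R_adj (hQ hx)]; exact hR _ (star_mem hx))
  have hUc : U.topologicalClosure ≤ (l2 vec Q).topologicalClosure :=
    Submodule.topologicalClosure_minimal _ hU (Submodule.isClosed_topologicalClosure _)
  obtain ⟨z, hz, hz'⟩ := left_bounded S hQ hω hn (hUc (pr_mem U (vec 1))) (C := 1) zero_le_one
    (fun y hy => by
      rw [← cR y hy, S.Rvec _ (hQ hy) _ (one_mem M), one_mul, one_mul]; exact pr_norm _ _)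
  have zc : z ∈ relComm (Q : Set (Op H)) (Q : Set (Op H)) := ⟨hz, fun x hx => by
    refine S.inj (hQ (mul_mem hx hz)) (hQ (mul_mem hz hx)) ?_
    rw [← S.Lvec _ (hQ hx) _ (hQ hz), ← S.Rvec _ (hQ hx) _ (hQ hz), hz', ← cL x hx, ← cR x hx,
      ← S.vec_eq (hQ hx), ← S.vec_eq' (hQ hx)]⟩
  rw [hf] at zc
  obtain ⟨c, rfl⟩ := zc
  rw [map_smul] at hz'
  have hc : c ≠ 0 := by
    rintro rfl
    rw [zero_smul] at hz'
    obtain ⟨ξ, hξ, hξ0⟩ := h0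
    apply hξ0
    rw [← pr_eq' hξ]
    have hcl : IsClosed {ξ : K | pr U ξ = 0} := isClosed_eq (by fun_prop) continuous_const
    refine closure_minimal (s := (l2 vec Q : Set K)) (t := {ξ : K | pr U ξ = 0}) ?_ hcl (hU hξ)
    rintro _ ⟨x, hx, rfl⟩
    show pr U (vec x) = 0
    rw [S.vec_eq (hQ hx), cL x hx, ← hz', map_zero]
  have : vec (1 : Op H) = c⁻¹ • pr U (vec 1) := by rw [← hz', smul_smul, inv_mul_cancel₀ hc, one_smul]
  rw [this]
  exact Submodule.smul_mem _ _ (pr_mem _ _)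

end std

section dens
variable {H : Type u} [NormedAddCommGroup H] [InnerProductSpace ℂ H] [CompleteSpace H]
variable {M Q : VonNeumannAlgebra H} {τ : Op H →ₗ[ℂ] ℂ} {K : Type u} [NormedAddCommGroup K]
    [InnerProductSpace ℂ K] [CompleteSpace K] {vec : Op H →ₗ[ℂ] K} {L R : Op H → (K →L[ℂ] K)}
variable {ω : Ultrafilter ℕ}

theorem hs_fst_le {K1 K2 : Type*} [NormedAddCommGroup K1] [InnerProductSpace ℂ K1]
    [NormedAddCommGroup K2] [InnerProductSpace ℂ K2] (g : HS K1 K2) : ‖g.fst‖ ≤ ‖g‖ := by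
  refine (sq_le_sq₀ (norm_nonneg _) (norm_nonneg _)).1 ?_
  rw [WithLp.prod_norm_sq_eq_of_L2]; nlinarith [sq_nonneg ‖g.snd‖]

theorem hs_snd_le {K1 K2 : Type*} [NormedAddCommGroup K1] [InnerProductSpace ℂ K1]
    [NormedAddCommGroup K2] [InnerProductSpace ℂ K2] (g : HS K1 K2) : ‖g.snd‖ ≤ ‖g‖ := by
  refine (sq_le_sq₀ (norm_nonneg _) (norm_nonneg _)).1 ?_
  rw [WithLp.prod_norm_sq_eq_of_L2]; nlinarith [sq_nonneg ‖g.fst‖]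

/-- graph map -/
noncomputable def gmap (vec : Op H →ₗ[ℂ] K) (ζ : H) : Op H →ₗ[ℂ] HS H K where
  toFun y := pp (y ζ) (vec y)
  map_add' x y := by apply hs_ext <;> simp
  map_smul' c x := by apply hs_ext <;> simp

theorem pow_lim_zero {c C : ℝ} (n : ℕ) (h : ∀ k ≥ n, c ≤ (1/2)^k * C) : c ≤ 0 := by
  have : Tendsto (fun k : ℕ => (1/2 : ℝ)^k * C) atTop (nhds (0 * C)) :=
    (tendsto_pow_atTop_nhds_zero_of_lt_one (by norm_num) (by norm_num)).mul_const C
  rw [zero_mul] at this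
  exact ge_of_tendsto this (eventually_atTop.2 ⟨n, fun k hk => h k hk⟩)

theorem exists_intertwiner (S : IsStd M τ vec L R) (hω : IsFreeUltrafilter ω) (hn : Nrml ω M τ)
    {ζ : H} (hζ : ζ ≠ 0) : ∃ b : H →L[ℂ] K, b ≠ 0 ∧ ∀ x ∈ M, ∀ h, b (x h) = L x (b h) := by
  let G : Submodule ℂ (HS H K) :=
    (Subalgebra.toSubmodule M.toStarSubalgebra.toSubalgebra).map (gmap vec ζ)
  have hG : ∀ y ∈ M, pp (y ζ) (vec y) ∈ G := fun y hy => ⟨y, hy, rfl⟩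
  have inv : ∀ x ∈ M, ∀ g ∈ G, pp (x g.fst) (L x g.snd) ∈ G.topologicalClosure := by
    rintro x hx _ ⟨y, hy, rfl⟩
    refine G.le_topologicalClosure ?_
    convert hG (x * y) (mul_mem hx hy) using 1
    refine hs_ext rfl ?_
    exact S.Lvec x hx y hy
  refine ⟨offd G, fun h0 => hζ ?_, fun x hx h => offd_comm (inv x hx) ?_ h⟩
  · have h1 := offd_zero h0 (hG 1 (one_mem M))
    have h2 : ∀ k : ℕ, ∃ y ∈ M, ‖y ζ‖ ≤ (1/4)^k ∧ ‖vec y - vec 1‖ ≤ (1/4)^k := fun k => by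
      obtain ⟨_, ⟨y, hy, rfl⟩, h⟩ := Metric.mem_closure_iff.1 h1 ((1/4)^k) (by positivity)
      rw [dist_comm, dist_eq_norm] at h
      have e1 := hs_fst_le (gmap vec ζ y - (pp 0 (vec 1) : HS H K))
      have e2 := hs_snd_le (gmap vec ζ y - (pp 0 (vec 1) : HS H K))
      have f1 : (gmap vec ζ y - (pp 0 (vec 1) : HS H K)).fst = y ζ := sub_zero _
      rw [f1] at e1
      exact ⟨y, hy, e1.trans h.le, e2.trans h.le⟩
    choose y hy h3 h4 using h2
    obtain ⟨a, ha, -, ha1, -, had, haw, -⟩ := egorov hω S.tr hn (fun k => 1 - y k)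
      (fun k => sub_mem (one_mem M) (hy k)) (fun k => by
        rw [← S.norm_sq (sub_mem (one_mem M) (hy k)), map_sub, norm_sub_rev]
        calc _ ≤ ((1/4 : ℝ)^k)^2 := by gcongr; exact h4 k
          _ = _ := by rw [← pow_mul, mul_comm, pow_mul]; norm_num)
    have ha0 : ∀ n, a n ζ = 0 := fun n => by
      rw [← norm_le_zero_iff]
      refine pow_lim_zero (C := ‖ζ‖ + 1) n fun k hk => ?_
      have e : a n ζ = (a n * (1 - y k)) ζ + a n (y k ζ) := by
        rw [mul_sub, mul_one]; simp
      rw [e, mul_add, mul_one]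
      refine (norm_add_le _ _).trans (add_le_add ?_ ?_)
      · exact ((a n * (1 - y k)).le_opNorm ζ).trans (by gcongr; exact had n k hk)
      · refine ((a n).le_opNorm _).trans ?_
        calc _ ≤ 1 * (1/4 : ℝ)^k := by gcongr; exact ha1 n; exact h3 k
          _ ≤ _ := by rw [one_mul]; gcongr; norm_num
    have := haw ζ ζ
    simp only [ha0, inner_zero_right] at this
    have h5 := tendsto_nhds_unique this tendsto_const_nhds
    simpa using h5
  · intro g hg
    rw [S.L_adj hx]
    exact inv (star x) (star_mem hx) g hg

theorem mem_closure_top (S : IsStd M τ vec L R) {U : Submodule ℂ K}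
    (h : ∀ x ∈ M, vec x ∈ U.topologicalClosure) (ξ : K) : ξ ∈ U.topologicalClosure :=
  closure_minimal (by rintro _ ⟨x, hx, rfl⟩; exact h x hx) U.isClosed_topologicalClosure (S.dense ξ)

theorem comm_ext (S : IsStd M τ vec L R) (hω : IsFreeUltrafilter ω) (hn : Nrml ω M τ)
    (hf : relComm (M : Set (Op H)) (M : Set (Op H)) = scalars H) {A : Set (Op H)}
    (hA : A ⊆ M) (hAs : ∀ a ∈ A, star a ∈ A)
    (hc : Set.centralizer (Set.centralizer A) = (M : Set (Op H))) {X : K →L[ℂ] K}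
    (hX : ∀ a ∈ A, ∀ ξ, X (L a ξ) = L a (X ξ)) : ∀ x ∈ M, ∀ ξ, X (L x ξ) = L x (X ξ) := by
  let U : Submodule ℂ K := Submodule.span ℂ {ξ | ∃ (b : H →L[ℂ] K) (h : H),
    (∀ x ∈ M, ∀ h, b (x h) = L x (b h)) ∧ ξ = b h}
  have hU : ∀ (b : H →L[ℂ] K) (h : H), (∀ x ∈ M, ∀ h, b (x h) = L x (b h)) → b h ∈ U :=
    fun b h hb => Submodule.subset_span ⟨b, h, hb, rfl⟩
  have hind : ∀ (T : K →L[ℂ] K), (∀ (b : H →L[ℂ] K) (h : H), (∀ x ∈ M, ∀ h, b (x h) = L x (b h)) →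
      T (b h) ∈ U) → ∀ ξ ∈ U, T ξ ∈ U.topologicalClosure := fun T hT ξ hξ => by
    refine U.le_topologicalClosure ?_
    have : U ≤ U.comap (T : K →ₗ[ℂ] K) := by
      refine Submodule.span_le.2 ?_
      rintro _ ⟨b, h, hb, rfl⟩
      exact hT b h hb
    exact this hξ
  have hl : ∀ x ∈ M, ∀ ξ ∈ U, L x ξ ∈ U.topologicalClosure := fun x hx => hind (L x)
    fun b h hb => by rw [← hb x hx]; exact hU b _ hb
  have hr : ∀ x ∈ M, ∀ ξ ∈ U, R x ξ ∈ U.topologicalClosure := fun x hx => hind (R x)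
    fun b h hb => hU (R x ∘L b) h fun y hy h => by
      simp only [ContinuousLinearMap.comp_apply]; rw [hb y hy, S.L_R hy hx]
  have hH : ∃ ζ : H, ζ ≠ 0 := by
    by_contra h
    push Not at h
    have h1 : (1 : Op H) = 0 := by ext x; simp [h]
    have := S.tr.map_one
    rw [h1, map_zero] at this
    exact zero_ne_one this
  obtain ⟨ζ, hζ⟩ := hH
  obtain ⟨b, hb0, hb⟩ := exists_intertwiner S hω hn hζ
  have hne : ∃ ξ ∈ U, ξ ≠ 0 := by
    by_contra h
    push Not at h
    exact hb0 (by ext x; exact h _ (hU b x hb))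
  have h1 := bimodule S subset_rfl hω hn hf U (fun ξ _ => mem_closure_top S (fun x hx =>
    (l2 vec M).le_topologicalClosure (vec_mem_l2 hx)) ξ) hl hr hne
  have hall : ∀ ξ, ξ ∈ U.topologicalClosure := mem_closure_top S fun x hx => by
    rw [S.vec_eq hx]; exact closure_map (hl x hx) h1
  intro x hx
  -- key
  have key : ∀ (b : H →L[ℂ] K) (h : H), (∀ x ∈ M, ∀ h, b (x h) = L x (b h)) →
      X (L x (b h)) = L x (X (b h)) := by
    intro b h hb
    rw [← sub_eq_zero]
    have h2 : ∀ ξ ∈ U, inner ℂ ξ (X (L x (b h)) - L x (X (b h))) = 0 := by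
      intro ξ hξ
      induction hξ using Submodule.span_induction with
      | zero => simp
      | add x y _ _ hx hy => rw [inner_add_left, hx, hy, add_zero]
      | smul c x _ hx => rw [inner_smul_left, hx, mul_zero]
      | mem ξ hξ =>
        obtain ⟨b', h', hb', rfl⟩ := hξ
        let Y : Op H := ContinuousLinearMap.adjoint b' ∘L X ∘L b
        have hL : ∀ y ∈ M, ∀ ξ, ContinuousLinearMap.adjoint b' (L y ξ) =
            y (ContinuousLinearMap.adjoint b' ξ) := fun y hy ξ => by
          refine ext_inner_left ℂ fun v => ?_
          rw [ContinuousLinearMap.adjoint_inner_right, ← S.L_inner hy, ← hb' _ (star_mem hy),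
            ← ContinuousLinearMap.adjoint_inner_right, ContinuousLinearMap.star_eq_adjoint,
            ContinuousLinearMap.adjoint_inner_left]
        have hY : Y ∈ Set.centralizer A := by
          rw [Set.mem_centralizer_iff]
          intro a ha
          ext v
          change a (ContinuousLinearMap.adjoint b' (X (b v))) =
            ContinuousLinearMap.adjoint b' (X (b (a v)))
          rw [hb a (hA ha), hX a ha, hL a (hA ha)]
        have hx' : x ∈ Set.centralizer (Set.centralizer A) := by rw [hc]; exact hx
        have := congrArg (fun T : Op H => T h) (Set.mem_centralizer_iff.1 hx' Y hY)
        change ContinuousLinearMap.adjoint b' (X (b (x h))) =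
          x (ContinuousLinearMap.adjoint b' (X (b h))) at this
        rw [hb x hx, ← hL x hx] at this
        rw [inner_sub_right, ← ContinuousLinearMap.adjoint_inner_right, this,
          ← ContinuousLinearMap.adjoint_inner_right b', sub_self]
    have := closure_orth h2 _ (hall (X (L x (b h)) - L x (X (b h))))
    exact inner_self_eq_zero.1 this
  intro ξ
  have hcl : IsClosed {ξ : K | X (L x ξ) = L x (X ξ)} := isClosed_eq (by fun_prop) (by fun_prop)
  refine closure_minimal (s := (U : Set K)) ?_ hcl (hall ξ)
  intro η hη
  change X (L x η) = L x (X η)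
  have hη' : η ∈ U := hη
  clear hη
  induction hη' using Submodule.span_induction with
  | zero => simp
  | add x y _ _ hx hy => simp only [map_add, hx, hy]
  | smul c x _ hx => simp only [map_smul, hx]
  | mem ξ hξ =>
    obtain ⟨b, h, hb, rfl⟩ := hξ
    exact key b h hb

theorem dense_union (S : IsStd M τ vec L R) (hω : IsFreeUltrafilter ω) (hn : Nrml ω M τ)
    (hf : relComm (M : Set (Op H)) (M : Set (Op H)) = scalars H) {A : ℕ → StarSubalgebra ℂ (Op H)}
    (hmono : Monotone A) (hA : ∀ n, (A n : Set (Op H)) ⊆ M)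
    (hc : Set.centralizer (Set.centralizer (⋃ n, (A n : Set (Op H)))) = (M : Set (Op H)))
    {x : Op H} (hx : x ∈ M) {ε : ℝ} (hε : 0 < ε) : ∃ k, ∃ a ∈ A k, ‖vec x - vec a‖ < ε := by
  let V : Submodule ℂ K :=
    { carrier := {ξ | ∃ k, ∃ a ∈ A k, vec a = ξ}
      zero_mem' := ⟨0, 0, zero_mem _, map_zero _⟩
      add_mem' := by
        rintro _ _ ⟨k, a, ha, rfl⟩ ⟨l, b, hb, rfl⟩
        exact ⟨max k l, a + b, add_mem (hmono (le_max_left _ _) ha) (hmono (le_max_right _ _) hb),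
          map_add _ _ _⟩
      smul_mem' := by
        rintro c _ ⟨k, a, ha, rfl⟩
        exact ⟨k, c • a, (A k).smul_mem ha c, map_smul _ _ _⟩ }
  have hinv : ∀ k, ∀ a ∈ A k, ∀ ξ ∈ V, L a ξ ∈ V.topologicalClosure := by
    rintro k a ha _ ⟨l, b, hb, rfl⟩
    refine V.le_topologicalClosure ?_
    rw [S.Lvec a (hA k ha) b (hA l hb)]
    exact ⟨max k l, a * b, mul_mem (hmono (le_max_left _ _) ha) (hmono (le_max_right _ _) hb), rfl⟩
  have h1 := comm_ext S hω hn hf (A := ⋃ n, (A n : Set (Op H))) (Set.iUnion_subset hA)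
    (by
      intro a ha
      obtain ⟨k, hk⟩ := Set.mem_iUnion.1 ha
      exact Set.mem_iUnion.2 ⟨k, star_mem (S := StarSubalgebra ℂ (Op H)) hk⟩) hc (X := pr V) (by
      intro a ha ξ
      obtain ⟨k, hk⟩ := Set.mem_iUnion.1 ha
      refine pr_comm (hinv k a hk) ?_ ξ
      rw [S.L_adj (hA k hk)]
      exact hinv k (star a) (star_mem (S := StarSubalgebra ℂ (Op H)) hk)) x hx (vec 1)
  rw [pr_eq' (U := V) ⟨0, 1, one_mem _, rfl⟩, ← S.vec_eq hx] at h1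
  have h2 := mem_of_pr_eq h1
  obtain ⟨_, ⟨k, a, ha, rfl⟩, h⟩ := Metric.mem_closure_iff.1 h2 ε hε
  exact ⟨k, a, ha, by rwa [dist_eq_norm] at h⟩

end dens

section avg
open MeasureTheory
variable {H : Type u} [NormedAddCommGroup H] [InnerProductSpace ℂ H] [CompleteSpace H]

theorem FinDim.fd {D : StarSubalgebra ℂ (Op H)} (hD : FinDim (D : Set (Op H))) :
    FiniteDimensional ℂ D := by
  obtain ⟨s, hs⟩ := hD
  haveI : FiniteDimensional ℂ (Submodule.span ℂ (s : Set (Op H))) :=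
    FiniteDimensional.span_of_finite ℂ s.finite_toSet
  exact Submodule.finiteDimensional_of_le (S₁ := Subalgebra.toSubmodule D.toSubalgebra)
    (S₂ := Submodule.span ℂ (s : Set (Op H))) hs

theorem FinDim.closed {D : StarSubalgebra ℂ (Op H)} (hD : FinDim (D : Set (Op H))) :
    IsClosed (D : Set (Op H)) := by
  haveI := hD.fd
  exact Submodule.closed_of_finiteDimensional (Subalgebra.toSubmodule D.toSubalgebra)

theorem FinDim.compact {D : StarSubalgebra ℂ (Op H)} (hD : FinDim (D : Set (Op H))) :
    CompactSpace (unitary D) := by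
  haveI := hD.fd
  haveI : ProperSpace D := FiniteDimensional.proper ℂ D
  refine isCompact_iff_compactSpace.1 ?_
  refine Metric.isCompact_of_isClosed_isBounded isClosed_unitary ?_
  refine (Metric.isBounded_closedBall (x := (0 : D)) (r := 1)).subset ?_
  intro u hu
  rw [mem_closedBall_zero_iff]
  have h1 : ‖star (u : Op H) * u‖ ≤ 1 := by
    have : star (u : Op H) * u = 1 := congrArg Subtype.val (Unitary.mem_iff.1 hu).1
    rw [this]
    exact ContinuousLinearMap.norm_id_le
  rw [CStarRing.norm_star_mul_self] at h1
  change ‖(u : Op H)‖ ≤ 1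
  nlinarith [norm_nonneg (u : Op H)]

theorem span_unitary_fd {D : StarSubalgebra ℂ (Op H)} (hD : FinDim (D : Set (Op H))) (d : D) :
    d ∈ Submodule.span ℂ (unitary D : Set D) := by
  haveI := hD.closed
  have := CStarAlgebra.span_unitary (A := D)
  rw [this]; trivial

theorem exists_avg {B : Type*} [NormedRing B] [NormedAlgebra ℂ B] [CompleteSpace B]
    {D : StarSubalgebra ℂ (Op H)} (hD : FinDim (D : Set (Op H))) (ρ : D →ₗ[ℂ] B)
    (hmul : ∀ x y, ρ (x * y) = ρ x * ρ y) (h1 : ρ 1 = 1) (X : B) :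
    ∃ T : B, (∀ d : D, ρ d * T = T * ρ d) ∧
      (∀ C : Set B, Convex ℝ C → IsClosed C →
        (∀ u : D, u ∈ unitary D → ρ u * X * ρ (star u) ∈ C) → T ∈ C) ∧
      (∀ f : B →L[ℂ] ℂ, (∀ u : D, u ∈ unitary D → 0 ≤ (f (ρ u * X * ρ (star u))).re) →
        0 < (f X).re → 0 < (f T).re) := by
  haveI := hD.fd
  haveI := hD.compact
  letI : MeasurableSpace (unitary D) := borel (unitary D)
  haveI : BorelSpace (unitary D) := ⟨rfl⟩
  let μ : Measure (unitary D) := Measure.haarMeasure ⊤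
  haveI : IsProbabilityMeasure μ := ⟨by
    have := Measure.haarMeasure_self (K₀ := (⊤ : TopologicalSpace.PositiveCompacts (unitary D)))
    simpa [μ] using this⟩
  have ρc : Continuous ρ := ρ.continuous_of_finiteDimensional
  let F : unitary D → B := fun u => ρ u * X * ρ (star (u : D))
  have Fc : Continuous F := by
    have e1 : Continuous fun u : unitary D => ρ (u : D) := ρc.comp continuous_subtype_val
    have e2 : Continuous fun u : unitary D => ρ (star (u : D)) :=
      ρc.comp (continuous_star.comp continuous_subtype_val)
    exact (e1.mul continuous_const).mul e2
  have Fi : Integrable F μ := Fc.integrable_of_hasCompactSupport (HasCompactSupport.of_compactSpace F)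
  have uu : ∀ u : unitary D, star (u : D) * u = 1 := fun u => (Unitary.mem_iff.1 u.2).1
  refine ⟨∫ u, F u ∂μ, ?_, ?_, ?_⟩
  · intro d
    have hd := span_unitary_fd hD d
    induction hd using Submodule.span_induction with
    | zero => simp
    | add x y _ _ hx hy => rw [map_add, add_mul, mul_add, hx, hy]
    | smul c x _ hx => rw [map_smul, smul_mul_assoc, mul_smul_comm, hx]
    | mem v hv =>
      let v' : unitary D := ⟨v, hv⟩
      have e1 : ∫ u, F (v' * u) ∂μ = ∫ u, F u ∂μ := integral_mul_left_eq_self F v'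
      have e2 : ∀ u, F (v' * u) = ρ v * F u * ρ (star v) := fun u => by
        change ρ (v * u) * X * ρ (star (v * (u : D))) = ρ v * (ρ u * X * ρ (star (u : D))) * ρ (star v)
        rw [star_mul, hmul, hmul]; simp only [mul_assoc]
      simp only [e2] at e1
      have Fi2 : Integrable (fun u => ρ v * F u) μ := Fi.const_mul _
      rw [integral_mul_const_of_integrable Fi2, integral_const_mul_of_integrable Fi] at e1
      have e3 : ρ (star v) * ρ v = 1 := by rw [← hmul, (Unitary.mem_iff.1 hv).1, h1]
      conv_rhs => rw [← e1, mul_assoc, e3, mul_one]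
  · intro C hC hC' h
    exact hC.integral_mem hC' (Filter.Eventually.of_forall fun u => h u u.2) Fi
  · intro f hf hX
    have e1 : (f (∫ u, F u ∂μ)).re = ∫ u, (f (F u)).re ∂μ := by
      rw [← f.integral_comp_comm Fi]
      exact (Complex.reCLM.integral_comp_comm (f.integrable_comp Fi)).symm
    rw [e1]
    refine Continuous.integral_pos_of_hasCompactSupport_nonneg_nonzero (x := 1) ?_
      (HasCompactSupport.of_compactSpace _) (fun u => hf u u.2) ?_
    · exact Complex.continuous_re.comp (f.continuous.comp Fc)
    · have : F 1 = X := by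
        change ρ 1 * X * ρ (star 1) = X
        rw [star_one, h1, one_mul, mul_one]
      rw [this]; exact hX.ne'

end avg

section stepA
variable {H : Type u} [NormedAddCommGroup H] [InnerProductSpace ℂ H] [CompleteSpace H]
variable {M N Mω : VonNeumannAlgebra H} {τ : Op H →ₗ[ℂ] ℂ} {K : Type u} [NormedAddCommGroup K]
    [InnerProductSpace ℂ K] [CompleteSpace K] {vec : Op H →ₗ[ℂ] K} {L R : Op H → (K →L[ℂ] K)}
variable {ω : Ultrafilter ℕ} {limω : (ℕ → Op H) → Op H}

theorem Bdd.mul {x y : ℕ → Op H} (hx : Bdd x) (hy : Bdd y) : Bdd (fun n => x n * y n) := by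
  obtain ⟨C, hC⟩ := hx
  obtain ⟨D, hD⟩ := hy
  refine ⟨C * D, fun n => (norm_mul_le _ _).trans ?_⟩
  exact mul_le_mul (hC n) (hD n) (norm_nonneg _) ((norm_nonneg _).trans (hC n))

theorem Bdd.star {x : ℕ → Op H} (hx : Bdd x) : Bdd (fun n => star (x n)) := by
  obtain ⟨C, hC⟩ := hx
  exact ⟨C, fun n => by rw [norm_star]; exact hC n⟩

theorem Bdd.const (x : Op H) : Bdd (fun _ => x) := ⟨‖x‖, fun _ => le_rfl⟩

theorem norm_tau (S : IsStd M τ vec L R) {x : Op H} (hx : x ∈ M) :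
    ‖τ (star x * x)‖ = ‖vec x‖ ^ 2 := by
  rw [← S.inner x hx x hx, inner_self_eq_norm_sq_to_K]
  simp

theorem lim_eq (S : IsStd M τ vec L R) (hU : IsTracialUltrapower ω M Mω τ limω) {x y : ℕ → Op H}
    (hx : SeqIn (M : Set (Op H)) x) (bx : Bdd x) (hy : SeqIn (M : Set (Op H)) y) (bY : Bdd y)
    (h : Tendsto (fun n => ‖vec (x n) - vec (y n)‖) (ω : Filter ℕ) (nhds 0)) : limω x = limω y := by
  refine hU.congr hx bx hy bY ?_
  have : (fun n => ‖τ (star (x n - y n) * (x n - y n))‖) = fun n => ‖vec (x n) - vec (y n)‖ ^ 2 := by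
    ext n
    rw [norm_tau S (sub_mem (hx n) (hy n)), map_sub]
  rw [this]
  simpa using h.pow 2

theorem vec_tendsto (S : IsStd M τ vec L R) (hU : IsTracialUltrapower ω M Mω τ limω) {x y : ℕ → Op H}
    (hx : SeqIn (M : Set (Op H)) x) (bx : Bdd x) (hy : SeqIn (M : Set (Op H)) y) (bY : Bdd y)
    (h : limω x = limω y) : Tendsto (fun n => ‖vec (x n) - vec (y n)‖) (ω : Filter ℕ) (nhds 0) := by
  have hy' : SeqIn (M : Set (Op H)) (fun n => (-1:ℂ) • y n) := fun n => vn_smul M (hy n) _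
  have by' : Bdd (fun n => (-1:ℂ) • y n) := by
    obtain ⟨C, hC⟩ := bY; exact ⟨C, fun n => by simpa using hC n⟩
  have h1 := hU.map_add x _ hx bx hy' by'
  rw [hU.map_smul _ _ hy bY, h] at h1
  have h2 : limω y + (-1:ℂ) • limω y = 0 := by simp
  rw [h2] at h1
  have hd : SeqIn (M : Set (Op H)) (fun n => x n + (-1:ℂ) • y n) := fun n => add_mem (hx n) (hy' n)
  have bd : Bdd (fun n => x n + (-1:ℂ) • y n) := by
    obtain ⟨C, hC⟩ := bx
    obtain ⟨D, hD⟩ := by'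
    exact ⟨C + D, fun n => (norm_add_le _ _).trans (add_le_add (hC n) (hD n))⟩
  have h3 := (hU.eq_zero _ hd bd).1 h1
  have : (fun n => ‖τ (star (x n + (-1:ℂ) • y n) * (x n + (-1:ℂ) • y n))‖) =
      fun n => ‖vec (x n) - vec (y n)‖ ^ 2 := by
    ext n
    rw [norm_tau S (hd n), map_add, map_smul]
    simp [sub_eq_add_neg]
  rw [this] at h3
  have h4 := h3.sqrt
  simpa using h4

theorem unitary_norm_le {u : Op H} (hu : star u * u = 1) : ‖u‖ ≤ 1 := by
  have h1 : ‖star u * u‖ ≤ 1 := by rw [hu]; exact ContinuousLinearMap.norm_id_le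
  rw [CStarRing.norm_star_mul_self] at h1
  nlinarith [norm_nonneg u]

theorem stepA (S : IsStd M τ vec L R) (hω : IsFreeUltrafilter ω) (hn : Nrml ω M τ)
    (hf : relComm (M : Set (Op H)) (M : Set (Op H)) = scalars H) {A : ℕ → StarSubalgebra ℂ (Op H)}
    (hmono : Monotone A) (hA : ∀ n, (A n : Set (Op H)) ⊆ M)
    (hc : Set.centralizer (Set.centralizer (⋃ n, (A n : Set (Op H)))) = (M : Set (Op H)))
    (hNM : (N : Set (Op H)) ⊆ (M : Set (Op H)))
    (hU : IsTracialUltrapower ω M Mω τ limω)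
    (hE : CornerEmbeds (relComm (M : Set (Op H)) (Mω : Set (Op H)))
          (ultrapowerSet limω (N : Set (Op H))) (Mω : Set (Op H))) :
    ∃ m, ∃ w ∈ M, ∃ δ > 0, ∀ u ∈ M, star u * u = 1 → u * star u = 1 → (∀ a ∈ A m, a * u = u * a) →
      δ ≤ ‖pr (l2 vec N) (vec (w * u * star w))‖ := by
  obtain ⟨p, q, v, θ, hp, hpp, hp0, hq, hqp, hq0, hθ, hv, hv0, hvv, hqvp, hint⟩ := hE
  have hvp : v * p = v := by
    conv_lhs => rw [← hqvp]
    rw [mul_assoc, hpp.2.eq, hqvp]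
  obtain ⟨pn, hpn, bpn, lpn⟩ := hU.surj p hp.1
  obtain ⟨vn, hvn, bvn, lvn⟩ := hU.surj v hv
  by_contra hcon
  push Not at hcon
  have ex1 : ∀ n : ℕ, ∃ k, ∃ a ∈ A k, ‖vec (pn n) - vec a‖ < 1 / ((n:ℝ) + 1) := fun n =>
    dense_union S hω hn hf hmono hA hc (hpn n) (by positivity)
  choose k a ha hpa using ex1
  have ex2 : ∀ n : ℕ, _ := fun n => hcon (max n (k n)) (vn n) (hvn n) (1 / ((n:ℝ) + 1)) (by positivity)
  choose un hun h1 h2 hcomm hsmall using ex2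
  have bun : Bdd un := ⟨1, fun n => unitary_norm_le (h1 n)⟩
  have un1 : ∀ n, ‖un n‖ ≤ 1 := fun n => unitary_norm_le (h1 n)
  set u := limω un with hu
  have huM : u ∈ Mω := hU.mem un hun bun
  have tω : Tendsto (fun n : ℕ => 1 / ((n:ℝ) + 1)) (ω : Filter ℕ) (nhds 0) :=
    tendsto_one_div_add_atTop_nhds_zero_nat.mono_left hω.le_atTop
  have hus : star u = limω (fun n => star (un n)) := (hU.map_star un hun bun).symm
  have sun : SeqIn (M : Set (Op H)) (fun n => star (un n)) := fun n => star_mem (S := VonNeumannAlgebra H) (hun n)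
  have huu : u * star u = 1 := by
    rw [hus, hu, ← hU.map_mul _ _ hun bun sun bun.star]
    simp only [h2]
    exact hU.diag 1 (one_mem M)
  -- u commutes with M
  have hucA : ∀ k, ∀ b ∈ A k, b * u = u * b := by
    intro k b hb
    have hbM := hA k hb
    have hbc : SeqIn (M : Set (Op H)) (fun _ => b) := fun _ => hbM
    rw [← hU.diag b hbM, hu, ← hU.map_mul _ _ hbc (Bdd.const b) hun bun,
      ← hU.map_mul _ _ hun bun hbc (Bdd.const b)]
    refine lim_eq S hU (fun n => mul_mem hbM (hun n)) ((Bdd.const b).mul bun)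
      (fun n => mul_mem (hun n) hbM) (bun.mul (Bdd.const b)) ?_
    refine tendsto_const_nhds.congr' ((hω.ge k).mono fun n hn => ?_)
    beta_reduce
    rw [hcomm n b (hmono (le_trans hn (le_max_left _ _)) hb), sub_self, norm_zero]
  have huc : ∀ y ∈ (M : Set (Op H)), y * u = u * y := by
    intro y hy
    rw [← hc, Set.mem_centralizer_iff] at hy
    refine (hy u ?_).symm
    rw [Set.mem_centralizer_iff]
    intro b hb
    obtain ⟨k, hk⟩ := Set.mem_iUnion.1 hb
    exact hucA k b hk
  have hup : p * u = u * p := by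
    rw [← lpn, hu, ← hU.map_mul _ _ hpn bpn hun bun, ← hU.map_mul _ _ hun bun hpn bpn]
    refine lim_eq S hU (fun n => mul_mem (hpn n) (hun n)) (bpn.mul bun)
      (fun n => mul_mem (hun n) (hpn n)) (bun.mul bpn) ?_
    have t2 : Tendsto (fun n : ℕ => 2 * (1 / ((n:ℝ) + 1))) (ω : Filter ℕ) (nhds 0) := by
      simpa using tω.const_mul 2
    refine squeeze_zero (fun _ => norm_nonneg _) (fun n => ?_) t2
    have haM : a n ∈ M := hA _ (ha n)
    have hdM : pn n - a n ∈ M := sub_mem (hpn n) haM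
    have e : vec (pn n * un n) - vec (un n * pn n) =
        R (un n) (vec (pn n - a n)) - L (un n) (vec (pn n - a n)) := by
      rw [S.Rvec _ (hun n) _ hdM, S.Lvec _ (hun n) _ hdM, ← map_sub, ← map_sub, sub_mul, mul_sub,
        hcomm n (a n) (hmono (le_max_right _ _) (ha n))]
      congr 1; abel
    rw [e, two_mul]
    refine (norm_sub_le _ _).trans (add_le_add ?_ ?_)
    · refine ((R (un n)).le_opNorm _).trans ?_
      calc _ ≤ 1 * ‖vec (pn n - a n)‖ := by gcongr; exact (S.Rnorm _ (hun n)).trans (un1 n)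
        _ ≤ _ := by rw [one_mul, map_sub]; exact (hpa n).le
    · refine ((L (un n)).le_opNorm _).trans ?_
      calc _ ≤ 1 * ‖vec (pn n - a n)‖ := by gcongr; exact (S.Lnorm _ (hun n)).trans (un1 n)
        _ ≤ _ := by rw [one_mul, map_sub]; exact (hpa n).le
  have hx : p * u * p ∈ corner p (relComm (M : Set (Op H)) (Mω : Set (Op H))) := by
    refine ⟨⟨mul_mem (mul_mem hp.1 huM) hp.1, fun y hy => ?_⟩, ?_⟩
    · have e1 := hp.2 y hy
      have e2 := huc y hy
      rw [← mul_assoc, ← mul_assoc, e1, mul_assoc p y u, e2, ← mul_assoc, mul_assoc _ y p, e1]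
      simp only [mul_assoc]
    · have := hpp.2.eq
      calc p * (p * u * p) * p = (p * p) * u * (p * p) := by simp only [mul_assoc]
        _ = _ := by rw [this]
  have hvu : θ (p * u * p) * v = v * u := by
    rw [hint _ hx, hup, mul_assoc u, hpp.2.eq, ← hup, ← mul_assoc, hvp]
  obtain ⟨y, hy, bY, ly⟩ := (hθ.1 _ hx).1
  have hyM : SeqIn (M : Set (Op H)) y := fun n => hNM (hy n)
  have hyv : SeqIn (M : Set (Op H)) (fun n => y n * vn n) := fun n => mul_mem (hyM n) (hvn n)
  have svn : SeqIn (M : Set (Op H)) (fun n => star (vn n)) := fun n => star_mem (S := VonNeumannAlgebra H) (hvn n)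
  have hvun : SeqIn (M : Set (Op H)) (fun n => vn n * un n) := fun n => mul_mem (hvn n) (hun n)
  have e1 : limω (fun n => y n * vn n * star (vn n)) = limω (fun n => vn n * un n * star (vn n)) := by
    rw [hU.map_mul _ _ hyv (bY.mul bvn) svn bvn.star, hU.map_mul _ _ hvun (bvn.mul bun) svn bvn.star,
      hU.map_mul _ _ hyM bY hvn bvn, hU.map_mul _ _ hvn bvn hun bun, ly, lvn, hvu]
  have e2 := vec_tendsto S hU (fun n => mul_mem (hyv n) (svn n)) ((bY.mul bvn).mul bvn.star)
    (fun n => mul_mem (hvun n) (svn n)) ((bvn.mul bun).mul bvn.star) e1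
  obtain ⟨C, hC⟩ := bY
  have C0 : 0 ≤ C := (norm_nonneg _).trans (hC 0)
  have e3 : Tendsto (fun n => ‖vec (y n * vn n)‖ ^ 2) (ω : Filter ℕ) (nhds 0) := by
    have t3 : Tendsto (fun n => C * (‖vec (y n * vn n * star (vn n)) -
        vec (vn n * un n * star (vn n))‖ + 1 / ((n:ℝ) + 1))) (ω : Filter ℕ) (nhds 0) := by
      simpa using (e2.add tω).const_mul C
    refine squeeze_zero (fun _ => sq_nonneg _) (fun n => ?_) t3
    have hz : y n * vn n * star (vn n) ∈ M := mul_mem (hyv n) (svn n)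
    have f1 : ‖vec (y n * vn n)‖ ^ 2 = ‖inner ℂ (vec (y n)) (vec (y n * vn n * star (vn n)))‖ := by
      rw [← norm_tau S (hyv n), S.inner _ (hyM n) _ hz, star_mul, mul_assoc,
        S.tr.tracial _ (svn n) _ (mul_mem (star_mem (S := VonNeumannAlgebra H) (hyM n)) (hyv n))]
      simp only [mul_assoc]
    rw [f1, ← pr_eq' (U := l2 vec N) (vec_mem_l2 (hy n)), pr_inner]
    refine (norm_inner_le_norm _ _).trans ?_
    refine mul_le_mul ((S.norm_vec_le (hyM n)).trans (hC n)) ?_ (norm_nonneg _) C0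
    have f2 : vec (y n * vn n * star (vn n)) = (vec (y n * vn n * star (vn n)) -
        vec (vn n * un n * star (vn n))) + vec (vn n * un n * star (vn n)) := by abel
    conv_lhs => rw [f2, map_add]
    refine (norm_add_le _ _).trans (add_le_add (pr_norm _ _) (hsmall n).le)
  have e4 : limω (fun n => y n * vn n) = 0 := by
    rw [hU.eq_zero _ hyv (Bdd.mul ⟨C, hC⟩ bvn)]
    refine e3.congr fun n => (norm_tau S (hyv n)).symm
  rw [hU.map_mul _ _ hyM ⟨C, hC⟩ hvn bvn, ly, lvn, hvu] at e4
  apply hv0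
  calc v = v * u * star u := by rw [mul_assoc, huu, mul_one]
    _ = 0 := by rw [e4, zero_mul]

end stepA

section stepB
variable {H : Type u} [NormedAddCommGroup H] [InnerProductSpace ℂ H] [CompleteSpace H]
variable {M N Mω : VonNeumannAlgebra H} {τ : Op H →ₗ[ℂ] ℂ} {K : Type u} [NormedAddCommGroup K]
    [InnerProductSpace ℂ K] [CompleteSpace K] {vec : Op H →ₗ[ℂ] K} {L R : Op H → (K →L[ℂ] K)}
variable {ω : Ultrafilter ℕ} {limω : (ℕ → Op H) → Op H}

/-- quadratic form -/
noncomputable def qf (ξ : K) : (K →L[ℂ] K) →ₗ[ℝ] ℝ where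
  toFun Z := (inner ℂ ξ (Z ξ)).re
  map_add' x y := by simp [inner_add_right]
  map_smul' c x := by simp [inner_smul_right]

theorem qf_cont (ξ : K) : Continuous (qf ξ : (K →L[ℂ] K) → ℝ) := by
  change Continuous fun Z : K →L[ℂ] K => (inner ℂ ξ (Z ξ)).re
  fun_prop

theorem nonneg_of_qf {Z : K →L[ℂ] K} (hZ : IsSelfAdjoint Z) (h : ∀ ξ, 0 ≤ qf ξ Z) : 0 ≤ Z := by
  rw [nonneg_iff_inner]
  intro ξ
  rw [Complex.le_def]
  refine ⟨h ξ, ?_⟩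
  have : inner ℂ ξ (Z ξ) = (starRingEnd ℂ) (inner ℂ ξ (Z ξ)) := by
    rw [inner_conj_symm]
    have h2 := ContinuousLinearMap.adjoint_inner_left Z ξ ξ
    rw [← ContinuousLinearMap.star_eq_adjoint, hZ.star_eq] at h2
    exact h2.symm
  exact (Complex.conj_eq_iff_im.1 this.symm).symm

theorem eN_comm (S : IsStd M τ vec L R) (hNM : (N : Set (Op H)) ⊆ (M : Set (Op H))) {y : Op H}
    (hy : y ∈ N) (ξ : K) : pr (l2 vec N) (R y ξ) = R y (pr (l2 vec N) ξ) := by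
  have h : ∀ y ∈ N, ∀ x ∈ l2 vec N, R y x ∈ (l2 vec N).topologicalClosure := by
    rintro y hy _ ⟨z, hz, rfl⟩
    refine (l2 vec N).le_topologicalClosure ?_
    rw [S.Rvec y (hNM hy) z (hNM hz)]
    exact vec_mem_l2 (mul_mem hz hy)
  refine pr_comm (h y hy) ?_ ξ
  rw [S.R_adj (hNM hy)]
  exact h _ (star_mem hy)

theorem eN_commL (S : IsStd M τ vec L R) (hNM : (N : Set (Op H)) ⊆ (M : Set (Op H))) {y : Op H}
    (hy : y ∈ N) (ξ : K) : pr (l2 vec N) (L y ξ) = L y (pr (l2 vec N) ξ) := by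
  have h : ∀ y ∈ N, ∀ x ∈ l2 vec N, L y x ∈ (l2 vec N).topologicalClosure := by
    rintro y hy _ ⟨z, hz, rfl⟩
    refine (l2 vec N).le_topologicalClosure ?_
    rw [S.Lvec y (hNM hy) z (hNM hz)]
    exact vec_mem_l2 (mul_mem hy hz)
  refine pr_comm (h y hy) ?_ ξ
  rw [S.L_adj (hNM hy)]
  exact h _ (star_mem hy)

theorem WLim.qf {T : ℕ → K →L[ℂ] K} {T'} (h : WLim ω T T') (ξ : K) :
    Tendsto (fun n => PopaQ.qf ξ (T n)) (ω : Filter ℕ) (nhds (PopaQ.qf ξ T')) :=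
  (Complex.continuous_re.tendsto _).comp (h ξ ξ)

theorem stepB (S : IsStd M τ vec L R) (hNM : (N : Set (Op H)) ⊆ (M : Set (Op H)))
    {A : ℕ → StarSubalgebra ℂ (Op H)} (hmono : Monotone A) (hA : ∀ n, (A n : Set (Op H)) ⊆ M)
    (hfd : ∀ n, FinDim (A n : Set (Op H))) (hω : IsFreeUltrafilter ω)
    (m : ℕ) {w : Op H} (hw : w ∈ M) {δ : ℝ} (hδ : 0 < δ)
    (h : ∀ u ∈ M, star u * u = 1 → u * star u = 1 → (∀ a ∈ A m, a * u = u * a) →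
      δ ≤ ‖pr (l2 vec N) (vec (w * u * star w))‖) :
    ∃ T : K →L[ℂ] K, 0 ≤ T ∧ (∀ k, ∀ c ∈ A k, (∀ a ∈ A m, a * c = c * a) →
        ∀ ξ, T (L c ξ) = L c (T ξ)) ∧ (∀ y ∈ N, ∀ ξ, T (R y ξ) = R y (T ξ)) ∧
      δ ^ 2 ≤ qf (vec (star w)) T ∧
      (∀ (n : ℕ) (ξ : Fin n → K),
        (∀ x ∈ M, ∑ i, ‖pr (l2 vec N) (L x (ξ i))‖ ^ 2 ≤ ‖vec x‖ ^ 2) →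
        ∑ i, qf (ξ i) T ≤ ‖vec w‖ ^ 2) := by
  let C : ℕ → StarSubalgebra ℂ (Op H) := fun k => A k ⊓ StarSubalgebra.centralizer ℂ (A m : Set (Op H))
  have hCM : ∀ k, ∀ c ∈ C k, c ∈ M := fun k c hc => hA k hc.1
  have hCc : ∀ k, ∀ c ∈ C k, ∀ a ∈ A m, a * c = c * a := fun k c hc a ha =>
    ((StarSubalgebra.mem_centralizer_iff ℂ).1 hc.2 a ha).1
  have hCfd : ∀ k, FinDim (C k : Set (Op H)) := fun k => by
    obtain ⟨s, hs⟩ := hfd k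
    exact ⟨s, fun x hx => hs hx.1⟩
  have hCmem : ∀ k, ∀ c ∈ A k, (∀ a ∈ A m, a * c = c * a) → c ∈ C k := fun k c hc h =>
    ⟨hc, (StarSubalgebra.mem_centralizer_iff ℂ).2 fun g hg => ⟨h g hg, h _ (star_mem hg)⟩⟩
  let ρ : ∀ k, C k →ₗ[ℂ] (K →L[ℂ] K) := fun k =>
    { toFun := fun c => L c
      map_add' := fun x y => by
        ext ξ; exact S.L_add (hCM k _ x.2) (hCM k _ y.2) ξ
      map_smul' := fun c x => by
        ext ξ; exact S.L_smul (hCM k _ x.2) c ξ }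
  let X : K →L[ℂ] K := L (star w) * pr (l2 vec N) * L w
  have sw := star_mem hw
  have ex : ∀ k, _ := fun k => exists_avg (hCfd k) (ρ k) (fun x y => by
    ext ξ; exact (S.L_mul (hCM k _ x.2) (hCM k _ y.2) ξ).symm) (by
    ext ξ; exact S.L_one ξ) X
  choose T hT1 hT2 hT3 using ex
  have hu : ∀ k, ∀ u : C k, u ∈ unitary (C k) → star (u : Op H) * u = 1 ∧ (u : Op H) * star (u : Op H) = 1 :=
    fun k u hu => ⟨congrArg Subtype.val (Unitary.mem_iff.1 hu).1, congrArg Subtype.val (Unitary.mem_iff.1 hu).2⟩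
  have huM : ∀ k, ∀ u : C k, star (u : Op H) ∈ M := fun k u => star_mem (hCM k _ u.2)
  have hqf : ∀ k, ∀ u : C k, ∀ ξ, qf ξ (ρ k u * X * ρ k (star u)) =
      ‖pr (l2 vec N) (L (w * star (u : Op H)) ξ)‖ ^ 2 := fun k u ξ => by
    change (inner ℂ ξ (L u (L (star w) (pr (l2 vec N) (L w (L (star (u : Op H)) ξ)))))).re = _
    rw [← S.L_inner (hCM k _ u.2), ← S.L_inner sw, star_star, S.L_mul hw (huM k u),
      pr_inner_self]
    exact Complex.ofReal_re _
  have nT : ∀ k, ‖T k‖ ≤ ‖X‖ := fun k => by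
    have := hT2 k (Metric.closedBall 0 ‖X‖) (convex_closedBall _ _) Metric.isClosed_closedBall ?_
    · simpa using this
    intro u huu
    rw [mem_closedBall_zero_iff]
    have f1 : ‖ρ k u‖ ≤ 1 := (S.Lnorm _ (hCM k _ u.2)).trans (unitary_norm_le (hu k u huu).1)
    have f2 : ‖ρ k (star u)‖ ≤ 1 := (S.Lnorm _ (huM k u)).trans
      (by rw [norm_star]; exact unitary_norm_le (hu k u huu).1)
    calc _ ≤ ‖ρ k u‖ * ‖X‖ * ‖ρ k (star u)‖ :=
          (norm_mul_le _ _).trans (by gcongr; exact norm_mul_le _ _)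
      _ ≤ 1 * ‖X‖ * 1 := by gcongr
      _ = _ := by ring
  obtain ⟨T', -, hT'⟩ := wot_lim ω T ‖X‖ nT
  have Tpos : ∀ k, 0 ≤ T k := fun k => by
    have hcv : Convex ℝ {Z : K →L[ℂ] K | 0 ≤ Z} := by
      intro x hx y hy a b ha hb _
      have hx' : 0 ≤ x := hx
      have hy' : 0 ≤ y := hy
      exact Set.mem_setOf_eq ▸ add_nonneg (smul_nonneg ha hx') (smul_nonneg hb hy')
    refine hT2 k {Z | 0 ≤ Z} hcv CStarAlgebra.isClosed_nonneg fun u huu => ?_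
    rw [Set.mem_setOf_eq]
    refine nonneg_of_qf ?_ fun ξ => by rw [hqf]; positivity
    have e1 : star (ρ k u) = ρ k (star u) := S.L_adj (hCM k _ u.2)
    have e2 : IsSelfAdjoint X := by
      rw [isSelfAdjoint_iff]
      simp only [X, star_mul]
      rw [ContinuousLinearMap.star_eq_adjoint, ContinuousLinearMap.star_eq_adjoint,
        ContinuousLinearMap.star_eq_adjoint, S.L_adj sw, S.L_adj hw, pr_adj, star_star, mul_assoc]
    rw [← e1]
    exact e2.conjugate _
  refine ⟨T', hT'.nonneg (Eventually.of_forall Tpos), ?_, ?_, ?_, ?_⟩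
  · intro k c hc hcm ξ
    have e : T' ∘L L c = L c ∘L T' := (hT'.comp_right (L c)).unique
      ((hT'.comp_left (L c)).congr ((hω.ge k).mono fun n hn =>
        hT1 n ⟨c, hCmem n c (hmono hn hc) hcm⟩))
    exact congrArg (fun Z : K →L[ℂ] K => Z ξ) e
  · intro y hy ξ
    have e : T' ∘L R y = R y ∘L T' := by
      refine (hT'.comp_right (R y)).unique ((hT'.comp_left (R y)).congr (Eventually.of_forall fun n => ?_))
      refine hT2 n {Z | R y ∘L Z = Z ∘L R y} ?_ (isClosed_eq (by fun_prop) (by fun_prop)) ?_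
      · intro x hx y hy a b _ _ _
        simp only [Set.mem_setOf_eq] at hx hy ⊢
        ext ξ
        have hx' := congrArg (fun Z : K →L[ℂ] K => Z ξ) hx
        have hy' := congrArg (fun Z : K →L[ℂ] K => Z ξ) hy
        simp only [ContinuousLinearMap.comp_apply] at hx' hy'
        simp [hx', hy']
      · intro u huu
        ext ξ
        change R y (L u (L (star w) (pr (l2 vec N) (L w (L (star (u : Op H)) ξ))))) =
          (L u (L (star w) (pr (l2 vec N) (L w (L (star (u : Op H)) (R y ξ))))))
        rw [S.L_R (huM n u) (hNM hy), S.L_R hw (hNM hy), eN_comm S hNM hy, S.L_R sw (hNM hy),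
          S.L_R (hCM n _ u.2) (hNM hy)]
    exact congrArg (fun Z : K →L[ℂ] K => Z ξ) e
  · refine ge_of_tendsto (hT'.qf _) (Eventually.of_forall fun k => ?_)
    refine hT2 k {Z | δ ^ 2 ≤ qf (vec (star w)) Z} (convex_halfSpace_ge (qf _).isLinear _)
      (isClosed_le continuous_const (qf_cont _)) fun u huu => ?_
    change δ ^ 2 ≤ qf _ _
    rw [hqf, S.Lvec _ (mul_mem hw (huM k u)) _ sw]
    gcongr
    refine h _ (huM k u) (by rw [star_star]; exact (hu k u huu).2)
      (by rw [star_star]; exact (hu k u huu).1) fun a ha => ?_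
    exact hCc k (star (u : Op H)) (star_mem u.2) a ha
  · intro n ξ hξ
    refine le_of_tendsto (tendsto_finsetSum _ fun i _ => hT'.qf (ξ i)) (Eventually.of_forall fun k => ?_)
    have hl : IsLinearMap ℝ (fun Z : K →L[ℂ] K => ∑ i, qf (ξ i) Z) := by
      have := (∑ i, qf (ξ i)).isLinear
      convert this using 2
      simp
    refine hT2 k {Z | ∑ i, qf (ξ i) Z ≤ ‖vec w‖ ^ 2} (convex_halfSpace_le hl _)
      (isClosed_le (continuous_finset_sum _ fun i _ => qf_cont _) continuous_const) fun u huu => ?_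
    change ∑ i, qf (ξ i) _ ≤ _
    simp only [hqf]
    refine (hξ _ (mul_mem hw (huM k u))).trans ?_
    rw [← S.Rvec _ (huM k u) _ hw]
    gcongr
    refine ((R _).le_opNorm _).trans ?_
    have : ‖R (star (u : Op H))‖ ≤ 1 := (S.Rnorm _ (huM k u)).trans
      (by rw [norm_star]; exact unitary_norm_le (hu k u huu).1)
    nlinarith [norm_nonneg (vec w)]

end stepB

section minproj
variable {H : Type u} [NormedAddCommGroup H] [InnerProductSpace ℂ H] [CompleteSpace H]

theorem finite_spec {D : StarSubalgebra ℂ (Op H)} (hD : FinDim (D : Set (Op H))) {h : Op H}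
    (hh : h ∈ D) : (spectrum ℝ h).Finite := by
  haveI := hD.fd
  rcases subsingleton_or_nontrivial (Op H) with hs | hs
  · rw [spectrum.of_subsingleton]; exact Set.finite_empty
  have h1 : IsIntegral ℂ (⟨h, hh⟩ : D) := Algebra.IsIntegral.isIntegral _
  obtain ⟨p, hp, hp2⟩ := h1.isAlgebraic
  have h3 : Polynomial.aeval h p = 0 := by
    have := congrArg D.subtype hp2
    rw [map_zero] at this
    rw [← this]
    exact (Polynomial.aeval_algHom_apply (D.subtype : D →ₐ[ℂ] Op H) ⟨h, hh⟩ p)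
  have h4 := spectrum.subset_polynomial_aeval h p
  rw [h3, spectrum.zero_eq] at h4
  have h5 : (spectrum ℂ h).Finite := by
    refine (p.roots.toFinset.finite_toSet).subset fun x hx => ?_
    have : p.eval x = 0 := h4 ⟨x, hx, rfl⟩
    simp [hp, this]
  rw [← spectrum.preimage_algebraMap ℂ]
  exact h5.preimage (Complex.ofReal_injective.injOn)

theorem cfc_mem_fd {D : StarSubalgebra ℂ (Op H)} (hD : FinDim (D : Set (Op H))) {h : Op H}
    (hh : h ∈ D) (f : ℝ → ℝ) : cfc f h ∈ D := by
  haveI := hD.closed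
  exact cfc_mem (𝕜' := ℂ) f hh

/-- compressed subspace -/
def cmp (D : StarSubalgebra ℂ (Op H)) (e : Op H) : Submodule ℂ (Op H) where
  carrier := {x | x ∈ D ∧ e * x = x ∧ x * e = x}
  zero_mem' := ⟨zero_mem _, by simp, by simp⟩
  add_mem' := fun {x y} ⟨a, b, c⟩ ⟨a', b', c'⟩ => ⟨add_mem a a', by rw [mul_add, b, b'], by rw [add_mul, c, c']⟩
  smul_mem' := fun k x ⟨a, b, c⟩ => ⟨D.smul_mem a k, by rw [mul_smul_comm, b], by rw [smul_mul_assoc, c]⟩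

theorem min_proj {D : StarSubalgebra ℂ (Op H)} (hD : FinDim (D : Set (Op H)))
    (Z : Submodule ℂ (Op H)) (h1 : 1 ∉ Z) : ∃ e ∈ D, IsProjection e ∧ e ∉ Z ∧
      ∀ d ∈ D, ∃ c : ℂ, e * d * e = c • e := by
  classical
  have hfd : ∀ e, FiniteDimensional ℂ (cmp D e) := fun e => by
    haveI : FiniteDimensional ℂ (Subalgebra.toSubmodule D.toSubalgebra) := hD.fd
    exact Submodule.finiteDimensional_of_le (S₂ := Subalgebra.toSubmodule D.toSubalgebra) fun x hx => hx.1
  have ex : ∃ n, ∃ e ∈ D, IsProjection e ∧ e ∉ Z ∧ Module.finrank ℂ (cmp D e) = n :=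
    ⟨_, 1, one_mem _, ⟨IsSelfAdjoint.one _, IsIdempotentElem.one⟩, h1, rfl⟩
  obtain ⟨e, heD, hep, heZ, hn⟩ := Nat.find_spec ex
  have hmin : ∀ e' ∈ D, IsProjection e' → e' ∉ Z →
      Module.finrank ℂ (cmp D e) ≤ Module.finrank ℂ (cmp D e') := fun e' h1 h2 h3 => by
    rw [hn]; exact Nat.find_min' ex ⟨e', h1, h2, h3, rfl⟩
  have key : ∀ h ∈ cmp D e, IsSelfAdjoint h → ∃ c : ℂ, h = c • e := by
    rintro h ⟨hD', h2, h3⟩ hsa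
    have fin := finite_spec hD hD'
    have cont : ∀ f : ℝ → ℝ, ContinuousOn f (spectrum ℝ h) := fun f => fin.continuousOn f
    let f : ℝ → ℝ → ℝ := fun l t => if t = l then 1 else 0
    have hsum : ∑ l ∈ fin.toFinset, cfc (f l) h = 1 := by
      rw [← cfc_sum f h _ fun i _ => cont _, ← cfc_const_one ℝ h]
      refine cfc_congr fun t ht => ?_
      simp [f, ht]
    have : ∃ l ∈ fin.toFinset, e * cfc (f l) h ∉ Z := by
      by_contra hc
      push Not at hc
      apply heZ
      rw [← mul_one e, ← hsum, Finset.mul_sum]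
      exact Submodule.sum_mem _ hc
    obtain ⟨l, -, hl⟩ := this
    set g := cfc (f l) h with hg
    have gD : g ∈ D := cfc_mem_fd hD hD' _
    have gsa : IsSelfAdjoint g := cfc_predicate _ _
    have gi : g * g = g := by
      rw [hg, ← cfc_mul _ _ _ (cont _) (cont _)]
      refine cfc_congr fun t ht => ?_
      by_cases h : t = l <;> simp [f, h]
    have hgl : h * g = (l : ℂ) • g := by
      have e1 : h * g = cfc (fun t => t * f l t) h := by
        rw [cfc_mul _ _ _ (cont _) (cont _), cfc_id' ℝ h]
      rw [e1, Complex.coe_smul, ← cfc_smul _ _ _ (cont _)]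
      refine cfc_congr fun t ht => ?_
      by_cases h : t = l <;> simp [f, h]
    have ge : g * e = e * g := by
      have : Commute h e := h3.trans h2.symm
      exact (this.cfc_real _).eq
    have hp' : IsProjection (e * g) := by
      refine ⟨?_, ?_⟩
      · rw [isSelfAdjoint_iff, star_mul, gsa.star_eq, hep.1.star_eq, ge]
      · change e * g * (e * g) = e * g
        rw [mul_assoc, ← mul_assoc g, ge, mul_assoc, gi, ← mul_assoc, hep.2.eq]
    have hle : cmp D (e * g) ≤ cmp D e := by
      rintro x ⟨a, b, c⟩
      refine ⟨a, ?_, ?_⟩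
      · rw [← b]; simp only [← mul_assoc, hep.2.eq]
      · rw [← c, ← ge]; simp only [mul_assoc, hep.2.eq]
    have heq := Submodule.eq_of_le_of_finrank_le hle (hmin _ (mul_mem heD gD) hp' hl)
    have he : e ∈ cmp D (e * g) := by rw [heq]; exact ⟨heD, hep.2.eq, hep.2.eq⟩
    have he2 : e * g = e := by
      have := he.2.1
      rw [mul_assoc, ge, ← mul_assoc, hep.2.eq] at this
      exact this
    refine ⟨l, ?_⟩
    calc h = h * (e * g) := by rw [he2, h3]
      _ = e * (h * g) := by rw [← mul_assoc, ← mul_assoc, h2, h3]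
      _ = _ := by rw [hgl, mul_smul_comm, he2]
  refine ⟨e, heD, hep, heZ, fun d hd => ?_⟩
  have kk : ∀ x ∈ D, e * x * e ∈ cmp D e := fun x hx => ⟨mul_mem (mul_mem heD hx) heD,
    by simp only [← mul_assoc, hep.2.eq], by simp only [mul_assoc, hep.2.eq]⟩
  have sae : star e = e := hep.1.star_eq
  obtain ⟨c1, h1⟩ := key (e * (d + star d) * e) (kk _ (add_mem hd (star_mem hd))) (by
    rw [isSelfAdjoint_iff]; simp only [star_mul, star_add, star_star, sae, mul_assoc, add_comm])
  obtain ⟨c2, h2⟩ := key (e * (Complex.I • (d - star d)) * e)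
    (kk _ (D.smul_mem (sub_mem hd (star_mem hd)) _)) (by
    rw [isSelfAdjoint_iff]
    simp only [star_mul, star_smul, star_sub, star_star, sae, mul_assoc, RCLike.star_def, Complex.conj_I]
    rw [neg_smul, ← smul_neg, neg_sub])
  refine ⟨(c1 - Complex.I * c2) / 2, ?_⟩
  have : e * d * e = (2⁻¹ : ℂ) • (e * (d + star d) * e - Complex.I • (e * (Complex.I • (d - star d)) * e)) := by
    rw [mul_smul_comm, smul_mul_assoc, smul_smul, Complex.I_mul_I]
    simp only [mul_add, add_mul, mul_sub, sub_mul]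
    module
  rw [this, h1, h2]
  module

end minproj

section stepC
variable {H : Type u} [NormedAddCommGroup H] [InnerProductSpace ℂ H] [CompleteSpace H]
variable {M N Mω : VonNeumannAlgebra H} {τ : Op H →ₗ[ℂ] ℂ} {K : Type u} [NormedAddCommGroup K]
    [InnerProductSpace ℂ K] [CompleteSpace K] {vec : Op H →ₗ[ℂ] K} {L R : Op H → (K →L[ℂ] K)}
variable {ω : Ultrafilter ℕ} {limω : (ℕ → Op H) → Op H}

theorem avg_corner {D B : StarSubalgebra ℂ (Op H)} (hD : FinDim (D : Set (Op H)))
    (hB : FinDim (B : Set (Op H))) (hDB : D ≤ B) {e : Op H} (heD : e ∈ D) (hep : IsProjection e)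
    (hmin : ∀ d ∈ D, ∃ c : ℂ, e * d * e = c • e) {x : Op H} (hx : x ∈ B) (hex : e * x = x) (hxe : x * e = x) :
    ∃ y ∈ B, ∃ c : ℝ, 0 < c ∧ (∀ a ∈ D, a * y = y * a) ∧ e * y = (c : ℂ) • x := by
  by_cases x0 : x = 0
  · exact ⟨0, zero_mem _, 1, one_pos, by simp, by simp [x0]⟩
  obtain ⟨h', hh'⟩ : ∃ h', x h' ≠ 0 := by
    by_contra hc
    push Not at hc
    exact x0 (ContinuousLinearMap.ext hc)
  obtain ⟨y, hy1, hy2, hy3⟩ := exists_avg (B := Op H) hD (Subalgebra.toSubmodule D.toSubalgebra).subtype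
    (fun _ _ => rfl) rfl x
  have sae : star e = e := hep.1.star_eq
  have hu : ∀ u : D, ∃ c : ℝ, 0 ≤ c ∧ e * ((u : Op H) * x * star (u : Op H)) * e = (c : ℂ) • x := by
    intro u
    obtain ⟨c, hc⟩ := hmin u u.2
    have hc2 : e * star (u : Op H) * e = (starRingEnd ℂ c) • e := by
      have := congrArg star hc
      simpa [star_mul, sae, mul_assoc] using this
    refine ⟨Complex.normSq c, Complex.normSq_nonneg c, ?_⟩
    calc e * ((u : Op H) * x * star (u : Op H)) * e = e * ((u : Op H) * (e * x * e) * star (u : Op H)) * e := by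
          rw [hex, hxe]
      _ = (e * u * e) * x * (e * star (u : Op H) * e) := by simp only [mul_assoc]
      _ = _ := by
          rw [hc, hc2, smul_mul_assoc, smul_mul_assoc, hex, mul_smul_comm, hxe, smul_smul,
            Complex.normSq_eq_conj_mul_self, mul_comm]
  have hyD : ∀ a ∈ D, a * y = y * a := fun a ha => hy1 ⟨a, ha⟩
  have hyB : y ∈ B := by
    refine hy2 (B : Set (Op H)) ?_ hB.closed ?_
    · intro a ha b hb s t _ _ _
      exact add_mem (by rw [← Complex.coe_smul]; exact B.smul_mem ha _) (by rw [← Complex.coe_smul]; exact B.smul_mem hb _)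
    · intro u _
      exact mul_mem (mul_mem (hDB u.2) hx) (hDB (star u).2)
  have hyc : e * y * e ∈ Submodule.span ℝ {x} := by
    refine hy2 {z | e * z * e ∈ Submodule.span ℝ {x}} ?_ ?_ ?_
    · intro a ha b hb s t _ _ _
      simp only [Set.mem_setOf_eq] at ha hb ⊢
      rw [mul_add, add_mul, mul_smul_comm, smul_mul_assoc, mul_smul_comm, smul_mul_assoc]
      exact add_mem (Submodule.smul_mem _ _ ha) (Submodule.smul_mem _ _ hb)
    · exact (Submodule.closed_of_finiteDimensional (Submodule.span ℝ {x})).preimage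
        (f := fun z : Op H => e * z * e) (by fun_prop)
    · intro u _
      obtain ⟨c, -, hc⟩ := hu u
      rw [Set.mem_setOf_eq, Submodule.mem_span_singleton]
      exact ⟨c, by rw [← Complex.coe_smul]; exact hc.symm⟩
  obtain ⟨c, hc⟩ := Submodule.mem_span_singleton.1 hyc
  have hey : e * y * e = e * y := by rw [mul_assoc, ← hyD e heD, ← mul_assoc, hep.2.eq]
  refine ⟨y, hyB, c, ?_, hyD, by rw [← hey, ← hc, Complex.coe_smul]⟩
  let f : Op H →L[ℂ] ℂ := LinearMap.mkContinuous
    { toFun := fun z => inner ℂ (x h') ((e * z * e) h')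
      map_add' := fun a b => by simp [mul_add, add_mul, inner_add_right]
      map_smul' := fun a b => by simp [inner_smul_right] } (‖x h'‖ * (‖e‖ * ‖e‖ * ‖h'‖)) (fun z => by
        refine (norm_inner_le_norm _ _).trans ?_
        rw [mul_assoc (‖x h'‖)]
        refine mul_le_mul_of_nonneg_left (b := ‖(e * z * e) h'‖) ?_ (norm_nonneg (x h'))
        calc _ ≤ ‖e * z * e‖ * ‖h'‖ := ContinuousLinearMap.le_opNorm _ _
          _ ≤ (‖e‖ * ‖z‖ * ‖e‖) * ‖h'‖ := by
            gcongr
            exact (norm_mul_le _ _).trans (by gcongr; exact norm_mul_le _ _)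
          _ = _ := by ring)
  have hf : ∀ z, ∀ c : ℝ, e * z * e = (c : ℂ) • x → (f z).re = c * ‖x h'‖ ^ 2 := fun z c hz => by
    change (inner ℂ (x h') ((e * z * e) h')).re = _
    rw [hz, _root_.smul_apply, inner_smul_right, inner_self_eq_norm_sq_to_K, Complex.re_ofReal_mul]
    norm_cast
  have npos : 0 < ‖x h'‖ ^ 2 := by positivity
  have := hy3 f (fun u _ => by
    obtain ⟨c, h0, hc⟩ := hu u
    have := hf _ c hc
    refine le_of_le_of_eq ?_ this.symm
    positivity) (by rw [hf x 1 (by rw [hex, hxe]; simp)]; linarith)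
  rw [hf y c (by rw [← hc, Complex.coe_smul])] at this
  exact pos_of_mul_pos_left this npos.le

theorem stepC (S : IsStd M τ vec L R) (hω : IsFreeUltrafilter ω) (hn : Nrml ω M τ)
    (hf : relComm (M : Set (Op H)) M = scalars H)
    (hNM : (N : Set (Op H)) ⊆ (M : Set (Op H)))
    {A : ℕ → StarSubalgebra ℂ (Op H)} (hmono : Monotone A) (hA : ∀ n, (A n : Set (Op H)) ⊆ M)
    (hc : Set.centralizer (Set.centralizer (⋃ n, (A n : Set (Op H)))) = (M : Set (Op H)))
    (hfd : ∀ n, FinDim (A n : Set (Op H))) (m : ℕ) {T : K →L[ℂ] K} (hT : 0 ≤ T) (hT0 : T ≠ 0)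
    (hTL : ∀ k, ∀ c ∈ A k, (∀ a ∈ A m, a * c = c * a) → ∀ ξ, T (L c ξ) = L c (T ξ))
    (hTR : ∀ y ∈ N, ∀ ξ, T (R y ξ) = R y (T ξ)) :
    ∃ e ∈ M, IsProjection e ∧ ∃ S0 : K →L[ℂ] K, 0 ≤ S0 ∧ S0 ≠ 0 ∧ (∀ ξ, S0 ξ = L e (T (L e ξ))) ∧
      (∀ x ∈ M, e * x = x → x * e = x → ∀ ξ, S0 (L x ξ) = L x (S0 ξ)) ∧
      (∀ y ∈ N, ∀ ξ, S0 (R y ξ) = R y (S0 ξ)) := by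
  let Z : Submodule ℂ (Op H) :=
    { carrier := {d | d ∈ A m ∧ ∀ ξ, T (L d ξ) = 0}
      zero_mem' := ⟨zero_mem _, fun ξ => by
        have := S.L_smul (zero_mem M) 0 ξ
        rw [zero_smul, zero_smul] at this
        rw [this, map_zero]⟩
      add_mem' := fun {a b} ha hb => ⟨add_mem ha.1 hb.1, fun ξ => by
        rw [S.L_add (hA m ha.1) (hA m hb.1), map_add, ha.2, hb.2, add_zero]⟩
      smul_mem' := fun c a ha => ⟨(A m).smul_mem ha.1 c, fun ξ => by
        rw [S.L_smul (hA m ha.1), map_smul, ha.2, smul_zero]⟩ }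
  obtain ⟨e, heD, hep, heZ, hmin⟩ := min_proj (hfd m) Z (by
    rintro ⟨-, h⟩
    apply hT0
    ext ξ
    simpa [S.L_one] using h ξ)
  have heM : e ∈ M := hA m heD
  have sae : star e = e := hep.1.star_eq
  have see : star (L e) = L e := by
    rw [ContinuousLinearMap.star_eq_adjoint, S.L_adj heM, sae]
  have Lee : ∀ ξ, L e (L e ξ) = L e ξ := fun ξ => by rw [S.L_mul heM heM, hep.2.eq]
  have S0pos : 0 ≤ L e * T * L e := by
    have := star_left_conjugate_nonneg hT (L e)
    rwa [see] at this
  refine ⟨e, heM, hep, L e * T * L e, S0pos, ?_, fun ξ => rfl, ?_, ?_⟩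
  · intro h0
    apply heZ
    refine ⟨heD, fun ξ => ?_⟩
    have hs : CFC.sqrt T * CFC.sqrt T = T := CFC.sqrt_mul_sqrt_self T hT
    have ss : star (CFC.sqrt T) = CFC.sqrt T := (CFC.sqrt_nonneg T).isSelfAdjoint.star_eq
    have h1 : star (CFC.sqrt T * L e) * (CFC.sqrt T * L e) = 0 := by
      rw [star_mul, ss, see, mul_assoc, ← mul_assoc (CFC.sqrt T), hs, ← mul_assoc, h0]
    have h2 := CStarRing.star_mul_self_eq_zero_iff _ |>.1 h1
    have h3 : T * L e = 0 := by rw [← hs, mul_assoc, h2, mul_zero]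
    exact congrArg (fun Z : K →L[ℂ] K => Z ξ) h3
  · have ak : ∀ k, ∀ x ∈ A k, e * x = x → x * e = x → ∀ ξ,
        (L e * T * L e) (L x ξ) = L x ((L e * T * L e) ξ) := by
      intro k x hx hex hxe ξ
      obtain ⟨y, hyB, c, c0, hyD, hey⟩ := avg_corner (hfd m) (hfd (max k m)) (hmono (le_max_right _ _))
        heD hep hmin (hmono (le_max_left k m) hx) hex hxe
      have hyM : y ∈ M := hA _ hyB
      have hxM : x ∈ M := hA _ hx
      have h1 := hTL _ y hyB hyD
      have hx' : x = (c⁻¹ : ℂ) • (e * y) := by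
        rw [hey, smul_smul, inv_mul_cancel₀ (by exact_mod_cast c0.ne'), one_smul]
      have key : L e (T (L e (L (e * y) ξ))) = L (e * y) (L e (T (L e ξ))) := by
        rw [S.L_mul heM (mul_mem heM hyM), ← mul_assoc, hep.2.eq, S.L_mul (mul_mem heM hyM) heM,
          hyD e heD, ← S.L_mul hyM heM, h1, S.L_mul heM hyM, mul_assoc,
          hep.2.eq, hyD e heD]
      change L e (T (L e (L x ξ))) = L x (L e (T (L e ξ)))
      rw [hx', S.L_smul (mul_mem heM hyM), S.L_smul (mul_mem heM hyM), map_smul, map_smul, map_smul, key]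
    intro x hx hex hxe ξ
    set S0 := L e * T * L e
    have ex : ∀ n : ℕ, ∃ a, a ∈ M ∧ (∀ ξ, S0 (L a ξ) = L a (S0 ξ)) ∧ ‖vec a - vec x‖ < 1 / (n + 1 : ℝ) := by
      intro n
      obtain ⟨k, a, ha, han⟩ := dense_union S hω hn hf hmono hA hc hx (ε := 1 / (n + 1 : ℝ)) (by positivity)
      have ha' : a ∈ A (max k m) := hmono (le_max_left _ _) ha
      have he' : e ∈ A (max k m) := hmono (le_max_right _ _) heD
      have haM := hA _ ha
      refine ⟨e * a * e, mul_mem (mul_mem heM haM) heM, ak (max k m) _ (mul_mem (mul_mem he' ha') he')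
        (by simp only [← mul_assoc, hep.2.eq]) (by simp only [mul_assoc, hep.2.eq]), ?_⟩
      have e1 : vec (e * a * e) - vec x = R e (L e (vec a - vec x)) := by
        rw [map_sub, map_sub, S.Lvec _ heM _ haM, S.Lvec _ heM _ hx, S.Rvec _ heM _ (mul_mem heM haM),
          S.Rvec _ heM _ (mul_mem heM hx), hex, hxe]
      have en : ‖e‖ ≤ 1 := by
        have := CStarRing.norm_star_mul_self (x := e)
        rw [sae, hep.2.eq] at this
        nlinarith [norm_nonneg e]
      have n1 : ‖L e‖ ≤ 1 := (S.Lnorm e heM).trans en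
      have n2 : ‖R e‖ ≤ 1 := (S.Rnorm e heM).trans en
      rw [e1]
      refine lt_of_le_of_lt ?_ han
      rw [norm_sub_rev (vec x)]
      calc _ ≤ ‖R e‖ * (‖L e‖ * ‖vec a - vec x‖) :=
            ((R e).le_opNorm _).trans (by gcongr; exact (L e).le_opNorm _)
        _ ≤ 1 * (1 * ‖vec a - vec x‖) := by gcongr
        _ = _ := by ring
    choose a haM haS han using ex
    have t1 : Tendsto (fun n => vec (a n)) atTop (nhds (vec x)) := by
      rw [tendsto_iff_norm_sub_tendsto_zero]
      exact squeeze_zero (fun _ => norm_nonneg _) (fun n => (han n).le) tendsto_one_div_add_atTop_nhds_zero_nat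
    have t2 : Tendsto (fun n => vec (star (a n))) atTop (nhds (vec (star x))) := by
      rw [tendsto_iff_norm_sub_tendsto_zero] at t1 ⊢
      refine t1.congr fun n => ?_
      rw [← map_sub, ← map_sub, ← star_sub, S.norm_star (sub_mem (haM n) hx)]
    have e : ∀ ξ, (S0 ∘L L x) ξ = (L x ∘L S0) ξ := by
      refine S.ext fun y hy => ?_
      refine S.ext_inner fun z hz => ?_
      have l1 : ∀ b ∈ M, (S0 ∘L L b) (vec y) = S0 (R y (vec b)) := fun b hb => by
        change S0 (L b (vec y)) = _
        rw [S.Lvec _ hb _ hy, S.Rvec _ hy _ hb]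
      have l2 : ∀ b ∈ M, inner ℂ ((L b ∘L S0) (vec y)) (vec z) = inner ℂ (S0 (vec y)) (R z (vec (star b))) := fun b hb => by
        change inner ℂ (L b (S0 (vec y))) (vec z) = _
        have := S.L_inner (star_mem hb) (S0 (vec y)) (vec z)
        rw [star_star] at this
        rw [this, S.Lvec _ (star_mem hb) _ hz, S.Rvec _ hz _ (star_mem hb)]
      rw [l1 x hx, l2 x hx]
      have T1 : Tendsto (fun n => inner ℂ (S0 (R y (vec (a n)))) (vec z)) atTop (nhds (inner ℂ (S0 (R y (vec x))) (vec z))) :=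
        Tendsto.inner (((S0.continuous.comp (R y).continuous).tendsto _).comp t1) tendsto_const_nhds
      have T2 : Tendsto (fun n => inner ℂ (S0 (vec y)) (R z (vec (star (a n))))) atTop (nhds (inner ℂ (S0 (vec y)) (R z (vec (star x))))) :=
        Tendsto.inner tendsto_const_nhds (((R z).continuous.tendsto _).comp t2)
      refine tendsto_nhds_unique T1 (T2.congr fun n => ?_)
      rw [← l1 _ (haM n), ← l2 _ (haM n)]
      change inner ℂ (L _ (S0 _)) _ = inner ℂ (S0 (L _ _)) _
      rw [haS]
    exact e ξ
  · intro y hy ξ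
    change L e (T (L e (R y ξ))) = R y (L e (T (L e ξ)))
    rw [S.L_R heM (hNM hy), hTR y hy, S.L_R heM (hNM hy)]

end stepC

section stepD
variable {H : Type u} [NormedAddCommGroup H] [InnerProductSpace ℂ H] [CompleteSpace H]
variable {M N Mω : VonNeumannAlgebra H} {τ : Op H →ₗ[ℂ] ℂ} {K : Type u} [NormedAddCommGroup K]
    [InnerProductSpace ℂ K] [CompleteSpace K] {vec : Op H →ₗ[ℂ] K} {L R : Op H → (K →L[ℂ] K)}
variable {ω : Ultrafilter ℕ} {limω : (ℕ → Op H) → Op H}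

theorem spec_sub {S0 : K →L[ℂ] K} (h0 : 0 ≤ S0) (hne : S0 ≠ 0) :
    ∃ c : ℝ, 0 < c ∧ ∃ F : K →L[ℂ] K, F ≠ 0 ∧ (∀ X : K →L[ℂ] K, Commute S0 X → Commute F X) ∧
      ∀ η, c * ‖F η‖ ^ 2 ≤ qf (F η) S0 := by
  have npos : 0 < ‖S0‖ := norm_pos_iff.2 hne
  have sa : IsSelfAdjoint S0 := h0.isSelfAdjoint
  set c := ‖S0‖ / 2 with hc
  have c0 : 0 < c := by positivity
  let f : ℝ → ℝ := fun t => max (t - c) 0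
  have fc : ContinuousOn f (spectrum ℝ S0) := by fun_prop
  refine ⟨c, c0, cfc f S0, ?_, fun X hX => hX.cfc_real f, ?_⟩
  · intro hF
    have h1 : S0 ≤ algebraMap ℝ _ c := by
      have h2 : algebraMap ℝ (K →L[ℂ] K) c + cfc f S0 = cfc (fun t => c + f t) S0 := by
        rw [cfc_const_add c f S0 fc]
      rw [hF, add_zero] at h2
      rw [h2]
      conv_lhs => rw [← cfc_id' ℝ S0]
      refine cfc_mono (fun t _ => ?_) (by fun_prop) (by fun_prop)
      have : t - c ≤ f t := le_max_left _ _
      linarith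
    have h3 := (CStarAlgebra.norm_le_iff_le_algebraMap S0 c0.le h0).2 h1
    linarith
  · intro η
    have hF : IsSelfAdjoint (cfc f S0) := cfc_predicate _ _
    have h1 : 0 ≤ cfc f S0 * (S0 - algebraMap ℝ _ c) * cfc f S0 := by
      have e1 : S0 - algebraMap ℝ _ c = cfc (fun t => t - c) S0 := by
        rw [cfc_sub (fun t => t) (fun _ => c) S0 (by fun_prop) (by fun_prop), cfc_id' ℝ S0, cfc_const c S0]
      rw [e1, ← cfc_mul _ _ _ (by fun_prop) (by fun_prop), ← cfc_mul _ _ _ (by fun_prop) (by fun_prop)]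
      refine cfc_nonneg fun t _ => ?_
      rcases le_total (t - c) 0 with h | h
      · simp [f, h]
      · simp only [f, max_eq_left h]; positivity
    have h2 := (nonneg_iff_inner _).1 h1 η
    have h3 : inner ℂ η ((cfc f S0 * (S0 - algebraMap ℝ _ c) * cfc f S0) η) =
        inner ℂ (cfc f S0 η) (S0 (cfc f S0 η)) - c * (‖cfc f S0 η‖ ^ 2 : ℝ) := by
      change inner ℂ η (cfc f S0 ((S0 - algebraMap ℝ _ c) (cfc f S0 η))) = _
      rw [← ContinuousLinearMap.adjoint_inner_left, ← ContinuousLinearMap.star_eq_adjoint, hF.star_eq,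
        Algebra.algebraMap_eq_smul_one, _root_.sub_apply, _root_.smul_apply,
        ContinuousLinearMap.one_apply, inner_sub_right, ← Complex.coe_smul, inner_smul_right,
        inner_self_eq_norm_sq_to_K]
      push_cast; rfl
    rw [h3, Complex.le_def] at h2
    have h4 := h2.1
    simp only [Complex.sub_re, ← Complex.ofReal_mul, Complex.ofReal_re, Complex.zero_re] at h4
    change _ ≤ (inner ℂ (cfc f S0 η) (S0 (cfc f S0 η))).re
    linarith

theorem closure_invariant {U : Submodule ℂ K} {T : K →L[ℂ] K} (h : ∀ ξ ∈ U, T ξ ∈ U) :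
    ∀ ξ ∈ U.topologicalClosure, T ξ ∈ U.topologicalClosure := by
  intro ξ hξ
  have h1 : U.topologicalClosure ≤ U.topologicalClosure.comap (T : K →ₗ[ℂ] K) := by
    refine Submodule.topologicalClosure_minimal _ (fun x hx => U.le_topologicalClosure (h x hx)) ?_
    exact U.isClosed_topologicalClosure.preimage T.continuous
  exact h1 hξ

theorem stepD (S : IsStd M τ vec L R) (hNM : (N : Set (Op H)) ⊆ (M : Set (Op H)))
    {T S0 : K →L[ℂ] K} {e : Op H} (heM : e ∈ M) (hep : IsProjection e) (h0 : 0 ≤ S0) (hne : S0 ≠ 0)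
    (hS0 : ∀ ξ, S0 ξ = L e (T (L e ξ)))
    (hL : ∀ x ∈ M, e * x = x → x * e = x → ∀ ξ, S0 (L x ξ) = L x (S0 ξ))
    (hR : ∀ y ∈ N, ∀ ξ, S0 (R y ξ) = R y (S0 ξ)) :
    ∃ V : Submodule ℂ K, ∃ c : ℝ, 0 < c ∧ IsClosed (V : Set K) ∧ (∃ ξ ∈ V, ξ ≠ 0) ∧
      (∀ ξ ∈ V, L e ξ = ξ) ∧ (∀ x ∈ M, e * x = x → x * e = x → ∀ ξ ∈ V, L x ξ ∈ V) ∧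
      (∀ y ∈ N, ∀ ξ ∈ V, R y ξ ∈ V) ∧ ∀ ξ ∈ V, c * ‖ξ‖ ^ 2 ≤ qf ξ T := by
  obtain ⟨c, c0, F, hF, hcom, hq⟩ := spec_sub h0 hne
  let V := (LinearMap.range (F : K →ₗ[ℂ] K)).topologicalClosure
  have hFL : ∀ x ∈ M, e * x = x → x * e = x → ∀ ξ, F (L x ξ) = L x (F ξ) := fun x hx h1 h2 ξ =>
    congrArg (fun Z : K →L[ℂ] K => Z ξ) (hcom (L x) (ContinuousLinearMap.ext (hL x hx h1 h2))).eq
  have hFR : ∀ y ∈ N, ∀ ξ, F (R y ξ) = R y (F ξ) := fun x hx ξ =>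
    congrArg (fun Z : K →L[ℂ] K => Z ξ) (hcom (R x) (ContinuousLinearMap.ext (hR x hx))).eq
  have Lee : ∀ ξ, L e (L e ξ) = L e ξ := fun ξ => by rw [S.L_mul heM heM, hep.2.eq]
  have hFe : ∀ ξ, L e (F ξ) = F ξ := by
    intro ξ
    have h1 : F (ξ - L e ξ) = F ξ - L e (F ξ) := by rw [map_sub, hFL e heM hep.2.eq hep.2.eq]
    have h2 := hq (ξ - L e ξ)
    have h3 : S0 (F (ξ - L e ξ)) = 0 := by
      rw [h1, map_sub, hS0, hS0, Lee, sub_self]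
    have h4 : qf (F (ξ - L e ξ)) S0 = 0 := by
      change (inner ℂ (F (ξ - L e ξ)) (S0 (F (ξ - L e ξ)))).re = 0
      rw [h3, inner_zero_right]; rfl
    rw [h4] at h2
    have h5 : ‖F (ξ - L e ξ)‖ ^ 2 = 0 := by
      have := sq_nonneg ‖F (ξ - L e ξ)‖
      nlinarith
    have h6 : F (ξ - L e ξ) = 0 := by simpa using h5
    rw [h1] at h6
    exact (sub_eq_zero.1 h6).symm
  have cl : ∀ (P : K → Prop), IsClosed {ξ | P ξ} → (∀ ξ, P (F ξ)) → ∀ ξ ∈ V, P ξ := by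
    intro P hP h ξ hξ
    have : closure (LinearMap.range (F : K →ₗ[ℂ] K) : Set K) ⊆ {ξ | P ξ} := by
      refine closure_minimal ?_ hP
      rintro _ ⟨x, rfl⟩
      exact h x
    exact this hξ
  have hVe : ∀ ξ ∈ V, L e ξ = ξ := cl _ (isClosed_eq (L e).continuous continuous_id) hFe
  refine ⟨V, c, c0, Submodule.isClosed_topologicalClosure _, ?_, hVe, ?_, ?_, ?_⟩
  · obtain ⟨η, hη⟩ : ∃ η, F η ≠ 0 := by
      by_contra hc
      push Not at hc
      exact hF (ContinuousLinearMap.ext hc)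
    exact ⟨F η, Submodule.le_topologicalClosure _ ⟨η, rfl⟩, hη⟩
  · intro x hx h1 h2
    refine closure_invariant ?_
    rintro _ ⟨η, rfl⟩
    exact ⟨L x η, hFL x hx h1 h2 η⟩
  · intro x hx
    refine closure_invariant ?_
    rintro _ ⟨η, rfl⟩
    exact ⟨R x η, hFR x hx η⟩
  · have : ∀ ξ ∈ V, c * ‖ξ‖ ^ 2 ≤ qf ξ S0 := by
      refine cl (fun ξ => c * ‖ξ‖ ^ 2 ≤ qf ξ S0) ?_ hq
      refine isClosed_le (by fun_prop) ?_
      change Continuous fun ξ => (inner ℂ ξ (S0 ξ)).re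
      fun_prop
    intro ξ hξ
    refine (this ξ hξ).trans (le_of_eq ?_)
    change (inner ℂ ξ (S0 ξ)).re = (inner ℂ ξ (T ξ)).re
    have h1 := S.L_inner heM ξ (T ξ)
    rw [hep.1.star_eq] at h1
    rw [hS0, hVe ξ hξ, ← h1, hVe ξ hξ]

theorem not_min (htr : IsTracialState (M : Set (Op H)) τ) (h : ¬ CornerEmbeds (M : Set (Op H)) (N : Set (Op H)) (M : Set (Op H)))
    {e : Op H} (heM : e ∈ M) (hep : IsProjection e) (he0 : e ≠ 0) :
    ∃ x ∈ M, e * x * e = x ∧ ∀ c : ℂ, x ≠ c • e := by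
  by_contra hc
  push Not at hc
  apply h
  have hte : τ e ≠ 0 := fun h0 => he0 (htr.faithful e heM (by rw [hep.1.star_eq, hep.2.eq, h0]))
  have hone : (1 : Op H) ≠ 0 := fun h0 => he0 (by rw [← mul_one e, h0, mul_zero])
  have key : ∀ c : ℂ, τ (c • e) / τ e = c := fun c => by rw [map_smul, smul_eq_mul, mul_div_cancel_right₀ _ hte]
  refine ⟨e, 1, e, fun x => (τ x / τ e) • 1, heM, hep, he0, one_mem N, ⟨IsSelfAdjoint.one _, IsIdempotentElem.one⟩,
    hone, ⟨?_, ?_, ?_, ?_, ?_⟩, heM, he0, by rw [hep.1.star_eq, hep.2.eq]; exact hep,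
    by rw [one_mul, hep.2.eq], ?_⟩
  · intro x _
    exact ⟨vn_smul N (one_mem N) _, by simp⟩
  · intro x _ y _
    simp only [map_add, add_div, add_smul]
  · rintro x ⟨hx, hx2⟩ y ⟨hy, hy2⟩
    obtain ⟨c, rfl⟩ := hc x hx hx2
    obtain ⟨d, rfl⟩ := hc y hy hy2
    rw [smul_mul_smul_comm, hep.2.eq]
    simp only [key, smul_mul_smul_comm, mul_one]
  · intro c x _
    simp only [map_smul, smul_eq_mul, smul_smul, mul_div_assoc]
  · rintro x ⟨hx, hx2⟩
    obtain ⟨c, rfl⟩ := hc x hx hx2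
    simp only [star_smul, hep.1.star_eq, key, star_one]
  · rintro x ⟨hx, hx2⟩
    obtain ⟨c, rfl⟩ := hc x hx hx2
    simp only [key, smul_mul_assoc, one_mul, mul_smul_comm, hep.2.eq]

theorem rangeProj {a : Op H} (ha : a ∈ M) : pr (LinearMap.range (a : H →ₗ[ℂ] H)) ∈ M := by
  rw [mem_vn_iff]
  have h1 : ∀ y ∈ Set.centralizer (M : Set (Op H)), ∀ x ∈ LinearMap.range (a : H →ₗ[ℂ] H),
      y x ∈ (LinearMap.range (a : H →ₗ[ℂ] H)).topologicalClosure := by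
    rintro y hy _ ⟨x, rfl⟩
    refine Submodule.le_topologicalClosure _ ⟨y x, ?_⟩
    exact congrArg (fun Z : Op H => Z x) ((mem_vn_iff M a).1 ha y hy).symm
  intro y hy
  ext ξ
  refine (pr_comm (h1 y hy) ?_ ξ).symm
  exact h1 _ (star_mem_centralizer M hy)

theorem split_proj (htr : IsTracialState (M : Set (Op H)) τ)
    (h : ¬ CornerEmbeds (M : Set (Op H)) (N : Set (Op H)) (M : Set (Op H)))
    {e : Op H} (heM : e ∈ M) (hep : IsProjection e) (he0 : e ≠ 0) :
    ∃ p ∈ M, IsProjection p ∧ p ≠ 0 ∧ e - p ≠ 0 ∧ e * p = p ∧ p * e = p := by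
  have sae : star e = e := hep.1.star_eq
  have hte : τ e ≠ 0 := fun h0 => he0 (htr.faithful e heM (by rw [hep.1.star_eq, hep.2.eq, h0]))
  have hsa : ∃ x ∈ M, IsSelfAdjoint x ∧ e * x * e = x ∧ ∀ c : ℂ, x ≠ c • e := by
    obtain ⟨x, hx, hxe, hxc⟩ := not_min htr h heM hep he0
    have hxs : e * star x * e = star x := by
      have := congrArg star hxe
      simpa [star_mul, sae, mul_assoc] using this
    by_contra hc
    push Not at hc
    obtain ⟨c1, h1⟩ := hc (x + star x) (add_mem hx (star_mem hx))
      (by rw [isSelfAdjoint_iff]; simp [add_comm]) (by rw [mul_add, add_mul, hxe, hxs])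
    obtain ⟨c2, h2⟩ := hc (Complex.I • (x - star x)) (vn_smul M (sub_mem hx (star_mem hx)) _)
      (by rw [isSelfAdjoint_iff]
          simp only [star_smul, star_sub, star_star, RCLike.star_def, Complex.conj_I]
          rw [neg_smul, ← smul_neg, neg_sub])
      (by rw [mul_smul_comm, smul_mul_assoc, mul_sub, sub_mul, hxe, hxs])
    refine hxc ((c1 - Complex.I * c2) / 2) ?_
    have : x = (2⁻¹ : ℂ) • ((x + star x) - Complex.I • (Complex.I • (x - star x))) := by
      rw [smul_smul, Complex.I_mul_I]
      module
    rw [this, h1, h2]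
    module
  obtain ⟨x, hx, xsa, hxe, hxc⟩ := hsa
  have hexx : e * x = x := by rw [← hxe]; simp only [← mul_assoc, hep.2.eq]
  have hxex : x * e = x := by rw [← hxe]; simp only [mul_assoc, hep.2.eq]
  have ere : star (τ e) = τ e := by
    have := htr.star heM
    rw [sae] at this; exact this.symm
  have xre : star (τ x) = τ x := by
    have := htr.star hx
    rw [xsa.star_eq] at this; exact this.symm
  let t : ℂ := τ x / τ e
  have ht : star t = t := by simp only [t, star_div₀, ere, xre]
  set y := x - t • e with hy
  have yM : y ∈ M := sub_mem hx (vn_smul M heM _)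
  have ysa : IsSelfAdjoint y := by
    rw [isSelfAdjoint_iff, hy, star_sub, star_smul, ht, sae, xsa.star_eq]
  have y0 : y ≠ 0 := fun h0 => hxc t (sub_eq_zero.1 h0)
  have ty : τ y = 0 := by
    rw [hy, map_sub, map_smul, smul_eq_mul, div_mul_cancel₀ _ hte, sub_self]
  have hey : e * y = y := by rw [hy, mul_sub, mul_smul_comm, hexx, hep.2.eq]
  have hye : y * e = y := by rw [hy, sub_mul, smul_mul_assoc, hxex, hep.2.eq]
  let f : ℝ → ℝ := fun t => max t 0
  let g : ℝ → ℝ := fun t => max (-t) 0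
  have hfg : cfc f y - cfc g y = y := by
    rw [← cfc_sub f g y (by fun_prop) (by fun_prop)]
    conv_rhs => rw [← cfc_id' ℝ y]
    refine cfc_congr fun t _ => ?_
    rcases le_total t 0 with h | h <;> simp [f, g, h]
  have hgf : cfc g y * cfc f y = 0 := by
    rw [← cfc_mul g f y (by fun_prop) (by fun_prop), ← cfc_zero ℝ y]
    refine cfc_congr fun t _ => ?_
    rcases le_total t 0 with h | h <;> simp [f, g, h]
  have ce : ∀ f : ℝ → ℝ, cfc f y * e = e * cfc f y := fun f =>
    (Commute.cfc_real (hye.trans hey.symm : Commute y e) f).eq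
  have cM : ∀ f : ℝ → ℝ, cfc f y ∈ M := cfc_mem_vn yM
  have pos : ∀ f : ℝ → ℝ, 0 ≤ f → 0 ≤ e * cfc f y := fun f hf => by
    have h1 : 0 ≤ cfc f y := cfc_nonneg fun t _ => hf t
    have h2 := star_left_conjugate_nonneg h1 e
    rwa [sae, mul_assoc, ce, ← mul_assoc, hep.2.eq] at h2
  have tz : ∀ f : ℝ → ℝ, 0 ≤ f → τ (e * cfc f y) = 0 → e * cfc f y = 0 := fun f hf h0 =>
    htr.eq_zero (mul_mem heM (cM f)) (pos f hf) h0
  have hf0 : 0 ≤ f := fun t => le_max_right _ _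
  have hg0 : 0 ≤ g := fun t => le_max_right _ _
  have hdiff : e * cfc f y - e * cfc g y = y := by rw [← mul_sub, hfg, hey]
  have teq : τ (e * cfc f y) = τ (e * cfc g y) := by
    rw [← sub_eq_zero, ← map_sub, hdiff, ty]
  have a0 : e * cfc f y ≠ 0 := fun h0 => by
    have h1 := tz g hg0 (by rw [← teq, h0, map_zero])
    rw [h0, h1, sub_zero] at hdiff
    exact y0 hdiff.symm
  have b0 : e * cfc g y ≠ 0 := fun h0 => by
    have h1 := tz f hf0 (by rw [teq, h0, map_zero])
    rw [h0, h1, sub_zero] at hdiff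
    exact y0 hdiff.symm
  set a := e * cfc f y with ha
  set b := e * cfc g y with hb
  have hba : b * a = 0 := by
    rw [ha, hb, mul_assoc, ← mul_assoc (cfc g y), ce, mul_assoc, hgf, mul_zero, mul_zero]
  have hea : e * a = a := by rw [ha, ← mul_assoc, hep.2.eq]
  have hbe : b * e = b := by rw [hb, mul_assoc, ce, ← mul_assoc, hep.2.eq]
  set U := LinearMap.range (a : H →ₗ[ℂ] H)
  set p := pr U with hp
  have psa : star p = p := pr_adj U
  have cl : ∀ Z : Op H, ∀ Z' : Op H, Z * a = Z' * a → Z * p = Z' * p := by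
    intro Z Z' hZ
    ext ξ
    have : closure (U : Set H) ⊆ {ξ | Z ξ = Z' ξ} := by
      refine closure_minimal ?_ (isClosed_eq Z.continuous Z'.continuous)
      rintro _ ⟨x, rfl⟩
      exact congrArg (fun Z : Op H => Z x) hZ
    exact this (pr_mem U ξ)
  have hep' : e * p = p := by
    have := cl e 1 (by rw [hea, one_mul])
    rwa [one_mul] at this
  have hbp : b * p = 0 := by
    have := cl b 0 (by rw [hba, zero_mul])
    rwa [zero_mul] at this
  refine ⟨p, rangeProj (mul_mem heM (cM f)), ⟨psa, ?_⟩, ?_, ?_, hep', ?_⟩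
  · exact ContinuousLinearMap.ext fun ξ => pr_pr U ξ
  · intro h0
    apply a0
    ext ξ
    have : pr U (a ξ) = a ξ := pr_eq' ⟨ξ, rfl⟩
    rw [← this, ← hp, h0]; simp
  · intro h0
    apply b0
    rw [← hbe, sub_eq_zero.1 h0, hbp]
  · have := congrArg star hep'
    rwa [star_mul, psa, sae] at this

theorem many_proj (htr : IsTracialState (M : Set (Op H)) τ)
    (h : ¬ CornerEmbeds (M : Set (Op H)) (N : Set (Op H)) (M : Set (Op H))) (n : ℕ) :
    ∀ {e : Op H} (heM : e ∈ M) (hep : IsProjection e) (he0 : e ≠ 0),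
    ∃ p : Fin n → Op H, (∀ i, p i ∈ M ∧ IsProjection (p i) ∧ p i ≠ 0 ∧ e * p i = p i ∧ p i * e = p i) ∧
      ∀ i j, i ≠ j → p i * p j = 0 := by
  induction n with
  | zero => intro e _ _ _; exact ⟨fun _ => 0, fun i => i.elim0, fun i => i.elim0⟩
  | succ n ih =>
    intro e heM hep he0
    obtain ⟨p, hpM, hpp, p0, q0, hep', hpe⟩ := split_proj htr h heM hep he0
    have hq : IsProjection (e - p) := by
      refine ⟨hep.1.sub hpp.1, ?_⟩
      change (e - p) * (e - p) = e - p
      rw [mul_sub, sub_mul, sub_mul, hep.2.eq, hpe, hep', hpp.2.eq, sub_self, sub_zero]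
    obtain ⟨P, h1, h2⟩ := ih (sub_mem heM hpM) hq q0
    have k1 : e * (e - p) = e - p := by rw [mul_sub, hep.2.eq, hep']
    have k2 : (e - p) * e = e - p := by rw [sub_mul, hep.2.eq, hpe]
    have k3 : p * (e - p) = 0 := by rw [mul_sub, hpe, hpp.2.eq, sub_self]
    have k4 : (e - p) * p = 0 := by rw [sub_mul, hep', hpp.2.eq, sub_self]
    refine ⟨Fin.cons p P, fun i => ?_, fun i j hij => ?_⟩
    · refine Fin.cases ?_ (fun i => ?_) i
      · exact ⟨hpM, hpp, p0, hep', hpe⟩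
      · obtain ⟨a, b, c, d, e'⟩ := h1 i
        refine ⟨a, b, c, ?_, ?_⟩
        · simp only [Fin.cons_succ]; rw [← d, ← mul_assoc, k1]
        · simp only [Fin.cons_succ]; rw [← e', mul_assoc, k2]
    · induction i using Fin.cases with
      | zero =>
        induction j using Fin.cases with
        | zero => exact absurd rfl hij
        | succ j => simp only [Fin.cons_succ, Fin.cons_zero]; rw [← (h1 j).2.2.2.1, ← mul_assoc, k3, zero_mul]
      | succ i =>
        induction j using Fin.cases with
        | zero => simp only [Fin.cons_succ, Fin.cons_zero]; rw [← (h1 i).2.2.2.2, mul_assoc, k4, mul_zero]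
        | succ j =>
          simp only [Fin.cons_succ]
          exact h2 i j fun h => hij (by rw [h])

end stepD

section compar
variable {H : Type u} [NormedAddCommGroup H] [InnerProductSpace ℂ H] [CompleteSpace H]
variable {M N Mω : VonNeumannAlgebra H} {τ : Op H →ₗ[ℂ] ℂ} {K : Type u} [NormedAddCommGroup K]
    [InnerProductSpace ℂ K] [CompleteSpace K] {vec : Op H →ₗ[ℂ] K} {L R : Op H → (K →L[ℂ] K)}
variable {ω : Ultrafilter ℕ} {limω : (ℕ → Op H) → Op H}

theorem abs_norm' (X : K →L[ℂ] K) (ξ : K) : ‖CFC.abs X ξ‖ = ‖X ξ‖ := by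
  have h1 : ∀ Y : K →L[ℂ] K, inner ℂ (Y ξ) (Y ξ) = inner ℂ ((star Y * Y) ξ) ξ := fun Y => by
    rw [ContinuousLinearMap.star_eq_adjoint]
    exact (ContinuousLinearMap.adjoint_inner_left Y ξ (Y ξ)).symm
  have h2 : inner ℂ (CFC.abs X ξ) (CFC.abs X ξ) = inner ℂ (X ξ) (X ξ) := by
    rw [h1, h1, (CFC.abs_nonneg X).isSelfAdjoint.star_eq, CFC.abs_mul_abs]
  rw [inner_self_eq_norm_sq_to_K, inner_self_eq_norm_sq_to_K] at h2
  have h3 : ‖CFC.abs X ξ‖ ^ 2 = ‖X ξ‖ ^ 2 := by exact_mod_cast h2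
  exact (sq_eq_sq₀ (norm_nonneg _) (norm_nonneg _)).1 h3

/-- polar graph -/
noncomputable def pgraph (X : K →L[ℂ] K) : Submodule ℂ (HS K K) where
  carrier := {g | ∃ η, g = pp (CFC.abs X η) (X η)}
  zero_mem' := ⟨0, by rw [map_zero, map_zero]; rfl⟩
  add_mem' := by
    rintro _ _ ⟨a, rfl⟩ ⟨b, rfl⟩
    exact ⟨a + b, by rw [map_add, map_add]; rfl⟩
  smul_mem' := by
    rintro c _ ⟨a, rfl⟩
    exact ⟨c • a, by rw [map_smul, map_smul]; rfl⟩

theorem pgraph_iso (X : K →L[ℂ] K) : ∀ g ∈ pgraph X, ‖g.fst‖ = ‖g.snd‖ := by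
  rintro _ ⟨a, rfl⟩
  exact abs_norm' X a

/-- good graphs -/
def Good (N : VonNeumannAlgebra H) (R : Op H → (K →L[ℂ] K)) (V1 V2 : Submodule ℂ K) (G : Submodule ℂ (HS K K)) : Prop :=
  (∀ g ∈ G, g.fst ∈ V1 ∧ g.snd ∈ V2 ∧ ‖g.fst‖ = ‖g.snd‖) ∧ ∀ y ∈ N, ∀ g ∈ G, pp (R y g.fst) (R y g.snd) ∈ G

theorem good_extend (S : IsStd M τ vec L R) (hω : IsFreeUltrafilter ω) (hn : Nrml ω M τ)
    (hf : relComm (N : Set (Op H)) N = scalars H) (hNM : (N : Set (Op H)) ⊆ (M : Set (Op H)))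
    {V1 V2 : Submodule ℂ K} (hV1 : IsClosed (V1 : Set K)) (hV2 : IsClosed (V2 : Set K))
    (hV2N : V2 ≤ (l2 vec N).topologicalClosure)
    (h1 : ∀ y ∈ N, ∀ ξ ∈ V1, R y ξ ∈ V1) (h2 : ∀ y ∈ N, ∀ ξ ∈ V2, R y ξ ∈ V2)
    (hne1 : ∃ ξ ∈ V1, ξ ≠ 0) (hne2 : ∃ ξ ∈ V2, ξ ≠ 0) :
    ∃ G, Good N R V1 V2 G ∧ ∃ g ∈ G, g.snd ≠ 0 := by
  have c1 : V1.topologicalClosure = V1 := hV1.submodule_topologicalClosure_eq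
  have c2 : V2.topologicalClosure = V2 := hV2.submodule_topologicalClosure_eq
  have ex : ∃ m ∈ M, ∃ ξ ∈ V1, pr V2 (L m ξ) ≠ 0 := by
    by_contra hc
    push Not at hc
    obtain ⟨ξ, hξ, ξ0⟩ := hne1
    have hc2 : ∀ m ∈ M, ∀ η ∈ V2, inner ℂ η (L m ξ) = 0 := fun m hm η hη => by
      have := pr_inner V2 η (L m ξ)
      rw [hc m hm ξ hξ, inner_zero_right, pr_eq' hη] at this
      exact this
    let U : Submodule ℂ K := Submodule.span ℂ {ζ | ∃ n ∈ N, ∃ η ∈ V2, ζ = L n η}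
    have inv : ∀ T : K →L[ℂ] K, (∀ n ∈ N, ∀ η ∈ V2, T (L n η) ∈ U) → ∀ ζ ∈ U, T ζ ∈ U := by
      intro T hT ζ hζ
      have : U ≤ U.comap (T : K →ₗ[ℂ] K) := by
        refine Submodule.span_le.2 ?_
        rintro _ ⟨n, hn, η, hη, rfl⟩
        exact hT n hn η hη
      exact this hζ
    have LN : ∀ n ∈ N, ∀ η ∈ (l2 vec N).topologicalClosure, L n η ∈ (l2 vec N).topologicalClosure := by
      intro n hn
      refine closure_invariant ?_
      rintro _ ⟨z, hz, rfl⟩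
      rw [S.Lvec n (hNM hn) z (hNM hz)]
      exact vec_mem_l2 (mul_mem hn hz)
    have hv := bimodule S hNM hω hn hf U
      (by
        refine Submodule.span_le.2 ?_
        rintro _ ⟨n, hn, η, hη, rfl⟩
        exact LN n hn η (hV2N hη))
      (fun x hx ζ hζ => U.le_topologicalClosure (inv (L x) (fun n hn η hη => by
        rw [S.L_mul (hNM hx) (hNM hn)]
        exact Submodule.subset_span ⟨_, mul_mem hx hn, η, hη, rfl⟩) ζ hζ))
      (fun x hx ζ hζ => U.le_topologicalClosure (inv (R x) (fun n hn η hη => by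
        rw [← S.L_R (hNM hn) (hNM hx)]
        exact Submodule.subset_span ⟨_, hn, R x η, h2 x hx η hη, rfl⟩) ζ hζ))
      (by
        obtain ⟨η, hη, η0⟩ := hne2
        exact ⟨η, Submodule.subset_span ⟨1, one_mem _, η, hη, (S.L_one η).symm⟩, η0⟩)
    apply ξ0
    refine S.ext_inner fun m hm => ?_
    rw [inner_zero_left]
    have e1 : vec m = L m (vec 1) := S.vec_eq hm
    have e2 := S.L_inner hm ξ (vec 1)
    rw [e1, ← e2]
    have e3 : ∀ u ∈ U, inner ℂ u (L (star m) ξ) = 0 := by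
      intro u hu
      have : U ≤ (LinearMap.ker (innerSL ℂ (L (star m) ξ) : K →ₗ[ℂ] ℂ)) := by
        refine Submodule.span_le.2 ?_
        rintro _ ⟨n, hn, η, hη, rfl⟩
        change inner ℂ (L (star m) ξ) (L n η) = 0
        rw [← S.L_inner (hNM hn), S.L_mul (star_mem (hNM hn)) (star_mem hm), ← inner_conj_symm,
          hc2 _ (mul_mem (star_mem (hNM hn)) (star_mem hm)) η hη, map_zero]
      have h3 : inner ℂ (L (star m) ξ) u = 0 := this hu
      rw [← inner_conj_symm, h3, map_zero]
    rw [← inner_conj_symm, closure_orth e3 _ hv, map_zero]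
  obtain ⟨m, hm, ξ, hξ, hne⟩ := ex
  let X : K →L[ℂ] K := pr V2 * L m * pr V1
  have prR1 : ∀ y ∈ N, ∀ ξ, pr V1 (R y ξ) = R y (pr V1 ξ) := fun y hy ξ => by
    refine pr_comm (fun x hx => by rw [c1]; exact h1 y hy x hx) (fun x hx => ?_) ξ
    rw [S.R_adj (hNM hy), c1]
    exact h1 _ (star_mem hy) x hx
  have prR2 : ∀ y ∈ N, ∀ ξ, pr V2 (R y ξ) = R y (pr V2 ξ) := fun y hy ξ => by
    refine pr_comm (fun x hx => by rw [c2]; exact h2 y hy x hx) (fun x hx => ?_) ξ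
    rw [S.R_adj (hNM hy), c2]
    exact h2 _ (star_mem hy) x hx
  have XR : ∀ y ∈ N, Commute X (R y) := fun y hy => by
    refine ContinuousLinearMap.ext fun ξ => ?_
    change pr V2 (L m (pr V1 (R y ξ))) = R y (pr V2 (L m (pr V1 ξ)))
    rw [prR1 y hy, S.L_R hm (hNM hy), prR2 y hy]
  have XR' : ∀ y ∈ N, Commute X (star (R y)) := fun y hy => by
    rw [ContinuousLinearMap.star_eq_adjoint, S.R_adj (hNM hy)]
    exact XR _ (star_mem hy)
  have aR : ∀ y ∈ N, Commute (CFC.abs X) (R y) := fun y hy =>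
    Commute.cfcAbs_left (XR y hy) (XR' y hy)
  have aV : ∀ η, CFC.abs X η ∈ V1 := by
    have e1 : CFC.abs X * pr V1 = CFC.abs X := by
      refine ContinuousLinearMap.ext fun η => ?_
      change CFC.abs X (pr V1 η) = CFC.abs X η
      rw [← sub_eq_zero, ← map_sub, ← norm_eq_zero, abs_norm', norm_eq_zero]
      change pr V2 (L m (pr V1 (pr V1 η - η))) = 0
      rw [map_sub, pr_pr, sub_self, map_zero, map_zero]
    have e2 := congrArg star e1
    rw [star_mul, (CFC.abs_nonneg X).isSelfAdjoint.star_eq, ContinuousLinearMap.star_eq_adjoint, pr_adj] at e2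
    intro η
    have e3 := congrArg (fun Z : K →L[ℂ] K => Z η) e2
    have := mem_of_pr_eq (U := V1) (ξ := CFC.abs X η) e3
    rwa [c1] at this
  refine ⟨pgraph X, ⟨?_, ?_⟩, pp (CFC.abs X ξ) (X ξ), ⟨ξ, rfl⟩, ?_⟩
  · rintro g hg
    refine ⟨?_, ?_, pgraph_iso X g hg⟩
    · obtain ⟨η, rfl⟩ := hg
      exact aV η
    · obtain ⟨η, rfl⟩ := hg
      have := pr_mem V2 (L m (pr V1 η))
      rwa [c2] at this
  · rintro y hy _ ⟨η, rfl⟩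
    refine ⟨R y η, ?_⟩
    have e1 := congrArg (fun Z : K →L[ℂ] K => Z η) (aR y hy).eq
    have e2 := congrArg (fun Z : K →L[ℂ] K => Z η) (XR y hy).eq
    change CFC.abs X (R y η) = R y (CFC.abs X η) at e1
    change X (R y η) = R y (X η) at e2
    rw [e1, e2]
    rfl
  · change pr V2 (L m (pr V1 ξ)) ≠ 0
    rwa [pr_eq' hξ]

theorem compare (S : IsStd M τ vec L R) (hω : IsFreeUltrafilter ω) (hn : Nrml ω M τ)
    (hf : relComm (N : Set (Op H)) N = scalars H) (hNM : (N : Set (Op H)) ⊆ (M : Set (Op H)))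
    {V1 V2 : Submodule ℂ K} (hV1 : IsClosed (V1 : Set K)) (hV2 : IsClosed (V2 : Set K))
    (hV2N : V2 ≤ (l2 vec N).topologicalClosure)
    (h1 : ∀ y ∈ N, ∀ ξ ∈ V1, R y ξ ∈ V1) (h2 : ∀ y ∈ N, ∀ ξ ∈ V2, R y ξ ∈ V2) :
    ∃ W : K →L[ℂ] K, (∀ ξ, W ξ ∈ V2) ∧ (∀ ξ, ContinuousLinearMap.adjoint W ξ ∈ V1) ∧
      (∀ y ∈ N, ∀ ξ, W (R y ξ) = R y (W ξ)) ∧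
      ((∀ ξ ∈ V1, ContinuousLinearMap.adjoint W (W ξ) = ξ) ∨
        (∀ ξ ∈ V2, W (ContinuousLinearMap.adjoint W ξ) = ξ)) := by
  obtain ⟨G, -, hG⟩ := zorn_le_nonempty₀ {G | Good N R V1 V2 G} (by
    intro c hc hch y hy
    refine ⟨sSup c, ?_, fun z hz => le_sSup hz⟩
    have mem : ∀ g, g ∈ sSup c ↔ ∃ G ∈ c, g ∈ G := fun g =>
      Submodule.mem_sSup_of_directed ⟨y, hy⟩ hch.directedOn
    refine ⟨fun g hg => ?_, fun y hy g hg => ?_⟩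
    · obtain ⟨G, hG, hgG⟩ := (mem g).1 hg
      exact (hc hG).1 g hgG
    · obtain ⟨G, hG, hgG⟩ := (mem g).1 hg
      exact (mem _).2 ⟨G, hG, (hc hG).2 y hy g hgG⟩) ⊥ (by
    refine ⟨fun g hg => ?_, fun y hy g hg => ?_⟩
    · rw [(Submodule.mem_bot ℂ).1 hg]
      exact ⟨zero_mem _, zero_mem _, by simp⟩
    · rw [(Submodule.mem_bot ℂ).1 hg]
      simp)
  have gG : Good N R V1 V2 G := hG.1
  obtain ⟨W, w1, w2, w3, w4, w5, w6⟩ := graph_iso G fun g hg => (gG.1 g hg).2.2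
  let U1 : Submodule ℂ K := G.map (WithLp.fstL 2 ℂ K K : HS K K →ₗ[ℂ] K)
  let U2 : Submodule ℂ K := G.map (WithLp.sndL 2 ℂ K K : HS K K →ₗ[ℂ] K)
  have u1 : ∀ g ∈ G, g.fst ∈ U1 := fun g hg => ⟨g, hg, rfl⟩
  have u2 : ∀ g ∈ G, g.snd ∈ U2 := fun g hg => ⟨g, hg, rfl⟩
  have cU1 : U1.topologicalClosure ≤ V1 := Submodule.topologicalClosure_minimal _
    (by rintro _ ⟨g, hg, rfl⟩; exact (gG.1 g hg).1) hV1
  have cU2 : U2.topologicalClosure ≤ V2 := Submodule.topologicalClosure_minimal _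
    (by rintro _ ⟨g, hg, rfl⟩; exact (gG.1 g hg).2.1) hV2
  have Wpr : ∀ ξ, W ξ = W (pr U1 ξ) := fun ξ => by
    rw [← sub_eq_zero, ← map_sub]
    refine w3 _ fun g hg => ?_
    exact pr_sub_orth _ (U1.le_topologicalClosure (u1 g hg))
  have Wpr' : ∀ ξ, ContinuousLinearMap.adjoint W ξ = ContinuousLinearMap.adjoint W (pr U2 ξ) := fun ξ => by
    rw [← sub_eq_zero, ← map_sub]
    refine w4 _ fun g hg => ?_
    exact pr_sub_orth _ (U2.le_topologicalClosure (u2 g hg))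
  refine ⟨W, fun ξ => ?_, fun ξ => ?_, fun y hy => ?_, ?_⟩
  · rw [Wpr]
    refine cU2 (closure_map (U := U1) ?_ (pr_mem U1 ξ))
    rintro _ ⟨g, hg, rfl⟩
    refine U2.le_topologicalClosure ?_
    have := w1 g hg
    exact ⟨g, hg, this.symm⟩
  · rw [Wpr']
    refine cU1 (closure_map (U := U2) ?_ (pr_mem U2 ξ))
    rintro _ ⟨g, hg, rfl⟩
    refine U1.le_topologicalClosure ?_
    have := w2 g hg
    exact ⟨g, hg, this.symm⟩
  · refine w6 (R y) (R y) (fun g hg => G.le_topologicalClosure (gG.2 y hy g hg)) fun g hg => ?_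
    rw [S.R_adj (hNM hy)]
    exact G.le_topologicalClosure (gG.2 _ (star_mem hy) g hg)
  · have dich : (∀ x ∈ V1, (∀ u ∈ U1, inner ℂ u x = 0) → x = 0) ∨ (∀ x ∈ V2, (∀ u ∈ U2, inner ℂ u x = 0) → x = 0) := by
      by_contra hc
      push Not at hc
      obtain ⟨⟨x, hx, hxo, x0⟩, y, hy, hyo, y0⟩ := hc
      have Uinv1 : ∀ y ∈ N, ∀ u ∈ U1, R y u ∈ U1 := by
        rintro y hy _ ⟨g, hg, rfl⟩
        exact ⟨_, gG.2 y hy g hg, rfl⟩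
      have Uinv2 : ∀ y ∈ N, ∀ u ∈ U2, R y u ∈ U2 := by
        rintro y hy _ ⟨g, hg, rfl⟩
        exact ⟨_, gG.2 y hy g hg, rfl⟩
      have Oinv : ∀ U : Submodule ℂ K, (∀ y ∈ N, ∀ u ∈ U, R y u ∈ U) → ∀ y ∈ N, ∀ x ∈ Uᗮ, R y x ∈ Uᗮ := by
        intro U hU y hy x hx
        rw [Submodule.mem_orthogonal] at hx ⊢
        intro u hu
        rw [← S.R_inner (hNM hy)]
        exact hx _ (hU _ (star_mem hy) u hu)
      obtain ⟨G', gG', g', hg', g0⟩ := good_extend S hω hn hf hNM (V1 := V1 ⊓ U1ᗮ) (V2 := V2 ⊓ U2ᗮ)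
        (hV1.inter U1.isClosed_orthogonal) (hV2.inter U2.isClosed_orthogonal) (inf_le_left.trans hV2N)
        (fun y hy ξ hξ => ⟨h1 y hy ξ hξ.1, Oinv U1 Uinv1 y hy ξ hξ.2⟩)
        (fun y hy ξ hξ => ⟨h2 y hy ξ hξ.1, Oinv U2 Uinv2 y hy ξ hξ.2⟩)
        ⟨x, ⟨hx, (Submodule.mem_orthogonal _ _).2 hxo⟩, x0⟩ ⟨y, ⟨hy, (Submodule.mem_orthogonal _ _).2 hyo⟩, y0⟩
      have gs : Good N R V1 V2 (G ⊔ G') := by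
        refine ⟨fun g hg => ?_, fun y hy g hg => ?_⟩
        · obtain ⟨a, ha, b, hb, rfl⟩ := Submodule.mem_sup.1 hg
          obtain ⟨a1, a2, a3⟩ := gG.1 a ha
          obtain ⟨b1, b2, b3⟩ := gG'.1 b hb
          refine ⟨add_mem a1 b1.1, add_mem a2 b2.1, ?_⟩
          have i1 : inner ℂ a.fst b.fst = 0 := (Submodule.mem_orthogonal _ _).1 b1.2 _ (u1 a ha)
          have i2 : inner ℂ a.snd b.snd = 0 := (Submodule.mem_orthogonal _ _).1 b2.2 _ (u2 a ha)
          have e1 := norm_add_sq_eq_norm_sq_add_norm_sq_of_inner_eq_zero _ _ i1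
          have e2 := norm_add_sq_eq_norm_sq_add_norm_sq_of_inner_eq_zero _ _ i2
          rw [a3, b3, ← e2] at e1
          exact (mul_self_inj (norm_nonneg _) (norm_nonneg _)).1 e1
        · obtain ⟨a, ha, b, hb, rfl⟩ := Submodule.mem_sup.1 hg
          have := Submodule.add_mem_sup (gG.2 y hy a ha) (gG'.2 y hy b hb)
          convert this using 1
          refine hs_ext ?_ ?_ <;> simp
      have hle : G ⊔ G' ≤ G := hG.2 gs le_sup_left
      have hgG : g' ∈ G := hle (Submodule.mem_sup_right hg')
      have := (Submodule.mem_orthogonal _ _).1 (gG'.1 g' hg').2.1.2 _ (u2 g' hgG)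
      exact g0 (inner_self_eq_zero.1 this)
    rcases dich with hd | hd
    · left
      intro ξ hξ
      have hξU : ξ ∈ U1.topologicalClosure := by
        refine mem_of_pr_eq ?_
        have := hd (ξ - pr U1 ξ) (sub_mem hξ (cU1 (pr_mem _ _))) fun u hu =>
          pr_sub_orth _ (U1.le_topologicalClosure hu)
        exact (sub_eq_zero.1 this).symm
      have : closure (U1 : Set K) ⊆ {ξ | ContinuousLinearMap.adjoint W (W ξ) = ξ} := by
        refine closure_minimal ?_ (isClosed_eq (by fun_prop) continuous_id)
        rintro _ ⟨g, hg, rfl⟩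
        change ContinuousLinearMap.adjoint W (W g.fst) = g.fst
        rw [w1 g hg, w2 g hg]
      exact this hξU
    · right
      intro ξ hξ
      have hξU : ξ ∈ U2.topologicalClosure := by
        refine mem_of_pr_eq ?_
        have := hd (ξ - pr U2 ξ) (sub_mem hξ (cU2 (pr_mem _ _))) fun u hu =>
          pr_sub_orth _ (U2.le_topologicalClosure hu)
        exact (sub_eq_zero.1 this).symm
      have : closure (U2 : Set K) ⊆ {ξ | W (ContinuousLinearMap.adjoint W ξ) = ξ} := by
        refine closure_minimal ?_ (isClosed_eq (by fun_prop) continuous_id)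
        rintro _ ⟨g, hg, rfl⟩
        change W (ContinuousLinearMap.adjoint W g.snd) = g.snd
        rw [w2 g hg, w1 g hg]
      exact this hξU

end compar

section findi
variable {H : Type u} [NormedAddCommGroup H] [InnerProductSpace ℂ H] [CompleteSpace H]
variable {M N Mω : VonNeumannAlgebra H} {τ : Op H →ₗ[ℂ] ℂ} {K : Type u} [NormedAddCommGroup K]
    [InnerProductSpace ℂ K] [CompleteSpace K] {vec : Op H →ₗ[ℂ] K} {L R : Op H → (K →L[ℂ] K)}
variable {ω : Ultrafilter ℕ} {limω : (ℕ → Op H) → Op H}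

theorem cut_ne (S : IsStd M τ vec L R) (hω : IsFreeUltrafilter ω) (hn : Nrml ω M τ)
    (hf : relComm (M : Set (Op H)) M = scalars H) {e p : Op H} (heM : e ∈ M) (hep : IsProjection e)
    (hpM : p ∈ M) (hpp : IsProjection p) (hp0 : p ≠ 0) (h1 : e * p = p) (h2 : p * e = p)
    {V : Submodule ℂ K} (hne : ∃ ξ ∈ V, ξ ≠ 0) (hVe : ∀ ξ ∈ V, L e ξ = ξ)
    (hVL : ∀ x ∈ M, e * x = x → x * e = x → ∀ ξ ∈ V, L x ξ ∈ V) :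
    ∃ ξ ∈ V, L p ξ = ξ ∧ ξ ≠ 0 := by
  by_contra hc
  push Not at hc
  have hz : ∀ ξ ∈ V, L p ξ = 0 := fun ξ hξ => hc _ (hVL p hpM h1 h2 ξ hξ) (by
    rw [S.L_mul hpM hpM, hpp.2.eq])
  let U : Submodule ℂ K := Submodule.span ℂ {ζ | ∃ x ∈ M, ∃ y ∈ M, ζ = vec (x * p * y)}
  have inv : ∀ T : K →L[ℂ] K, (∀ x ∈ M, ∀ y ∈ M, T (vec (x * p * y)) ∈ U) →
      ∀ ζ ∈ U, T ζ ∈ U.topologicalClosure := by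
    intro T hT ζ hζ
    have : U ≤ U.comap (T : K →ₗ[ℂ] K) := by
      refine Submodule.span_le.2 ?_
      rintro _ ⟨n, hn, η, hη, rfl⟩
      exact hT n hn η hη
    exact U.le_topologicalClosure (this hζ)
  have hv := bimodule S subset_rfl hω hn hf U (fun ξ _ => mem_closure_top S (fun x hx =>
    (l2 vec M).le_topologicalClosure (vec_mem_l2 hx)) ξ)
    (fun z hz => inv (L z) fun x hx y hy => by
      rw [S.Lvec z hz _ (mul_mem (mul_mem hx hpM) hy)]
      exact Submodule.subset_span ⟨z * x, mul_mem hz hx, y, hy, by simp only [mul_assoc]⟩)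
    (fun z hz => inv (R z) fun x hx y hy => by
      rw [S.Rvec z hz _ (mul_mem (mul_mem hx hpM) hy)]
      exact Submodule.subset_span ⟨x, hx, y * z, mul_mem hy hz, by simp only [mul_assoc]⟩)
    ⟨vec (1 * p * 1), Submodule.subset_span ⟨1, one_mem _, 1, one_mem _, rfl⟩, fun h => hp0 (by
      rw [one_mul, mul_one] at h
      exact S.eq_zero hpM h)⟩
  obtain ⟨ξ, hξ, ξ0⟩ := hne
  apply ξ0
  refine S.ext_inner fun m hm => ?_
  rw [inner_zero_left, S.vec_eq' hm, ← S.R_inner hm]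
  have e3 : ∀ u ∈ U, inner ℂ u (R (star m) ξ) = 0 := by
    intro u hu
    have : U ≤ (LinearMap.ker (innerSL ℂ (R (star m) ξ) : K →ₗ[ℂ] ℂ)) := by
      refine Submodule.span_le.2 ?_
      rintro _ ⟨x, hx, y, hy, rfl⟩
      change inner ℂ (R (star m) ξ) (vec (x * p * y)) = 0
      rw [S.R_inner hm, S.Rvec m hm _ (mul_mem (mul_mem hx hpM) hy), ← hVe ξ hξ,
        ← hep.1.star_eq, S.L_inner heM, S.Lvec e heM _ (mul_mem (mul_mem (mul_mem hx hpM) hy) hm),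
        show e * (x * p * y * m) = (e * x * p) * (y * m) by simp only [mul_assoc],
        ← S.Lvec _ (mul_mem (mul_mem heM hx) hpM) _ (mul_mem hy hm),
        ← S.L_inner (mul_mem (mul_mem heM hx) hpM)]
      have : star (e * x * p) = p * (e * star x * e) := by
        rw [star_mul, star_mul, hep.1.star_eq, hpp.1.star_eq, ← mul_assoc, ← mul_assoc, ← mul_assoc, h2]
      have hm2 : e * star x * e ∈ M := mul_mem (mul_mem heM (star_mem hx)) heM
      rw [this, ← S.L_mul hpM hm2, hz, inner_zero_left]
      refine hVL _ hm2 ?_ ?_ _ hξ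
      · rw [← mul_assoc, ← mul_assoc, hep.2.eq]
      · rw [mul_assoc _ e e, hep.2.eq]
    have h3 : inner ℂ (R (star m) ξ) u = 0 := this hu
    rw [← inner_conj_symm, h3, map_zero]
  rw [← inner_conj_symm, closure_orth e3 _ hv, map_zero]

theorem bessel (S : IsStd M τ vec L R) {n : ℕ} {p : Fin n → Op H} (hp : ∀ i, p i ∈ M ∧ IsProjection (p i))
    (ho : ∀ i j, i ≠ j → p i * p j = 0) (η : K) : ∑ i, ‖L (p i) η‖ ^ 2 ≤ ‖η‖ ^ 2 := by
  have L0 : ∀ ξ, L 0 ξ = 0 := fun ξ => by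
    have := S.L_smul (one_mem M) 0 ξ
    rwa [zero_smul, zero_smul] at this
  have h1 : ∀ i ξ, inner ℂ (L (p i) η) ξ = inner ℂ η (L (p i) ξ) := fun i ξ => by
    have := S.L_inner (hp i).1 η ξ
    rwa [(hp i).2.1.star_eq] at this
  have h2 : ∀ i, inner ℂ (L (p i) η) η = ((‖L (p i) η‖ ^ 2 : ℝ) : ℂ) := fun i => by
    have := h1 i (L (p i) η)
    rw [S.L_mul (hp i).1 (hp i).1, (hp i).2.2.eq, ← h1, inner_self_eq_norm_sq_to_K] at this
    rw [← this]; simp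
  set ζ := ∑ i, L (p i) η
  have h3 : inner ℂ ζ η = ((∑ i, ‖L (p i) η‖ ^ 2 : ℝ) : ℂ) := by
    rw [sum_inner, Complex.ofReal_sum]
    exact Finset.sum_congr rfl fun i _ => h2 i
  have h4 : inner ℂ ζ ζ = ((∑ i, ‖L (p i) η‖ ^ 2 : ℝ) : ℂ) := by
    rw [sum_inner, Complex.ofReal_sum]
    refine Finset.sum_congr rfl fun i _ => ?_
    rw [inner_sum, Finset.sum_eq_single i]
    · rw [inner_self_eq_norm_sq_to_K]; simp
    · intro j _ hj
      rw [h1, S.L_mul (hp i).1 (hp j).1, ho i j hj.symm, L0, inner_zero_right]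
    · simp
  have h5 : ‖ζ‖ ^ 2 = ∑ i, ‖L (p i) η‖ ^ 2 := by
    rw [inner_self_eq_norm_sq_to_K] at h4
    exact Complex.ofReal_injective (by rw [← h4]; simp)
  have h6 := norm_inner_le_norm (𝕜 := ℂ) ζ η
  rw [h3, ← h5, Complex.norm_real, Real.norm_of_nonneg (by positivity)] at h6
  rw [← h5]
  by_cases hz : ‖ζ‖ = 0
  · rw [hz]; simp
  · have : 0 < ‖ζ‖ := lt_of_le_of_ne (norm_nonneg _) (Ne.symm hz)
    have : ‖ζ‖ ≤ ‖η‖ := by nlinarith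
    gcongr

theorem coiso_bound (S : IsStd M τ vec L R) (hω : IsFreeUltrafilter ω) (hn : Nrml ω M τ)
    (hNM : (N : Set (Op H)) ⊆ (M : Set (Op H))) {p : Op H} (hpM : p ∈ M) (hpp : IsProjection p) {W : K →L[ℂ] K}
    (w1 : ∀ ξ, W ξ ∈ (l2 vec N).topologicalClosure)
    (w2 : ∀ ξ, L p (ContinuousLinearMap.adjoint W ξ) = ContinuousLinearMap.adjoint W ξ)
    (w3 : ∀ y ∈ N, ∀ ξ, W (R y ξ) = R y (W ξ))
    (w4 : ∀ ξ ∈ (l2 vec N).topologicalClosure, W (ContinuousLinearMap.adjoint W ξ) = ξ) {x : Op H} (hx : x ∈ M) :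
    ‖pr (l2 vec N) (L x (ContinuousLinearMap.adjoint W (vec 1)))‖ ≤ ‖L p (vec (star x))‖ := by
  have w3' : ∀ y ∈ N, ∀ ξ, ContinuousLinearMap.adjoint W (R y ξ) = R y (ContinuousLinearMap.adjoint W ξ) := by
    intro y hy ξ
    refine ext_inner_right ℂ fun v => ?_
    have h1 : inner ℂ (R y (ContinuousLinearMap.adjoint W ξ)) v = inner ℂ (ContinuousLinearMap.adjoint W ξ) (R (star y) v) := by
      rw [← S.R_inner (star_mem (hNM hy)), star_star]
    have h2 : inner ℂ (R y ξ) (W v) = inner ℂ ξ (R (star y) (W v)) := by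
      rw [← S.R_inner (star_mem (hNM hy)), star_star]
    rw [h1, ContinuousLinearMap.adjoint_inner_left, ContinuousLinearMap.adjoint_inner_left, h2, w3 _ (star_mem hy)]
  obtain ⟨n, hnN, hnv⟩ := left_bounded S hNM hω hn (pr_mem (l2 vec N) (L x (ContinuousLinearMap.adjoint W (vec 1))))
    (C := ‖L x‖ * ‖ContinuousLinearMap.adjoint W‖) (by positivity) (fun y hy => by
      rw [← eN_comm S hNM hy, ← S.L_R hx (hNM hy), ← w3' y hy, ← S.vec_eq' (hNM hy)]
      refine (pr_norm _ _).trans (((L x).le_opNorm _).trans ?_)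
      rw [mul_assoc]
      gcongr
      exact ContinuousLinearMap.le_opNorm _ _)
  have hnM := hNM hnN
  have key : inner ℂ (vec (star n)) (vec (star n)) = inner ℂ (W (vec (star x))) (vec (star n)) := by
    have e1 : inner ℂ (vec (star n)) (vec (star n)) = inner ℂ (vec n) (vec n) := by
      rw [S.inner _ (star_mem hnM) _ (star_mem hnM), S.inner _ hnM _ hnM, star_star, S.tr.tracial _ hnM _ (star_mem hnM)]
    rw [e1]
    nth_rw 2 [hnv]
    rw [← pr_inner, pr_eq' (vec_mem_l2 hnN)]
    have e2 : inner ℂ (vec n) (L x (ContinuousLinearMap.adjoint W (vec 1))) = inner ℂ (vec (star x * n)) (ContinuousLinearMap.adjoint W (vec 1)) := by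
      rw [← S.L_inner hx, S.Lvec _ (star_mem hx) _ hnM]
    rw [e2, ContinuousLinearMap.adjoint_inner_right, ← S.Rvec n hnM _ (star_mem hx), w3 n hnN]
    have := S.R_inner (star_mem hnM) (W (vec (star x))) (vec 1)
    rw [star_star] at this
    rw [this, ← S.vec_eq' (star_mem hnM)]
  have b1 : ‖vec n‖ ≤ ‖W (vec (star x))‖ := by
    rw [← S.norm_star hnM]
    have h6 := norm_inner_le_norm (𝕜 := ℂ) (W (vec (star x))) (vec (star n))
    rw [← key, inner_self_eq_norm_sq_to_K] at h6
    simp only [norm_pow, RCLike.norm_ofReal, abs_norm] at h6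
    by_cases hz : ‖vec (star n)‖ = 0
    · rw [hz]; positivity
    · have : 0 < ‖vec (star n)‖ := lt_of_le_of_ne (norm_nonneg _) (Ne.symm hz)
      nlinarith
  rw [← hnv]
  refine b1.trans ?_
  set η := vec (star x)
  have k1 : inner ℂ (W η) (W η) = inner ℂ (ContinuousLinearMap.adjoint W (W η)) (L p η) := by
    have := S.L_inner hpM (ContinuousLinearMap.adjoint W (W η)) η
    rw [← this, hpp.1.star_eq, w2, ContinuousLinearMap.adjoint_inner_left]
  have k2 : ‖ContinuousLinearMap.adjoint W (W η)‖ = ‖W η‖ := by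
    have : inner ℂ (ContinuousLinearMap.adjoint W (W η)) (ContinuousLinearMap.adjoint W (W η)) = inner ℂ (W η) (W η) := by
      rw [ContinuousLinearMap.adjoint_inner_left, w4 _ (w1 _)]
    rw [inner_self_eq_norm_sq_to_K, inner_self_eq_norm_sq_to_K] at this
    have h3 : ‖ContinuousLinearMap.adjoint W (W η)‖ ^ 2 = ‖W η‖ ^ 2 := by exact_mod_cast this
    exact (sq_eq_sq₀ (norm_nonneg _) (norm_nonneg _)).1 h3
  have h6 := norm_inner_le_norm (𝕜 := ℂ) (ContinuousLinearMap.adjoint W (W η)) (L p η)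
  rw [← k1, inner_self_eq_norm_sq_to_K, k2] at h6
  simp only [norm_pow, RCLike.norm_ofReal, abs_norm] at h6
  by_cases hz : ‖W η‖ = 0
  · rw [hz]; positivity
  · have : 0 < ‖W η‖ := lt_of_le_of_ne (norm_nonneg _) (Ne.symm hz)
    nlinarith

theorem stepE (S : IsStd M τ vec L R) (hω : IsFreeUltrafilter ω) (hn : Nrml ω M τ)
    (hf : relComm (M : Set (Op H)) M = scalars H) (hfN : relComm (N : Set (Op H)) N = scalars H)
    (hNM : (N : Set (Op H)) ⊆ (M : Set (Op H)))
    (hE : ¬ CornerEmbeds (M : Set (Op H)) (N : Set (Op H)) (M : Set (Op H)))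
    {e : Op H} (heM : e ∈ M) (hep : IsProjection e)
    {V : Submodule ℂ K} {c B : ℝ} {T : K →L[ℂ] K} (hc : 0 < c) (hVc : IsClosed (V : Set K)) (hne : ∃ ξ ∈ V, ξ ≠ 0)
    (hVe : ∀ ξ ∈ V, L e ξ = ξ) (hVL : ∀ x ∈ M, e * x = x → x * e = x → ∀ ξ ∈ V, L x ξ ∈ V)
    (hVR : ∀ y ∈ N, ∀ ξ ∈ V, R y ξ ∈ V) (hVT : ∀ ξ ∈ V, c * ‖ξ‖ ^ 2 ≤ qf ξ T)
    (hB : ∀ (n : ℕ) (ξ : Fin n → K),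
        (∀ x ∈ M, ∑ i, ‖pr (l2 vec N) (L x (ξ i))‖ ^ 2 ≤ ‖vec x‖ ^ 2) →
        ∑ i, qf (ξ i) T ≤ B) :
    ∃ p ∈ M, IsProjection p ∧ p ≠ 0 ∧ ∃ V' : Submodule ℂ K, ∃ W : K →L[ℂ] K, (∃ ξ ∈ V', ξ ≠ 0) ∧
      (∀ ξ ∈ V', L p ξ = ξ) ∧ (∀ x ∈ M, p * x = x → x * p = x → ∀ ξ ∈ V', L x ξ ∈ V') ∧
      (∀ ξ, W ξ ∈ (l2 vec N).topologicalClosure) ∧ (∀ ξ, ContinuousLinearMap.adjoint W ξ ∈ V') ∧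
      (∀ y ∈ N, ∀ ξ, W (R y ξ) = R y (W ξ)) ∧ (∀ ξ ∈ V', ContinuousLinearMap.adjoint W (W ξ) = ξ) := by
  obtain ⟨n, hnB⟩ := exists_nat_gt (B / c)
  have he0 : e ≠ 0 := by
    rintro rfl
    obtain ⟨ξ, hξ, ξ0⟩ := hne
    have := S.L_smul (one_mem M) 0 ξ
    rw [zero_smul, zero_smul, hVe ξ hξ] at this
    exact ξ0 this
  obtain ⟨p, hp, ho⟩ := many_proj S.tr hE n heM hep he0
  let V' : Fin n → Submodule ℂ K := fun i => V ⊓ LinearMap.ker ((L (p i) - 1 : K →L[ℂ] K) : K →ₗ[ℂ] K)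
  have mV : ∀ i ξ, ξ ∈ V' i ↔ ξ ∈ V ∧ L (p i) ξ = ξ := fun i ξ => by
    refine and_congr Iff.rfl ?_
    change L (p i) ξ - ξ = 0 ↔ _
    exact sub_eq_zero
  have cV : ∀ i, IsClosed (V' i : Set K) := fun i => hVc.inter (L (p i) - 1 : K →L[ℂ] K).isClosed_ker
  have RN : ∀ y ∈ N, ∀ η ∈ (l2 vec N).topologicalClosure, R y η ∈ (l2 vec N).topologicalClosure := by
    intro n hn
    refine closure_invariant ?_
    rintro _ ⟨z, hz, rfl⟩
    rw [S.Rvec n (hNM hn) z (hNM hz)]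
    exact vec_mem_l2 (mul_mem hz hn)
  have hcomp := fun i => compare S hω hn hfN hNM (cV i) (l2 vec N).isClosed_topologicalClosure le_rfl
    (fun y hy ξ hξ => (mV i _).2 ⟨hVR y hy ξ ((mV i ξ).1 hξ).1, by
      rw [S.L_R (hp i).1 (hNM hy), ((mV i ξ).1 hξ).2]⟩) RN
  choose W w1 w2 w3 w4 using hcomp
  by_cases hall : ∀ i, ∀ ξ ∈ (l2 vec N).topologicalClosure, W i (ContinuousLinearMap.adjoint (W i) ξ) = ξ
  · exfalso
    have hq := hB n (fun i => ContinuousLinearMap.adjoint (W i) (vec 1)) (fun x hx => by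
      calc _ ≤ ∑ i, ‖L (p i) (vec (star x))‖ ^ 2 := by
            refine Finset.sum_le_sum fun i _ => ?_
            gcongr
            exact coiso_bound S hω hn hNM (hp i).1 (hp i).2.1 (w1 i) (fun ξ => ((mV i _).1 (w2 i ξ)).2) (w3 i) (hall i) hx
        _ ≤ _ := by
          rw [← S.norm_star hx]
          exact bessel S (fun i => ⟨(hp i).1, (hp i).2.1⟩) ho _)
    have hlow : ∀ i, c ≤ qf (ContinuousLinearMap.adjoint (W i) (vec 1)) T := fun i => by
      have h1 := hVT _ ((mV i _).1 (w2 i (vec 1))).1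
      have h2 : inner ℂ (ContinuousLinearMap.adjoint (W i) (vec 1)) (ContinuousLinearMap.adjoint (W i) (vec 1)) = inner ℂ (vec 1) (vec 1) := by
        rw [ContinuousLinearMap.adjoint_inner_left, hall i _ ((l2 vec N).le_topologicalClosure (vec_mem_l2 (one_mem N)))]
      rw [inner_self_eq_norm_sq_to_K, inner_self_eq_norm_sq_to_K, S.norm_one] at h2
      have h3 : ‖ContinuousLinearMap.adjoint (W i) (vec 1)‖ ^ 2 = 1 ^ 2 := by exact_mod_cast h2
      rw [h3] at h1
      simpa using h1
    have h3 : (n : ℝ) * c ≤ B := by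
      refine le_trans ?_ hq
      have := Finset.sum_le_sum (s := Finset.univ) fun i _ => hlow i
      simpa using this
    rw [div_lt_iff₀ hc] at hnB
    linarith
  · push Not at hall
    obtain ⟨i, hi⟩ := hall
    have w4' := (w4 i).resolve_right (by push Not; exact hi)
    obtain ⟨ξ, hξ, hξp, ξ0⟩ := cut_ne S hω hn hf heM hep (hp i).1 (hp i).2.1 (hp i).2.2.1 (hp i).2.2.2.1 (hp i).2.2.2.2 hne hVe hVL
    refine ⟨p i, (hp i).1, (hp i).2.1, (hp i).2.2.1, V' i, W i, ⟨ξ, (mV i ξ).2 ⟨hξ, hξp⟩, ξ0⟩,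
      fun ξ hξ => ((mV i ξ).1 hξ).2, fun x hx h1 h2 ξ hξ => (mV i _).2 ⟨hVL x hx ?_ ?_ ξ ((mV i ξ).1 hξ).1, ?_⟩, w1 i, w2 i, w3 i, w4'⟩
    · rw [← h1, ← mul_assoc, (hp i).2.2.2.1]
    · rw [← h2, mul_assoc, (hp i).2.2.2.2]
    · rw [S.L_mul (hp i).1 hx, h1]

end findi

section stepf
variable {H : Type u} [NormedAddCommGroup H] [InnerProductSpace ℂ H] [CompleteSpace H]
variable {M N Mω : VonNeumannAlgebra H} {τ : Op H →ₗ[ℂ] ℂ} {K : Type u} [NormedAddCommGroup K]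
    [InnerProductSpace ℂ K] [CompleteSpace K] {vec : Op H →ₗ[ℂ] K} {L R : Op H → (K →L[ℂ] K)}
variable {ω : Ultrafilter ℕ} {limω : (ℕ → Op H) → Op H}

theorem corner_left {p x : Op H} {P : Set (Op H)} (hp : IsProjection p) (hx : x ∈ corner p P) : p * x = x := by
  rw [← hx.2, ← mul_assoc, ← mul_assoc, hp.2.eq]

theorem corner_right {p x : Op H} {P : Set (Op H)} (hp : IsProjection p) (hx : x ∈ corner p P) : x * p = x := by
  rw [← hx.2, mul_assoc, hp.2.eq]

theorem stepF1 (S : IsStd M τ vec L R) (hω : IsFreeUltrafilter ω) (hn : Nrml ω M τ)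
    (hNM : (N : Set (Op H)) ⊆ (M : Set (Op H))) {p : Op H} (hpM : p ∈ M) (hpp : IsProjection p)
    {V' : Submodule ℂ K} {W : K →L[ℂ] K} (hne : ∃ ξ ∈ V', ξ ≠ 0)
    (hVp : ∀ ξ ∈ V', L p ξ = ξ) (hVL : ∀ x ∈ M, p * x = x → x * p = x → ∀ ξ ∈ V', L x ξ ∈ V')
    (w1 : ∀ ξ, W ξ ∈ (l2 vec N).topologicalClosure) (w2 : ∀ ξ, ContinuousLinearMap.adjoint W ξ ∈ V')
    (w3 : ∀ y ∈ N, ∀ ξ, W (R y ξ) = R y (W ξ)) (w4 : ∀ ξ ∈ V', ContinuousLinearMap.adjoint W (W ξ) = ξ) :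
    ∃ ξ : K, ξ ≠ 0 ∧ L p ξ = ξ ∧ ∃ q ∈ N, IsProjection q ∧ q ≠ 0 ∧ R q ξ = ξ ∧ ∃ θ : Op H → Op H,
      IsStarHomOn θ (corner p (M : Set (Op H))) (corner q (N : Set (Op H))) ∧ θ p = q ∧
      ∀ x ∈ corner p (M : Set (Op H)), L x ξ = R (θ x) ξ := by
  set J := ContinuousLinearMap.adjoint W with hJ
  have w3' : ∀ y ∈ N, ∀ ξ, J (R y ξ) = R y (J ξ) := by
    intro y hy ξ
    refine ext_inner_right ℂ fun v => ?_
    have h1 : inner ℂ (R y (J ξ)) v = inner ℂ (J ξ) (R (star y) v) := by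
      rw [← S.R_inner (star_mem (hNM hy)), star_star]
    have h2 : inner ℂ (R y ξ) (W v) = inner ℂ ξ (R (star y) (W v)) := by
      rw [← S.R_inner (star_mem (hNM hy)), star_star]
    rw [h1, hJ, ContinuousLinearMap.adjoint_inner_left, ContinuousLinearMap.adjoint_inner_left, h2, w3 _ (star_mem hy)]
  set ξ := J (vec 1) with hξ
  have hJv : ∀ y ∈ N, J (vec y) = R y ξ := fun y hy => by rw [S.vec_eq' (hNM hy), w3' y hy]
  have R0 : ∀ ξ, R 0 ξ = 0 := fun ξ => by
    have := S.R_smul (one_mem M) 0 ξ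
    rwa [zero_smul, zero_smul] at this
  have ξ0 : ξ ≠ 0 := by
    intro h0
    obtain ⟨ζ, hζ, ζ0⟩ := hne
    have h1 : closure (l2 vec N : Set K) ⊆ {η | J η = 0} := by
      refine closure_minimal ?_ (isClosed_eq (by fun_prop) continuous_const)
      rintro _ ⟨y, hy, rfl⟩
      change J (vec y) = 0
      rw [hJv y hy, h0, map_zero]
    apply ζ0
    rw [← w4 ζ hζ]
    exact h1 (w1 ζ)
  have hξp : L p ξ = ξ := hVp _ (w2 _)
  have hex : ∀ x ∈ corner p (M : Set (Op H)), ∃ n ∈ N, vec n = W (L x ξ) := by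
    intro x hx
    have hxM : x ∈ M := hx.1
    refine left_bounded S hNM hω hn (w1 _) (C := ‖W‖ * (‖L x‖ * ‖J‖)) (by positivity) fun y hy => ?_
    rw [← w3 y hy, ← S.L_R hxM (hNM hy), ← hJv y hy, mul_assoc, mul_assoc]
    refine (W.le_opNorm _).trans ?_
    gcongr
    refine ((L x).le_opNorm _).trans ?_
    gcongr
    exact J.le_opNorm _
  choose! θ hθN hθv using hex
  have hθ : ∀ x ∈ corner p (M : Set (Op H)), L x ξ = R (θ x) ξ := fun x hx => by
    rw [← hJv _ (hθN x hx), hθv x hx]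
    exact (w4 _ (hVL x hx.1 (corner_left hpp hx) (corner_right hpp hx) _ (w2 _))).symm
  have cmul : ∀ x ∈ corner p (M : Set (Op H)), ∀ y ∈ corner p (M : Set (Op H)), x * y ∈ corner p (M : Set (Op H)) :=
    fun x hx y hy => ⟨mul_mem (S := VonNeumannAlgebra H) hx.1 hy.1, by
      rw [← mul_assoc, corner_left hpp hx, mul_assoc, corner_right hpp hy]⟩
  have cstar : ∀ x ∈ corner p (M : Set (Op H)), star x ∈ corner p (M : Set (Op H)) :=
    fun x hx => ⟨star_mem (S := VonNeumannAlgebra H) hx.1, by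
      have := congrArg star hx.2
      rwa [star_mul, star_mul, hpp.1.star_eq, ← mul_assoc] at this⟩
  have hmul : ∀ x ∈ corner p (M : Set (Op H)), ∀ y ∈ corner p (M : Set (Op H)), θ (x * y) = θ x * θ y := by
    intro x hx y hy
    have hxM : x ∈ M := hx.1
    have hyM : y ∈ M := hy.1
    refine S.inj (hNM (hθN _ (cmul x hx y hy))) (hNM (mul_mem (hθN x hx) (hθN y hy))) ?_
    rw [hθv _ (cmul x hx y hy), ← S.L_mul hxM hyM, hθ y hy, S.L_R hxM (hNM (hθN y hy)), w3 _ (hθN y hy),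
      ← hθv x hx, S.Rvec _ (hNM (hθN y hy)) _ (hNM (hθN x hx))]
  have hstar : ∀ x ∈ corner p (M : Set (Op H)), θ (star x) = star (θ x) := by
    intro x hx
    have hxM : x ∈ M := hx.1
    have a1 := hNM (hθN x hx)
    have a2 := hNM (hθN _ (cstar x hx))
    have key : ∀ y ∈ N, inner ℂ (vec y) (vec (θ x)) = inner ℂ (vec y) (vec (star (θ (star x)))) := by
      intro y hy
      have e1 : vec (θ (star x) * y) = W (L (star x) (J (vec y))) := by
        rw [hJv y hy, S.L_R (star_mem hxM) (hNM hy), w3 y hy, ← hθv _ (cstar x hx), S.Rvec _ (hNM hy) _ a2]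
      have e2 : inner ℂ (vec (θ (star x) * y)) (vec 1) = inner ℂ (vec y) (vec (star (θ (star x)))) := by
        rw [S.inner _ (mul_mem a2 (hNM hy)) _ (one_mem M), S.inner _ (hNM hy) _ (star_mem a2), star_mul, mul_one]
      have e3 : inner ℂ (vec y) (W (L x ξ)) = inner ℂ (J (vec y)) (L x ξ) :=
        (ContinuousLinearMap.adjoint_inner_left W _ _).symm
      have e4 : inner ℂ (W (L (star x) (J (vec y)))) (vec 1) = inner ℂ (L (star x) (J (vec y))) ξ :=
        (ContinuousLinearMap.adjoint_inner_right W _ _).symm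
      rw [← e2, e1, hθv x hx, e3, e4, S.L_inner hxM]
    have d : θ x - star (θ (star x)) ∈ N := sub_mem (hθN x hx) (star_mem (hθN _ (cstar x hx)))
    have h0 := key _ d
    rw [← sub_eq_zero, ← inner_sub_right, ← map_sub, inner_self_eq_zero] at h0
    have := sub_eq_zero.1 (S.eq_zero (hNM d) h0)
    rw [this, star_star]
  have hpc : p ∈ corner p (M : Set (Op H)) := ⟨hpM, by rw [hpp.2.eq, hpp.2.eq]⟩
  have hRq : R (θ p) ξ = ξ := by rw [← hθ p hpc, hξp]
  refine ⟨ξ, ξ0, hξp, θ p, hθN p hpc, ⟨?_, ?_⟩, ?_, hRq, θ, ⟨?_, ?_, hmul, ?_, hstar⟩, rfl, hθ⟩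
  · have := hstar p hpc
    rw [hpp.1.star_eq] at this
    exact this.symm
  · have := hmul p hpc p hpc
    rw [hpp.2.eq] at this
    exact this.symm
  · intro h
    rw [h, R0] at hRq
    exact ξ0 hRq.symm
  · intro x hx
    refine ⟨hθN x hx, ?_⟩
    rw [← hmul p hpc x hx, corner_left hpp hx, ← hmul x hx p hpc, corner_right hpp hx]
  · intro x hx y hy
    have hxM : x ∈ M := hx.1
    have hyM : y ∈ M := hy.1
    have hxy : x + y ∈ corner p (M : Set (Op H)) := ⟨add_mem (S := VonNeumannAlgebra H) hx.1 hy.1, by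
      rw [mul_add, add_mul, hx.2, hy.2]⟩
    refine S.inj (hNM (hθN _ hxy)) (hNM (add_mem (hθN x hx) (hθN y hy))) ?_
    rw [hθv _ hxy, S.L_add hxM hyM, map_add, map_add, hθv x hx, hθv y hy]
  · intro c x hx
    have hxM : x ∈ M := hx.1
    have hcx : c • x ∈ corner p (M : Set (Op H)) := ⟨vn_smul M hx.1 c, by
      rw [mul_smul_comm, smul_mul_assoc, hx.2]⟩
    refine S.inj (hNM (hθN _ hcx)) (hNM (vn_smul N (hθN x hx) c)) ?_
    rw [hθv _ hcx, S.L_smul hxM, map_smul, map_smul, hθv x hx]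

theorem closab (S : IsStd M τ vec L R) (hω : IsFreeUltrafilter ω) (hn : Nrml ω M τ) {ξ : K}
    (h : ∀ k : ℕ, ∃ y ∈ M, ‖vec y‖ ≤ (1/4)^k ∧ ‖R y ξ - ξ‖ ≤ (1/4)^k) : ξ = 0 := by
  choose y hy h3 h4 using h
  obtain ⟨a, ha, hasa, ha1, had, -, -, hat⟩ := egorov hω S.tr hn y hy (fun k => by
    rw [← S.norm_sq (hy k)]
    calc _ ≤ ((1/4 : ℝ)^k)^2 := by gcongr; exact h3 k
      _ = _ := by rw [← pow_mul, mul_comm, pow_mul]; norm_num)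
  have ha0 : ∀ n, R (a n) ξ = 0 := fun n => by
    rw [← norm_le_zero_iff]
    refine pow_lim_zero (C := ‖ξ‖ + 1) n fun k hk => ?_
    have e : R (a n) ξ = R (y k * a n) ξ - R (a n) (R (y k) ξ - ξ) := by
      rw [map_sub, S.R_mul (ha n) (hy k)]; abel
    rw [e, mul_add, mul_one]
    refine (norm_sub_le _ _).trans (add_le_add ?_ ?_)
    · exact ((R (y k * a n)).le_opNorm ξ).trans (by
        gcongr; exact (S.Rnorm _ (mul_mem (hy k) (ha n))).trans (had n k hk))
    · refine ((R (a n)).le_opNorm _).trans ?_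
      calc _ ≤ 1 * (1/4 : ℝ)^k := by gcongr; exact (S.Rnorm _ (ha n)).trans (ha1 n); exact h4 k
        _ ≤ _ := by rw [one_mul]; gcongr; norm_num
  have hv : Tendsto (fun n => vec (a n)) atTop (nhds (vec 1)) := by
    rw [tendsto_iff_norm_sub_tendsto_zero]
    have h1 : Tendsto (fun n => Real.sqrt ((τ (star (1 - a n) * (1 - a n))).re)) atTop (nhds 0) := by
      have := (Real.continuous_sqrt.tendsto 0).comp hat
      rwa [Real.sqrt_zero] at this
    refine h1.congr fun n => ?_
    rw [← S.norm_sq (sub_mem (one_mem M) (ha n)), Real.sqrt_sq (norm_nonneg _), map_sub, norm_sub_rev]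
  refine S.ext_inner fun m hm => ?_
  rw [inner_zero_left]
  have h5 : Tendsto (fun n => (inner ℂ ξ (L m (vec (a n))) : ℂ)) atTop (nhds (inner ℂ ξ (L m (vec 1)))) :=
    tendsto_const_nhds.inner (((L m).continuous.tendsto _).comp hv)
  rw [← S.vec_eq hm] at h5
  refine tendsto_nhds_unique h5 (tendsto_const_nhds.congr fun n => ?_)
  rw [S.Lvec m hm _ (ha n), ← S.Rvec _ (ha n) m hm, ← S.R_inner (ha n), (hasa n).star_eq, ha0, inner_zero_left]

theorem stepF2 (S : IsStd M τ vec L R) (hω : IsFreeUltrafilter ω) (hn : Nrml ω M τ)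
    (hNM : (N : Set (Op H)) ⊆ (M : Set (Op H))) {p q : Op H} (hpM : p ∈ M) (hpp : IsProjection p)
    {ξ : K} (ξ0 : ξ ≠ 0) (hqN : q ∈ N) (hqp : IsProjection q)
    (hRq : R q ξ = ξ) {θ : Op H → Op H}
    (hθ : IsStarHomOn θ (corner p (M : Set (Op H))) (corner q (N : Set (Op H))))
    (hθξ : ∀ x ∈ corner p (M : Set (Op H)), L x ξ = R (θ x) ξ) :
    ∃ b0 ∈ M, b0 ≠ 0 ∧ b0 * q = b0 ∧ ∀ x ∈ corner p (M : Set (Op H)), x * b0 = b0 * θ x := by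
  have hqM := hNM hqN
  let G : Submodule ℂ (HS K K) :=
    { carrier := {g | ∃ y ∈ M, g = pp (vec (q * y)) (R y ξ)}
      zero_mem' := ⟨0, zero_mem M, by
        have := S.R_smul (one_mem M) 0 ξ
        rw [zero_smul, zero_smul] at this
        rw [this, mul_zero, map_zero]; rfl⟩
      add_mem' := by
        rintro _ _ ⟨a, ha, rfl⟩ ⟨b, hb, rfl⟩
        exact ⟨a + b, add_mem ha hb, by rw [S.R_add ha hb, mul_add, map_add]; rfl⟩
      smul_mem' := by
        rintro c _ ⟨a, ha, rfl⟩
        exact ⟨c • a, vn_smul M ha c, by rw [S.R_smul ha, mul_smul_comm, map_smul]; rfl⟩ }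
  have hG : ∀ y ∈ M, pp (vec (q * y)) (R y ξ) ∈ G := fun y hy => ⟨y, hy, rfl⟩
  have invR : ∀ m ∈ M, ∀ g ∈ G, pp (R m g.fst) (R m g.snd) ∈ G.topologicalClosure := by
    rintro m hm _ ⟨y, hy, rfl⟩
    refine G.le_topologicalClosure ?_
    convert hG (y * m) (mul_mem hy hm) using 1
    refine hs_ext ?_ ?_
    · change R m (vec (q * y)) = vec (q * (y * m))
      rw [S.Rvec m hm _ (mul_mem hqM hy), mul_assoc]
    · exact S.R_mul hm hy ξ
  have hc : ∀ x ∈ corner p (M : Set (Op H)), θ x ∈ M := fun x hx => hNM (hθ.1 x hx).1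
  have cstar : ∀ x ∈ corner p (M : Set (Op H)), star x ∈ corner p (M : Set (Op H)) :=
    fun x hx => ⟨star_mem (S := VonNeumannAlgebra H) hx.1, by
      have := congrArg star hx.2
      rwa [star_mul, star_mul, hpp.1.star_eq, ← mul_assoc] at this⟩
  have invL : ∀ x ∈ corner p (M : Set (Op H)), ∀ g ∈ G, pp (L (θ x) g.fst) (L x g.snd) ∈ G.topologicalClosure := by
    rintro x hx _ ⟨y, hy, rfl⟩
    have hxM : x ∈ M := hx.1
    refine G.le_topologicalClosure ?_
    convert hG (θ x * y) (mul_mem (hc x hx) hy) using 1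
    refine hs_ext ?_ ?_
    · change L (θ x) (vec (q * y)) = vec (q * (θ x * y))
      rw [S.Lvec _ (hc x hx) _ (mul_mem hqM hy), ← mul_assoc, ← mul_assoc, corner_left hqp (hθ.1 x hx),
        corner_right hqp (hθ.1 x hx)]
    · change L x (R y ξ) = R (θ x * y) ξ
      rw [← S.R_mul hy (hc x hx), ← hθξ x hx, S.L_R hxM hy]
  set b := offd G with hb
  have bR : ∀ m ∈ M, ∀ η, b (R m η) = R m (b η) := fun m hm η =>
    offd_comm (invR m hm) (by rw [S.R_adj hm]; exact invR _ (star_mem hm)) η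
  have bL : ∀ x ∈ corner p (M : Set (Op H)), ∀ η, b (L (θ x) η) = L x (b η) := fun x hx η =>
    offd_comm (invL x hx) (by
      rw [S.L_adj hx.1, S.L_adj (hc x hx), ← hθ.2.2.2.2 x hx]; exact invL _ (cstar x hx)) η
  obtain ⟨b0, hb0, hbv⟩ := left_bounded S subset_rfl hω hn (mem_closure_top S (fun x hx =>
    (l2 vec M).le_topologicalClosure (vec_mem_l2 hx)) (b (vec 1))) (C := ‖b‖) (norm_nonneg _) (fun y hy => by
      rw [← bR y hy, ← S.vec_eq' hy]
      exact b.le_opNorm _)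
  have bvec : ∀ y ∈ M, b (vec y) = vec (b0 * y) := fun y hy => by
    rw [S.vec_eq' hy, bR y hy, ← hbv, S.Rvec y hy b0 hb0]
  refine ⟨b0, hb0, ?_, ?_, ?_⟩
  · intro h0
    apply ξ0
    have hbz : b = 0 := ContinuousLinearMap.ext fun η =>
      S.ext (T := b) (T' := 0) (fun x hx => by rw [bvec x hx, h0, zero_mul, map_zero]; rfl) η
    have h1 := offd_zero hbz (hG 1 (one_mem M))
    refine closab S hω hn fun k => ?_
    obtain ⟨_, ⟨y, hy, rfl⟩, h⟩ := Metric.mem_closure_iff.1 h1 ((1/4)^k) (by positivity)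
    rw [dist_comm, dist_eq_norm] at h
    have e1 := (hs_fst_le _).trans h.le
    have e2 := (hs_snd_le _).trans h.le
    refine ⟨q * y, mul_mem hqM hy, ?_, ?_⟩
    · change ‖vec (q * y) - 0‖ ≤ _ at e1
      rwa [sub_zero] at e1
    · change ‖R y ξ - R 1 ξ‖ ≤ _ at e2
      rw [S.R_one] at e2
      rwa [← S.R_mul hy hqM, hRq]
  · have : b (vec (1 - q)) = 0 := by
      rw [hb, offd_apply, pr_zero]
      · rfl
      rintro _ ⟨y, hy, rfl⟩
      rw [hs_inner]
      change inner ℂ (vec (q * y)) (vec (1 - q)) + inner ℂ (R y ξ) (0 : K) = 0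
      rw [inner_zero_right, add_zero, S.inner _ (mul_mem hqM hy) _ (sub_mem (one_mem M) hqM), star_mul,
        mul_assoc, hqp.1.star_eq, mul_sub, hqp.2.eq, mul_one, sub_self, mul_zero, map_zero]
    rw [bvec _ (sub_mem (one_mem M) hqM), mul_sub, mul_one] at this
    exact (sub_eq_zero.1 (S.eq_zero (sub_mem hb0 (mul_mem hb0 hqM)) this)).symm
  · intro x hx
    have hxM : x ∈ M := hx.1
    refine S.inj (mul_mem hxM hb0) (mul_mem hb0 (hc x hx)) ?_
    rw [← bvec _ (hc x hx), S.vec_eq (hc x hx), bL x hx, ← hbv, S.Lvec x hxM b0 hb0]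

theorem stepF3 {p q b0 : Op H} (hpM : p ∈ M) (hpp : IsProjection p) (hp0 : p ≠ 0)
    (hqN : q ∈ N) (hqp : IsProjection q) (hq0 : q ≠ 0) {θ : Op H → Op H}
    (hθ : IsStarHomOn θ (corner p (M : Set (Op H))) (corner q (N : Set (Op H)))) (hθp : θ p = q)
    (hb0 : b0 ∈ M) (hb : b0 ≠ 0) (hbq : b0 * q = b0)
    (h : ∀ x ∈ corner p (M : Set (Op H)), x * b0 = b0 * θ x) :
    CornerEmbeds (M : Set (Op H)) (N : Set (Op H)) (M : Set (Op H)) := by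
  set X := star b0 with hX
  have cstar : ∀ x ∈ corner p (M : Set (Op H)), star x ∈ corner p (M : Set (Op H)) :=
    fun x hx => ⟨star_mem (S := VonNeumannAlgebra H) hx.1, by
      have := congrArg star hx.2
      rwa [star_mul, star_mul, hpp.1.star_eq, ← mul_assoc] at this⟩
  have hpc : p ∈ corner p (M : Set (Op H)) := ⟨hpM, by rw [hpp.2.eq, hpp.2.eq]⟩
  have hXx : ∀ x ∈ corner p (M : Set (Op H)), X * x = θ x * X := fun x hx => by
    have := congrArg star (h _ (cstar x hx))
    rwa [star_mul, star_mul, star_star, hθ.2.2.2.2 x hx, star_star] at this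
  have hqX : q * X = X := by
    have := congrArg star hbq
    rwa [star_mul, hqp.1.star_eq] at this
  have cabs : ∀ z : Op H, Commute (star X * X) z → Commute (CFC.abs X) z := fun z hz =>
    Commute.cfcₙ_nnreal hz _
  obtain ⟨v, v1, v2, v3, v4, v5, v6⟩ := graph_iso (pgraph X) (pgraph_iso X)
  have mG : ∀ η, pp (CFC.abs X η) (X η) ∈ pgraph X := fun η => ⟨η, rfl⟩
  have inv : ∀ z z' : Op H, z' * X = X * z → Commute (CFC.abs X) z →
      ∀ g ∈ pgraph X, pp (z g.fst) (z' g.snd) ∈ (pgraph X).topologicalClosure := by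
    rintro z z' h1 h2 _ ⟨η, rfl⟩
    refine (pgraph X).le_topologicalClosure ?_
    refine ⟨z η, ?_⟩
    have e1 := congrArg (fun Z : Op H => Z η) h1
    have e2 := congrArg (fun Z : Op H => Z η) h2.eq
    change z' (X η) = X (z η) at e1
    change CFC.abs X (z η) = z (CFC.abs X η) at e2
    rw [e2, ← e1]
    rfl
  have vx : ∀ x ∈ corner p (M : Set (Op H)), θ x * v = v * x := by
    have cx : ∀ x ∈ corner p (M : Set (Op H)), Commute (CFC.abs X) x := by
      intro x hx
      refine cabs x ?_
      change star X * X * x = x * (star X * X)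
      rw [hX, star_star, mul_assoc, hXx x hx, ← mul_assoc, ← mul_assoc, h x hx]
    intro x hx
    refine ContinuousLinearMap.ext fun η => ?_
    refine (v6 x (θ x) (inv _ _ (hXx x hx).symm (cx x hx)) ?_ η).symm
    rw [← ContinuousLinearMap.star_eq_adjoint, ← ContinuousLinearMap.star_eq_adjoint, ← hθ.2.2.2.2 x hx]
    exact inv _ _ (hXx _ (cstar x hx)).symm (cx _ (cstar x hx))
  have vM : v ∈ M := by
    rw [mem_vn_iff]
    have hXM : X ∈ M := star_mem hb0
    have c1 : ∀ y ∈ Set.centralizer (M : Set (Op H)), y * X = X * y := fun y hy =>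
      (Set.mem_centralizer_iff.1 hy X hXM).symm
    have c2 : ∀ y ∈ Set.centralizer (M : Set (Op H)), Commute (CFC.abs X) y := fun y hy =>
      cabs y (Set.mem_centralizer_iff.1 hy _ (mul_mem (S := VonNeumannAlgebra H) (star_mem hXM) hXM))
    intro y hy
    refine ContinuousLinearMap.ext fun η => ?_
    refine (v6 y y (inv _ _ (c1 y hy) (c2 y hy)) ?_ η).symm
    rw [← ContinuousLinearMap.star_eq_adjoint]
    have hy' := star_mem_centralizer M hy
    exact inv _ _ (c1 _ hy') (c2 _ hy')
  have v5' : v * star v * v = v := by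
    rw [ContinuousLinearMap.star_eq_adjoint]
    exact ContinuousLinearMap.ext fun η => v5 η
  have hqv : q * v = v := by
    have h1 : star v * (1 - q) = 0 := by
      refine ContinuousLinearMap.ext fun η => ?_
      rw [ContinuousLinearMap.star_eq_adjoint]
      refine v4 ((1 - q) η) ?_
      rintro _ ⟨ζ, rfl⟩
      change inner ℂ (X ζ) ((1 - q) η) = 0
      have e : (1 - q) * X = 0 := by rw [sub_mul, one_mul, hqX, sub_self]
      have e2 : star (1 - q) = 1 - q := by rw [star_sub, star_one, hqp.1.star_eq]
      rw [← e2, ContinuousLinearMap.star_eq_adjoint, ContinuousLinearMap.adjoint_inner_right]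
      have := congrArg (fun Z : Op H => Z ζ) e
      change (1 - q) (X ζ) = 0 at this
      rw [this, inner_zero_left]
    have h2 := congrArg star h1
    rw [star_mul, star_star, star_sub, star_one, hqp.1.star_eq, star_zero, sub_mul, one_mul] at h2
    exact (sub_eq_zero.1 h2).symm
  refine ⟨p, q, v, θ, hpM, hpp, hp0, hqN, hqp, hq0, hθ, vM, ?_, ⟨?_, ?_⟩, ?_, vx⟩
  · intro h0
    apply hb
    have : X = 0 := ContinuousLinearMap.ext fun η => by
      have := v1 _ (mG η)
      rw [h0] at this
      exact this.symm
    rw [← star_star b0, ← hX, this, star_zero]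
  · exact IsSelfAdjoint.star_mul_self v
  · change star v * v * (star v * v) = star v * v
    rw [mul_assoc, ← mul_assoc v, v5']
  · rw [hqv, ← vx p hpc, hθp, hqv]

end stepf

/-- Lemma 2.2. Let `ω` be a free ultrafilter on ℕ and `N ⊆ M` an
inclusion of hyperfinite II₁ factors. If no corner of `M` embeds into `N` inside `M`,
then no corner of the central sequence algebra `M' ∩ M^ω` embeds into `N^ω` inside `M^ω`.
In particular, if `M' ∩ M^ω ⊆ N^ω` then `M ≺_M N`. -/
theorem no_intertwining_of_central_sequences
    {H : Type u} [NormedAddCommGroup H] [InnerProductSpace ℂ H] [CompleteSpace H]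
    (ω : Ultrafilter ℕ) (hω : IsFreeUltrafilter ω)
    (M N Mω : VonNeumannAlgebra H) (τ : Op H →ₗ[ℂ] ℂ) (limω : (ℕ → Op H) → Op H)
    (hM : IsII1Factor M τ) (hN : IsII1Factor N τ)
    (hMhf : IsHyperfinite M) (hNhf : IsHyperfinite N)
    (hNM : (N : Set (Op H)) ⊆ (M : Set (Op H)))
    (hU : IsTracialUltrapower ω M Mω τ limω) :
    (¬ CornerEmbeds (M : Set (Op H)) (N : Set (Op H)) (M : Set (Op H)) →
      ¬ CornerEmbeds (relComm (M : Set (Op H)) (Mω : Set (Op H)))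
          (ultrapowerSet limω (N : Set (Op H))) (Mω : Set (Op H))) ∧
    (relComm (M : Set (Op H)) (Mω : Set (Op H)) ⊆ ultrapowerSet limω (N : Set (Op H)) →
      CornerEmbeds (M : Set (Op H)) (N : Set (Op H)) (M : Set (Op H))) := by
  have main : ¬ CornerEmbeds (M : Set (Op H)) (N : Set (Op H)) (M : Set (Op H)) →
      ¬ CornerEmbeds (relComm (M : Set (Op H)) (Mω : Set (Op H)))
          (ultrapowerSet limω (N : Set (Op H))) (Mω : Set (Op H)) := by
    intro h hE
    have hn := hU.nrml hω
    obtain ⟨K, i1, i2, i3, vec, L, R, S⟩ := exists_std hM.trace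
    obtain ⟨A, hmono, hA, hfd, hc⟩ := hMhf
    obtain ⟨m, w, hw, δ, hδ, hA1⟩ := stepA S hω hn hM.factor hmono hA hc hNM hU hE
    obtain ⟨T, hT, hTL, hTR, hTδ, hTB⟩ := stepB S hNM hmono hA hfd hω m hw hδ hA1
    have hT0 : T ≠ 0 := by
      rintro rfl
      have h1 : qf (vec (star w)) (0 : K →L[ℂ] K) = 0 := by simp [qf]
      rw [h1] at hTδ
      have : 0 < δ ^ 2 := by positivity
      linarith
    obtain ⟨e, heM, hep, S0, hS0, hS00, hS1, hS2, hS3⟩ := 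
      stepC S hω hn hM.factor hNM hmono hA hc hfd m hT hT0 hTL hTR
    obtain ⟨V, c, hc0, hVc, hVne, hVe, hVL, hVR, hVT⟩ := stepD S hNM heM hep hS0 hS00 hS1 hS2 hS3
    obtain ⟨p, hpM, hpp, hp0, V', W, g1, g2, g3, g4, g5, g6, g7⟩ := 
      stepE S hω hn hM.factor hN.factor hNM h heM hep hc0 hVc hVne hVe hVL hVR hVT hTB
    obtain ⟨ξ, ξ0, hξp, q, hqN, hqp, hq0, hRq, θ, hθ, hθp, hθξ⟩ := 
      stepF1 S hω hn hNM hpM hpp g1 g2 g3 g4 g5 g6 g7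
    obtain ⟨b0, hb0, hb, hbq, hbx⟩ := stepF2 S hω hn hNM hpM hpp ξ0 hqN hqp hRq hθ hθξ
    exact h (stepF3 hpM hpp hp0 hqN hqp hq0 hθ hθp hb0 hb hbq hbx)
  refine ⟨main, fun hsub => ?_⟩
  by_contra h
  refine main h ?_
  have h10 : (1 : Op H) ≠ 0 := by
    intro h1
    have := hM.trace.map_one
    rw [h1, map_zero] at this
    exact zero_ne_one this
  have hp1 : IsProjection (1 : Op H) := ⟨star_one _, mul_one _⟩
  have hr1 : (1 : Op H) ∈ relComm (M : Set (Op H)) (Mω : Set (Op H)) := 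
    ⟨one_mem Mω, fun y _ => by rw [mul_one, one_mul]⟩
  refine ⟨1, 1, 1, id, hr1, hp1, h10, hsub hr1, hp1, h10, 
    ⟨fun x hx => ⟨hsub hx.1, hx.2⟩, fun _ _ _ _ => rfl, fun _ _ _ _ => rfl, fun _ _ _ => rfl, fun _ _ => rfl⟩, 
    one_mem Mω, h10, ?_, ?_, fun x _ => ?_⟩
  · rw [star_one, one_mul]; exact hp1
  · rw [one_mul, one_mul]
  · rw [mul_one, one_mul]; rfl

end PopaQ
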